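/- There exists an absolute constant c > 0 with the following property. Let ν > 0, let u₀ ∈ L²(ℝ³;ℝ³) be divergence-free with ∫(1+|ξ|²)|𝓕u₀(ξ)|² dξ < ∞ (i.e. u₀ ∈ H¹(ℝ³)), let u be a Leray–Hopf weak solution of the Navier–Stokes equations with initial datum u₀, and let 0 < T < ∞. If there exists k > 0 such that for a.e. t ∈ (0,T) the high-frequency part (u(t))^k satisfies ‖(u(t))^k‖_{B^{−1}_{∞,∞}} ≤ cν, then u is regular in (0,T]. -/

import Mathlib

/-!
Common setup: the Fourier–Plancherel transform on `L²(ℝ³;ℂ)` (Mathlib's unitary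
Fourier transform with kernel `e^{-2πi x·ξ}`), characterized -- uniquely up to a.e.
equality -- by the multiplication formula against Schwartz functions; sharp
frequency cut-offs; Besov norms; and the notion of Leray–Hopf weak solution.
-/

noncomputable section

open MeasureTheory Real Complex Filter Function
open scoped ENNReal NNReal FourierTransform ComplexConjugate Classical

namespace NSE

abbrev V := EuclideanSpace ℝ (Fin 3)

/-- `IsFourierPair u v` says: `u, v ∈ L²(ℝ³;ℂ)` and `v` is (a version of) the
Fourier–Plancherel transform `𝓕u` of `u` (unitary Fourier transform, kernel
`e^{-2πi x·ξ}`), characterized by the multiplication formula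
`∫ v g = ∫ u 𝓕g` for all Schwartz functions `g`. -/
def IsFourierPair (u v : V → ℂ) : Prop :=
  MemLp u 2 volume ∧ MemLp v 2 volume ∧
    ∀ g : SchwartzMap V ℂ,
      ∫ ξ, v ξ * g ξ = ∫ x, u x * FourierTransform.fourier (F := V → ℂ) (⇑g) x

/-- The Fourier–Plancherel transform `𝓕u` of `u ∈ L²` (a choice of representative;
`0` if `u ∉ L²`). -/
def FT (u : V → ℂ) : V → ℂ :=
  if h : ∃ v, IsFourierPair u v then h.choose else 0

/-- The inverse Fourier–Plancherel transform `𝓕⁻¹v` of `v ∈ L²` (a choice of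
representative; `0` if `v ∉ L²`). -/
def FTinv (v : V → ℂ) : V → ℂ :=
  if h : ∃ u, IsFourierPair u v then h.choose else 0

/-- Frequency cut-off: `𝓕⁻¹(1_S · 𝓕u)`. -/
def cut (S : Set V) (u : V → ℂ) : V → ℂ := FTinv (S.indicator (FT u))

/-- High-frequency part `u^k = 𝓕⁻¹(1_{|ξ|≥k} 𝓕u)`. -/
def hi (k : ℝ) (u : V → ℂ) : V → ℂ := cut {ξ : V | k ≤ ‖ξ‖} u

/-- Low-frequency part `u_k = 𝓕⁻¹(1_{|ξ|<k} 𝓕u)`. -/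
def lo (k : ℝ) (u : V → ℂ) : V → ℂ := cut {ξ : V | ‖ξ‖ < k} u

/-- Frequency band `u_{h,k} = 𝓕⁻¹(1_{h≤|ξ|<k} 𝓕u)`. -/
def band (h k : ℝ) (u : V → ℂ) : V → ℂ := cut {ξ : V | h ≤ ‖ξ‖ ∧ ‖ξ‖ < k} u

/-- Sharp dyadic piece `Δ_j v = 𝓕⁻¹(1_{2^{j-1}≤|ξ|<2^j} 𝓕v)`. -/
def Δd (j : ℤ) (v : V → ℂ) : V → ℂ := band ((2:ℝ) ^ (j - 1)) ((2:ℝ) ^ j) v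

/-- `Δ̃₀ v = 𝓕⁻¹(1_{|ξ|<1} 𝓕v)`. -/
def Δt0 (v : V → ℂ) : V → ℂ := lo 1 v

/-- The `L^∞` norm (essential sup norm; for the frequency-localized pieces this is
the sup norm of the bounded continuous representative), valued in `[0,∞]`. -/
def nInf (v : V → ℂ) : ℝ≥0∞ := eLpNorm v ⊤ volume

/-- Inhomogeneous Besov norm `‖v‖_{B^σ_{∞,∞}}`, valued in `[0,∞]`. -/
def besov (σ : ℝ) (v : V → ℂ) : ℝ≥0∞ :=
  max (nInf (Δt0 v))
    (⨆ j : {j : ℕ // 1 ≤ j}, ENNReal.ofReal ((2:ℝ) ^ (σ * (j : ℕ))) * nInf (Δd ((j : ℕ) : ℤ) v))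

/-- Homogeneous Besov norm `‖v‖_{Ḃ^{-1}_{∞,∞}} = sup_{j∈ℤ} 2^{-j} ‖Δ_j v‖_∞`,
valued in `[0,∞]`. -/
def hbesovNeg1 (v : V → ℂ) : ℝ≥0∞ :=
  ⨆ j : ℤ, ENNReal.ofReal ((2:ℝ) ^ (-(j : ℝ))) * nInf (Δd j v)

/-- `i`-th component of a vector field, as a complex-valued function. -/
def comp (w : V → V) (i : Fin 3) : V → ℂ := fun x => ((w x i : ℝ) : ℂ)

/-- `|𝓕w(ξ)|²` (sum over the three components), valued in `[0,∞]`. -/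
def frSq (w : V → V) (ξ : V) : ℝ≥0∞ := ∑ i : Fin 3, (‖FT (comp w i) ξ‖₊ : ℝ≥0∞) ^ 2

/-- `∫ |ξ|² |𝓕w(ξ)|² dξ`. -/
def gradSq (w : V → V) : ℝ≥0∞ := ∫⁻ ξ, (‖ξ‖₊ : ℝ≥0∞) ^ 2 * frSq w ξ

/-- `‖∇w‖_{L²}² = ∫ 4π²|ξ|²|𝓕w(ξ)|² dξ`. -/
def gradSq4π (w : V → V) : ℝ≥0∞ :=
  ∫⁻ ξ, ENNReal.ofReal (4 * π ^ 2) * (‖ξ‖₊ : ℝ≥0∞) ^ 2 * frSq w ξ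

/-- `∫ (1+|ξ|²) |𝓕w(ξ)|² dξ` (squared `H¹` norm). -/
def h1Sq (w : V → V) : ℝ≥0∞ := ∫⁻ ξ, (1 + (‖ξ‖₊ : ℝ≥0∞) ^ 2) * frSq w ξ

/-- `∫ (1+|ξ|²)² |𝓕w(ξ)|² dξ` (squared `H²` norm). -/
def h2Sq (w : V → V) : ℝ≥0∞ := ∫⁻ ξ, (1 + (‖ξ‖₊ : ℝ≥0∞) ^ 2) ^ 2 * frSq w ξ

/-- Divergence-free on the Fourier side: `𝓕w(ξ)·ξ = 0` for a.e. `ξ`. -/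
def DivFreeF (w : V → V) : Prop :=
  ∀ᵐ ξ : V, (∑ i : Fin 3, FT (comp w i) ξ * ((ξ i : ℝ) : ℂ)) = 0

/-- Partial derivative `∂_i f (x)` of a scalar field. -/
def pd (f : V → ℝ) (i : Fin 3) (x : V) : ℝ :=
  fderiv ℝ f x (EuclideanSpace.single i (1:ℝ))

/-- A Leray–Hopf weak solution of the 3D Navier–Stokes equations on `(0,∞)×ℝ³`
with viscosity `ν` and divergence-free initial datum `u₀ ∈ L²(ℝ³;ℝ³)`. -/
structure IsLerayHopf (ν : ℝ) (u₀ : V → V) (u : ℝ → V → V) : Prop where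
  /-- measurability of `u` -/
  meas : Measurable (Function.uncurry u)
  /-- `u(t) ∈ L²` for `t > 0` -/
  memL2 : ∀ t : ℝ, 0 < t → MemLp (u t) 2 volume
  /-- (i) `ess sup_{t>0} ‖u(t)‖_{L²} < ∞` -/
  bddL2 : essSup (fun t => eLpNorm (u t) 2 volume) (volume.restrict (Set.Ioi (0:ℝ))) < ⊤
  /-- (i) `∫₀^∞ ∫ |ξ|²|𝓕u(t)(ξ)|² dξ dt < ∞` -/
  gradL2 : (∫⁻ t in Set.Ioi (0:ℝ), gradSq (u t)) < ⊤
  /-- (ii) `u(t)` is divergence-free for a.e. `t` -/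
  divFree : ∀ᵐ t ∂(volume.restrict (Set.Ioi (0:ℝ))), DivFreeF (u t)
  /-- (iii) the weak formulation against smooth compactly supported
  divergence-free test fields -/
  weak : ∀ φ : ℝ → V → V, ContDiff ℝ (⊤ : ℕ∞) (Function.uncurry φ) →
      HasCompactSupport (Function.uncurry φ) →
      (∀ t x, (∑ i : Fin 3, pd (fun y => φ t y i) i x) = 0) →
      (∫ t in Set.Ioi (0:ℝ), ∫ x,
          ((∑ j : Fin 3, u t x j * deriv (fun s => φ s x j) t)
            + ν * (∑ j : Fin 3, u t x j *
                ∑ i : Fin 3, pd (fun y => pd (fun z => φ t z j) i y) i x)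
            + ∑ i : Fin 3, ∑ j : Fin 3, u t x i * u t x j * pd (fun y => φ t y j) i x))
        + (∫ x, ∑ j : Fin 3, u₀ x j * φ 0 x j) = 0
  /-- (iv) the energy inequality for a.e. `t > 0` -/
  energy : ∀ᵐ t ∂(volume.restrict (Set.Ioi (0:ℝ))),
      (1/2 : ℝ≥0∞) * eLpNorm (u t) 2 volume ^ 2
          + ENNReal.ofReal ν * ∫⁻ τ in Set.Ioc (0:ℝ) t, gradSq4π (u τ)
        ≤ (1/2 : ℝ≥0∞) * eLpNorm u₀ 2 volume ^ 2

/-- `u` is regular in `(0,T]`: `u ∈ L^∞(0,T;H¹) ∩ L²(0,T;H²)`. -/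
def RegularOn (u : ℝ → V → V) (T : ℝ) : Prop :=
  essSup (fun t => h1Sq (u t)) (volume.restrict (Set.Ioo (0:ℝ) T)) < ⊤ ∧
    (∫⁻ t in Set.Ioo (0:ℝ) T, h2Sq (u t)) < ⊤

/-- Besov norm of a vector field: the largest Besov norm of its components. -/
def besovV (σ : ℝ) (w : V → V) : ℝ≥0∞ := ⨆ i : Fin 3, besov σ (comp w i)

section

open scoped SchwartzMap

theorem ae_eq_of_schwartz {v v' : V → ℂ} (hv : MemLp v 2 volume) (hv' : MemLp v' 2 volume)
    (h : ∀ g : SchwartzMap V ℂ, ∫ ξ, v ξ * g ξ = ∫ ξ, v' ξ * g ξ) : v =ᵐ[volume] v' := by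
  apply ae_eq_of_integral_contDiff_smul_eq (hv.locallyIntegrable (by norm_num))
    (hv'.locallyIntegrable (by norm_num))
  intro g hg hgs
  have h1 : HasCompactSupport (fun x => (g x : ℂ)) := hgs.comp_left (g := fun r : ℝ => (r:ℂ)) (by simp)
  have h2 : ContDiff ℝ (⊤ : ℕ∞) (fun x => (g x : ℂ)) := ofRealCLM.contDiff.comp hg
  have := h (h1.toSchwartzMap h2)
  change ∫ ξ, v ξ * ((g ξ : ℝ) : ℂ) = ∫ ξ, v' ξ * ((g ξ : ℝ) : ℂ) at this
  simpa [mul_comm] using this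

theorem pair_lp (f : Lp (α := V) ℂ 2 volume) : IsFourierPair f (𝓕 f : Lp (α := V) ℂ 2 volume) := by
  refine ⟨Lp.memLp _, Lp.memLp _, fun g => ?_⟩
  have := congrArg (fun T => T g) (Lp.fourier_toTemperedDistribution_eq f)
  simp only [TemperedDistribution.fourier_apply, Lp.toTemperedDistribution_apply, smul_eq_mul,
    SchwartzMap.fourier_coe] at this
  simp only [mul_comm] at this ⊢
  exact this.symm

theorem IsFourierPair.congr {u u' v v' : V → ℂ} (h : IsFourierPair u v) (hu : u =ᵐ[volume] u')
    (hv : v =ᵐ[volume] v') : IsFourierPair u' v' := by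
  obtain ⟨a, b, c⟩ := h
  refine ⟨a.ae_eq hu, b.ae_eq hv, fun g => ?_⟩
  have e1 : ∫ ξ, v ξ * g ξ = ∫ ξ, v' ξ * g ξ := integral_congr_ae (hv.mono fun x hx => by simp only [hx])
  rw [← e1, c g]
  exact integral_congr_ae (hu.mono fun x hx => by simp only [hx])

theorem IsFourierPair.unique_right {u v v' : V → ℂ} (h : IsFourierPair u v)
    (h' : IsFourierPair u v') : v =ᵐ[volume] v' :=
  ae_eq_of_schwartz h.2.1 h'.2.1 fun g => by rw [h.2.2, h'.2.2]

theorem IsFourierPair.unique_left {u u' v : V → ℂ} (h : IsFourierPair u v)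
    (h' : IsFourierPair u' v) : u =ᵐ[volume] u' := by
  refine ae_eq_of_schwartz h.1 h'.1 fun g => ?_
  have e1 := h.2.2 (𝓕⁻ g)
  have e2 := h'.2.2 (𝓕⁻ g)
  rw [← SchwartzMap.fourier_coe, FourierTransform.fourier_fourierInv_eq] at e1 e2
  rw [← e1, ← e2]

theorem exists_right {u : V → ℂ} (hu : MemLp u 2 volume) : ∃ v, IsFourierPair u v :=
  ⟨_, (pair_lp (hu.toLp u)).congr hu.coeFn_toLp (EventuallyEq.refl _ _)⟩

theorem exists_left {v : V → ℂ} (hv : MemLp v 2 volume) : ∃ u, IsFourierPair u v := by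
  have := pair_lp (𝓕⁻ (hv.toLp v))
  rw [FourierTransform.fourier_fourierInv_eq] at this
  exact ⟨_, this.congr (EventuallyEq.refl _ _) hv.coeFn_toLp⟩

theorem FT_pair {u : V → ℂ} (hu : MemLp u 2 volume) : IsFourierPair u (FT u) := by
  have h := exists_right hu
  rw [FT, dif_pos h]; exact h.choose_spec

theorem FTinv_pair {v : V → ℂ} (hv : MemLp v 2 volume) : IsFourierPair (FTinv v) v := by
  have h := exists_left hv
  rw [FTinv, dif_pos h]; exact h.choose_spec

theorem FT_memLp (u : V → ℂ) : MemLp (FT u) 2 volume := by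
  by_cases h : ∃ v, IsFourierPair u v
  · rw [FT, dif_pos h]; exact h.choose_spec.2.1
  · rw [FT, dif_neg h]; exact MemLp.zero

theorem cut_pair (S : Set V) (hS : MeasurableSet S) (u : V → ℂ) :
    IsFourierPair (cut S u) (S.indicator (FT u)) :=
  FTinv_pair ((FT_memLp u).indicator hS)

theorem FT_of_pair {u v : V → ℂ} (h : IsFourierPair u v) : FT u =ᵐ[volume] v :=
  (FT_pair h.1).unique_right h

theorem IsFourierPair.lp_eq {u v : V → ℂ} (h : IsFourierPair u v) :
    𝓕 (h.1.toLp u) = h.2.1.toLp v := by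
  apply Lp.ext
  have := (pair_lp (h.1.toLp u)).congr h.1.coeFn_toLp (EventuallyEq.refl _ _)
  exact (this.unique_right h).trans h.2.1.coeFn_toLp.symm

theorem IsFourierPair.parseval {u v u' v' : V → ℂ} (h : IsFourierPair u v)
    (h' : IsFourierPair u' v') : ∫ x, u x * conj (u' x) = ∫ ξ, v ξ * conj (v' ξ) := by
  have := Lp.inner_fourier_eq (h'.1.toLp u') (h.1.toLp u)
  rw [h.lp_eq, h'.lp_eq, L2.inner_def, L2.inner_def] at this
  have e1 : ∫ a, inner ℂ ((h'.2.1.toLp v') a) ((h.2.1.toLp v) a) = ∫ ξ, v ξ * conj (v' ξ) := by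
    apply integral_congr_ae
    filter_upwards [h.2.1.coeFn_toLp, h'.2.1.coeFn_toLp] with x hx hx'
    rw [hx, hx']; simp
  have e2 : ∫ a, inner ℂ ((h'.1.toLp u') a) ((h.1.toLp u) a) = ∫ ξ, u ξ * conj (u' ξ) := by
    apply integral_congr_ae
    filter_upwards [h.1.coeFn_toLp, h'.1.coeFn_toLp] with x hx hx'
    rw [hx, hx']; simp
  rw [e1, e2] at this
  exact this.symm

theorem IsFourierPair.norm_eq {u v : V → ℂ} (h : IsFourierPair u v) :
    eLpNorm u 2 volume = eLpNorm v 2 volume := by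
  have := Lp.norm_fourier_eq (h.1.toLp u)
  rw [h.lp_eq, Lp.norm_toLp, Lp.norm_toLp] at this
  exact ((ENNReal.toReal_eq_toReal_iff' h.2.1.2.ne h.1.2.ne).1 this).symm

theorem IsFourierPair.add {u v u' v' : V → ℂ} (h : IsFourierPair u v)
    (h' : IsFourierPair u' v') : IsFourierPair (u + u') (v + v') := by
  have e : 𝓕 ((h.1.add h'.1).toLp _) = (h.2.1.add h'.2.1).toLp _ := by
    rw [MemLp.toLp_add h.1 h'.1, MemLp.toLp_add h.2.1 h'.2.1, FourierTransform.fourier_add, h.lp_eq, h'.lp_eq]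
  have := pair_lp ((h.1.add h'.1).toLp _)
  rw [e] at this
  exact this.congr (MemLp.coeFn_toLp _) (MemLp.coeFn_toLp _)

theorem IsFourierPair.smul {u v : V → ℂ} (c : ℂ) (h : IsFourierPair u v) :
    IsFourierPair (c • u) (c • v) := by
  have e : 𝓕 ((h.1.const_smul c).toLp _) = (h.2.1.const_smul c).toLp _ := by
    rw [MemLp.toLp_const_smul c h.1, MemLp.toLp_const_smul c h.2.1, FourierTransform.fourier_smul, h.lp_eq]
  have := pair_lp ((h.1.const_smul c).toLp _)
  rw [e] at this
  exact this.congr (MemLp.coeFn_toLp _) (MemLp.coeFn_toLp _)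

/-- For `h ∈ L¹ ∩ L²` the inverse Fourier integral is the `L²` inverse transform. -/
theorem pair_fourierInv {h : V → ℂ} (h1 : Integrable h volume) (h2 : MemLp h 2 volume) :
    IsFourierPair (𝓕⁻ h) h := by
  obtain ⟨u, hu⟩ := exists_left h2
  have key : ∀ g : SchwartzMap V ℂ, ∫ ξ, h ξ * g ξ = ∫ x, (𝓕⁻ h) x * (𝓕 (g : V → ℂ)) x := by
    intro g
    have e := VectorFourier.integral_fourierIntegral_smul_eq_flip (μ := (volume : Measure V))
      (ν := (volume : Measure V)) (e := Real.fourierChar) (L := -(innerₗ V)) (f := h)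
      (g := 𝓕 (g : V → ℂ)) Real.continuous_fourierChar (by simp; fun_prop) h1
      (by rw [← SchwartzMap.fourier_coe]; exact (𝓕 g).integrable)
    have e3 : ∀ w : V, VectorFourier.fourierIntegral Real.fourierChar (volume : Measure V) (-(innerₗ V)) h w
        = (𝓕⁻ h) w := fun w => rfl
    have e4 : ∀ w : V, VectorFourier.fourierIntegral Real.fourierChar (volume : Measure V)
        (-(innerₗ V)).flip (𝓕 (g : V → ℂ)) w = g w := by
      intro w
      have : VectorFourier.fourierIntegral Real.fourierChar (volume : Measure V)
        (-(innerₗ V)).flip (𝓕 (g : V → ℂ)) w = 𝓕⁻ (𝓕 (g : V → ℂ)) w := by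
        rw [Real.fourierInv_eq, VectorFourier.fourierIntegral]
        simp [real_inner_comm]
      rw [this, ← SchwartzMap.fourier_coe, ← SchwartzMap.fourierInv_coe,
        FourierTransform.fourierInv_fourier_eq]
    simp only [e3, e4, smul_eq_mul] at e
    exact e.symm
  have hli : LocallyIntegrable (𝓕⁻ h) volume := by
    have : Continuous (𝓕⁻ h) := by
      have := VectorFourier.fourierIntegral_continuous (μ := (volume : Measure V))
        (e := Real.fourierChar) (L := -(innerₗ V)) Real.continuous_fourierChar (by simp; fun_prop) h1
      exact this
    exact this.locallyIntegrable
  have : u =ᵐ[volume] 𝓕⁻ h := by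
    apply ae_eq_of_integral_contDiff_smul_eq (hu.1.locallyIntegrable (by norm_num)) hli
    intro g hg hgs
    have h1 : HasCompactSupport (fun x => (g x : ℂ)) := hgs.comp_left (g := fun r : ℝ => (r:ℂ)) (by simp)
    have h2 : ContDiff ℝ (⊤ : ℕ∞) (fun x => (g x : ℂ)) := ofRealCLM.contDiff.comp hg
    set G := h1.toSchwartzMap h2
    have a1 := hu.2.2 (𝓕⁻ G)
    have a2 := key (𝓕⁻ G)
    rw [← SchwartzMap.fourier_coe, FourierTransform.fourier_fourierInv_eq] at a1 a2
    rw [a1] at a2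
    change ∫ ξ, u ξ * ((g ξ : ℝ) : ℂ) = ∫ ξ, (𝓕⁻ h) ξ * ((g ξ : ℝ) : ℂ) at a2
    simpa [mul_comm] using a2
  exact hu.congr this (EventuallyEq.refl _ _)

end

section

/-- `L²` norm as a real number. -/
def nrm {E : Type*} [NormedAddCommGroup E] (f : V → E) : ℝ := (eLpNorm f 2 volume).toReal

section nrm
variable {E : Type*} [NormedAddCommGroup E]

theorem nrm_nonneg (f : V → E) : 0 ≤ nrm f := ENNReal.toReal_nonneg

theorem nrm_sq {f : V → E} (hf : MemLp f 2 volume) : nrm f ^ 2 = ∫ x, ‖f x‖ ^ 2 := by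
  have := hf.eLpNorm_eq_integral_rpow_norm (by norm_num) (by norm_num)
  rw [nrm, this, ENNReal.toReal_ofReal (by positivity)]
  simp only [ENNReal.toReal_ofNat, Real.rpow_ofNat]
  rw [← Real.rpow_natCast, ← Real.rpow_mul (by positivity)]
  norm_num

theorem int_sq {f : V → E} (hf : MemLp f 2 volume) : Integrable (fun x => ‖f x‖ ^ 2) volume :=
  hf.integrable_norm_pow (by norm_num)

theorem lint_sq {f : V → E} (hf : MemLp f 2 volume) :
    ∫⁻ x, (‖f x‖₊ : ℝ≥0∞) ^ 2 = ENNReal.ofReal (nrm f ^ 2) := by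
  rw [nrm_sq hf, ofReal_integral_eq_lintegral_ofReal (int_sq hf) (ae_of_all _ fun x => by positivity)]
  congr 1; ext x
  rw [ENNReal.ofReal_pow (norm_nonneg _), ofReal_norm]; rfl

theorem nrm_congr {f g : V → E} (h : f =ᵐ[volume] g) : nrm f = nrm g := by
  rw [nrm, nrm, eLpNorm_congr_ae h]

theorem int_mul_le {f : V → ℝ} {g : V → ℝ} (hf : MemLp f 2 volume) (hg : MemLp g 2 volume) :
    Integrable (fun x => f x * g x) volume ∧ ∫ x, |f x * g x| ≤ nrm f * nrm g := by
  have hi : Integrable (fun x => f x * g x) volume := hf.integrable_mul hg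
  refine ⟨hi, ?_⟩
  have h := eLpNorm_smul_le_mul_eLpNorm (p := 2) (q := 2) (r := 1) hg.1 hf.1
  have h1 : eLpNorm (fun x => f x * g x) 1 volume ≤ eLpNorm f 2 volume * eLpNorm g 2 volume := h
  rw [eLpNorm_one_eq_lintegral_enorm] at h1
  have h2 := ENNReal.toReal_mono (ENNReal.mul_ne_top hf.2.ne hg.2.ne) h1
  rw [ENNReal.toReal_mul, ← integral_norm_eq_lintegral_enorm hi.1] at h2
  exact h2

theorem abs_int_mul_le {f : V → ℝ} {g : V → ℝ} (hf : MemLp f 2 volume) (hg : MemLp g 2 volume) :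
    |∫ x, f x * g x| ≤ nrm f * nrm g :=
  (abs_integral_le_integral_abs).trans (int_mul_le hf hg).2

theorem nrm_add_le {f g : V → E} (hf : MemLp f 2 volume) (hg : MemLp g 2 volume) :
    nrm (f + g) ≤ nrm f + nrm g := by
  rw [nrm, nrm, nrm, ← ENNReal.toReal_add hf.2.ne hg.2.ne]
  exact ENNReal.toReal_mono (ENNReal.add_ne_top.2 ⟨hf.2.ne, hg.2.ne⟩)
    (eLpNorm_add_le hf.1 hg.1 (by norm_num))

theorem nrm_le_of_le {F : Type*} [NormedAddCommGroup F] {f : V → E} {g : V → F} (hg : MemLp g 2 volume) {c : ℝ} (hc : 0 ≤ c)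
    (h : ∀ᵐ x, ‖f x‖ ≤ c * ‖g x‖) : nrm f ≤ c * nrm g := by
  have := eLpNorm_le_mul_eLpNorm_of_ae_le_mul h 2
  have h2 := ENNReal.toReal_mono (ENNReal.mul_ne_top ENNReal.ofReal_ne_top hg.2.ne) this
  rwa [ENNReal.toReal_mul, ENNReal.toReal_ofReal hc] at h2

/-- Cauchy–Schwarz constant of the ball of radius `R`. -/
def CR (R : ℝ) : ℝ := (volume (Metric.closedBall (0:V) R)).toReal ^ (1/2 : ℝ)

theorem CR_nonneg (R : ℝ) : 0 ≤ CR R := by unfold CR; positivity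

theorem integrable_of_supp {h : V → E} {R : ℝ} (hm : MemLp h 2 volume)
    (hR : ∀ ξ : V, R < ‖ξ‖ → h ξ = 0) : Integrable h volume ∧ ∫ ξ, ‖h ξ‖ ≤ CR R * nrm h := by
  set B := Metric.closedBall (0:V) R with hB
  have hfin : IsFiniteMeasure (volume.restrict B) := ⟨by
    rw [Measure.restrict_apply_univ]; exact measure_closedBall_lt_top⟩
  have h0 : ∀ ξ, ξ ∉ B → h ξ = 0 := fun ξ hξ => hR ξ (by simpa [hB] using hξ)
  have hm' : MemLp h 2 (volume.restrict B) := hm.restrict B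
  have hi : IntegrableOn h B volume := hm'.integrable (by norm_num)
  have hI : Integrable h volume := hi.integrable_of_forall_notMem_eq_zero h0
  refine ⟨hI, ?_⟩
  have h1 := eLpNorm_le_eLpNorm_mul_rpow_measure_univ (p := 1) (q := 2) (by norm_num) hm'.1
  have h2 : eLpNorm h 1 (volume.restrict B) = eLpNorm h 1 volume := by
    rw [← eLpNorm_indicator_eq_eLpNorm_restrict Metric.isClosed_closedBall.measurableSet]
    congr 1
    rw [Set.indicator_eq_self]
    intro x hx; by_contra hc; exact hx (h0 x hc)
  rw [h2] at h1
  have h3 : eLpNorm h 1 volume ≤ eLpNorm h 2 volume * (volume B) ^ (1/2 : ℝ) := by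
    refine h1.trans ?_
    rw [Measure.restrict_apply_univ]
    norm_num
    gcongr
    exact Measure.restrict_le_self
  have h4 := ENNReal.toReal_mono (ENNReal.mul_ne_top hm.2.ne
    (ENNReal.rpow_ne_top_of_nonneg (by norm_num) measure_closedBall_lt_top.ne)) h3
  rw [ENNReal.toReal_mul, eLpNorm_one_eq_lintegral_enorm, ← integral_norm_eq_lintegral_enorm hI.1,
    ← ENNReal.toReal_rpow] at h4
  rw [mul_comm]; exact h4
end nrm

/-- `f` is real, band-limited to `|ξ| ≤ R` with Fourier transform `h`. -/
structure BL (R : ℝ) (f : V → ℝ) (h : V → ℂ) : Prop where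
  hm : MemLp h 2 volume
  supp : ∀ ξ : V, R < ‖ξ‖ → h ξ = 0
  eq : ∀ x, (f x : ℂ) = 𝓕⁻ h x

theorem herm_of_real {u : V → ℝ} {v : V → ℂ} (h : IsFourierPair (fun x => (u x : ℂ)) v) :
    (fun ξ => conj (v (-ξ))) =ᵐ[volume] v := by
  have hl := h.2.1.locallyIntegrable (by norm_num)
  have hm : MemLp (fun ξ => conj (v (-ξ))) 2 volume := by
    have := (h.2.1.comp_measurePreserving (Measure.measurePreserving_neg (volume : Measure V))).star
    exact this
  apply ae_eq_of_integral_contDiff_smul_eq (hm.locallyIntegrable (by norm_num)) hl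
  intro g hg hgs
  have key : ∀ g : V → ℝ, ContDiff ℝ (⊤ : ℕ∞) g → HasCompactSupport g →
      ∫ ξ, v ξ * (g ξ : ℂ) = ∫ x, (u x : ℂ) * 𝓕 (fun ξ => (g ξ : ℂ)) x := by
    intro g hg hgs
    have h1 : HasCompactSupport (fun x => (g x : ℂ)) := hgs.comp_left (g := fun r : ℝ => (r:ℂ)) (by simp)
    have h2 : ContDiff ℝ (⊤ : ℕ∞) (fun x => (g x : ℂ)) := ofRealCLM.contDiff.comp hg
    exact h.2.2 (h1.toSchwartzMap h2)
  have k1 := key g hg hgs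
  have k2 := key (fun x => g (-x)) (hg.comp contDiff_neg)
    (hgs.comp_homeomorph (Homeomorph.neg V))
  have e1 : ∫ ξ, g ξ • conj (v (-ξ)) = conj (∫ ξ, v ξ * (g (-ξ) : ℂ)) := by
    rw [← integral_conj, ← integral_neg_eq_self]
    congr 1; ext ξ; simp [mul_comm]
  rw [e1, k2, ← integral_conj]
  have e2 : ∀ x, conj (𝓕 (fun ξ => ((g (-ξ) : ℝ) : ℂ)) x) = 𝓕 (fun ξ => (g ξ : ℂ)) x := by
    intro x
    rw [Real.fourier_eq', Real.fourier_eq', ← integral_conj, ← integral_neg_eq_self]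
    congr 1; ext ξ
    simp [← Complex.exp_conj, conj_ofNat]
  simp only [map_mul, e2, conj_ofReal]
  rw [← k1]
  congr 1; ext ξ; simp [mul_comm]

theorem BL.of_herm {R : ℝ} {h : V → ℂ} (hm : MemLp h 2 volume)
    (supp : ∀ ξ : V, R < ‖ξ‖ → h ξ = 0) (hh : (fun ξ => conj (h (-ξ))) =ᵐ[volume] h) :
    BL R (fun x => (𝓕⁻ h x).re) h := by
  refine ⟨hm, supp, fun x => ?_⟩
  rw [← Complex.conj_eq_iff_re, Real.fourierInv_eq', ← integral_conj, ← integral_neg_eq_self]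
  apply integral_congr_ae
  filter_upwards [hh] with ξ hξ
  rw [← hξ]
  simp [← Complex.exp_conj, conj_ofNat]

namespace BL
variable {R : ℝ} {f g : V → ℝ} {h k : V → ℂ}

theorem int_h (H : BL R f h) : Integrable h volume := (integrable_of_supp H.hm H.supp).1

theorem pair (H : BL R f h) : IsFourierPair (fun x => (f x : ℂ)) h := by
  have : (fun x => (f x : ℂ)) = 𝓕⁻ h := funext H.eq
  rw [this]; exact pair_fourierInv H.int_h H.hm

theorem f_eq (H : BL R f h) (x : V) : f x = (𝓕⁻ h x).re := by rw [← H.eq x]; simp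

theorem memLp (H : BL R f h) : MemLp f 2 volume := by
  have := H.pair.1.re
  simpa using this

theorem nrm_eq (H : BL R f h) : nrm f = nrm h := by
  have := H.pair.norm_eq
  rw [nrm, nrm, ← this]
  congr 1
  exact eLpNorm_congr_norm_ae (ae_of_all _ fun x => by simp)

theorem bound (H : BL R f h) (x : V) : |f x| ≤ CR R * nrm f := by
  rw [H.nrm_eq]
  refine le_trans ?_ (integrable_of_supp H.hm H.supp).2
  have : |f x| = ‖(f x : ℂ)‖ := by simp
  rw [this, H.eq x, Real.fourierInv_eq]
  refine (norm_integral_le_integral_norm _).trans (le_of_eq ?_)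
  congr 1; ext ξ; simp

theorem add (H : BL R f h) (K : BL R g k) : BL R (fun x => f x + g x) (fun ξ => h ξ + k ξ) := by
  refine ⟨H.hm.add K.hm, fun ξ hξ => by simp [H.supp ξ hξ, K.supp ξ hξ], fun x => ?_⟩
  push_cast
  rw [H.eq, K.eq, Real.fourierInv_eq, Real.fourierInv_eq, Real.fourierInv_eq, ← integral_add]
  · simp only [smul_add]
  · exact (Real.fourierIntegral_convergent_iff (-x)).2 H.int_h |>.congr (by simp)
  · exact (Real.fourierIntegral_convergent_iff (-x)).2 K.int_h |>.congr (by simp)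

theorem cmul (H : BL R f h) (c : ℝ) : BL R (fun x => c * f x) (fun ξ => (c : ℂ) * h ξ) := by
  refine ⟨H.hm.const_mul _, fun ξ hξ => by simp [H.supp ξ hξ], fun x => ?_⟩
  push_cast
  rw [H.eq, Real.fourierInv_eq, Real.fourierInv_eq, ← integral_const_mul]
  congr 1; ext ξ; rw [mul_smul_comm]

theorem zero (R : ℝ) : BL R (fun _ => 0) (fun _ => 0) :=
  ⟨MemLp.zero, fun _ _ => rfl, fun x => by simp [Real.fourierInv_eq]⟩

theorem sub (H : BL R f h) (K : BL R g k) : BL R (fun x => f x - g x) (fun ξ => h ξ - k ξ) := by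
  have := H.add (K.cmul (-1))
  simpa [sub_eq_add_neg] using this

theorem sum {ι : Type*} (s : Finset ι) {f : ι → V → ℝ} {h : ι → V → ℂ}
    (H : ∀ i ∈ s, BL R (f i) (h i)) :
    BL R (fun x => ∑ i ∈ s, f i x) (fun ξ => ∑ i ∈ s, h i ξ) := by
  induction s using Finset.induction_on with
  | empty => simpa using BL.zero R
  | insert a s ha ih =>
    simp only [Finset.sum_insert ha]
    exact (H a (by simp)).add (ih fun i hi => H i (by simp [hi]))

theorem mono {R' : ℝ} (H : BL R f h) (hR : R ≤ R') : BL R' f h :=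
  ⟨H.hm, fun ξ hξ => H.supp ξ (hR.trans_lt hξ), H.eq⟩

theorem contDiff (H : BL R f h) : ContDiff ℝ (⊤ : ℕ∞) f := by
  have e : f = fun x => Complex.reCLM (𝓕 (fun ξ => h (-ξ)) x) := by
    ext x; rw [H.f_eq, Real.fourierInv_eq_fourier_comp_neg]; simp
  rw [e]
  refine Complex.reCLM.contDiff.comp (Real.contDiff_fourier fun n _ => ?_)
  have hm : MemLp (fun ξ => h (-ξ)) 2 volume :=
    H.hm.comp_measurePreserving (Measure.measurePreserving_neg (volume : Measure V))
  have hi : Integrable (fun ξ => h (-ξ)) volume := H.int_h.comp_neg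
  refine Integrable.mono' (hi.norm.const_mul (R ^ n))
    (AEStronglyMeasurable.mul (by fun_prop) hi.1.norm) (ae_of_all _ fun ξ => ?_)
  rw [norm_mul, norm_pow, norm_norm, norm_norm]
  by_cases hξ : R < ‖ξ‖
  · rw [H.supp (-ξ) (by simpa using hξ)]; simp
  · push Not at hξ
    gcongr

theorem dfun_memLp (H : BL R f h) (a : Fin 3) :
    MemLp (fun ξ => (2 * π * I * (ξ a : ℝ) : ℂ) * h ξ) 2 volume := by
  refine MemLp.of_le_mul (c := 2 * π * R) H.hm ?_ (ae_of_all _ fun ξ => ?_)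
  · exact AEStronglyMeasurable.mul (by fun_prop) H.hm.1
  · by_cases hξ : R < ‖ξ‖
    · rw [H.supp ξ hξ]; simp
    · push Not at hξ
      rw [norm_mul]
      gcongr
      have := (EuclideanSpace.norm_eq ξ ▸ PiLp.norm_apply_le ξ a : ‖ξ a‖ ≤ ‖ξ‖)
      simp only [norm_mul, Complex.norm_ofNat, norm_real, norm_I, mul_one, Real.norm_eq_abs,
        abs_of_pos Real.pi_pos]
      have h2 : |ξ a| ≤ R := this.trans hξ
      gcongr

theorem pd (H : BL R f h) (a : Fin 3) :
    BL R (NSE.pd f a) (fun ξ => (2 * π * I * (ξ a : ℝ) : ℂ) * h ξ) := by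
  refine ⟨H.dfun_memLp a, fun ξ hξ => by simp [H.supp ξ hξ], fun x => ?_⟩
  set h' : V → ℂ := fun ξ => h (-ξ)
  have hi : Integrable h' volume := H.int_h.comp_neg
  have hi2 : Integrable (fun ξ => ‖ξ‖ * ‖h' ξ‖) volume := by
    refine Integrable.mono' (hi.norm.const_mul R) (by fun_prop) (ae_of_all _ fun ξ => ?_)
    rw [norm_mul, norm_norm, norm_norm]
    by_cases hξ : R < ‖ξ‖
    · simp only [h']; rw [H.supp (-ξ) (by simpa using hξ)]; simp
    · push Not at hξ
      gcongr
  have hd := Real.hasFDerivAt_fourier hi hi2 x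
  have e : (fun x => (f x : ℂ)) = 𝓕 h' := by
    ext x; rw [H.eq, Real.fourierInv_eq_fourier_comp_neg]
  have hf : HasFDerivAt f (fderiv ℝ f x) x :=
    ((H.contDiff.differentiable (by simp)) x).hasFDerivAt
  have hf2 : HasFDerivAt (fun x => (f x : ℂ)) (ofRealCLM.comp (fderiv ℝ f x)) x :=
    ofRealCLM.hasFDerivAt.comp x hf
  rw [e] at hf2
  have := congrArg (fun L => L (EuclideanSpace.single a (1:ℝ))) (hf2.unique hd)
  simp only [ContinuousLinearMap.comp_apply, ofRealCLM_apply] at this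
  rw [NSE.pd, this, Real.fourier_continuousLinearMap_apply, Real.fourierInv_eq_fourier_comp_neg]
  · refine congrArg (fun F : V → ℂ => 𝓕 F x) (funext fun ξ => ?_)
    have hin : (innerSL ℝ ξ) (EuclideanSpace.single a (1:ℝ)) = ξ a := by
      rw [innerSL_apply_apply]; simp [EuclideanSpace.inner_single_right]
    simp [VectorFourier.fourierSMulRight_apply, h', hin]
    ring
  · have := VectorFourier.norm_fourierSMulRight_le (innerSL ℝ) h'
    refine Integrable.mono' (hi2.const_mul (2 * π * ‖innerSL (E := V) ℝ‖)) ?_ (ae_of_all _ fun ξ => ?_)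
    · exact AEStronglyMeasurable.fourierSMulRight (L := innerSL ℝ) hi.1
    · refine (this ξ).trans (le_of_eq (by ring))

theorem pd_nrm (H : BL R f h) (hR : 0 ≤ R) (a : Fin 3) : nrm (NSE.pd f a) ≤ 2 * π * R * nrm f := by
  rw [(H.pd a).nrm_eq, H.nrm_eq]
  refine nrm_le_of_le H.hm (by positivity) (ae_of_all _ fun ξ => ?_)
  by_cases hξ : R < ‖ξ‖
  · rw [H.supp ξ hξ]; simp
  · push Not at hξ
    rw [norm_mul]
    gcongr
    have := (PiLp.norm_apply_le ξ a : ‖ξ a‖ ≤ ‖ξ‖)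
    simp only [norm_mul, Complex.norm_ofNat, norm_real, norm_I, mul_one, Real.norm_eq_abs,
      abs_of_pos Real.pi_pos]
    have h2 : |ξ a| ≤ R := this.trans hξ
    gcongr

theorem cont (H : BL R f h) : Continuous f := H.contDiff.continuous

theorem diff (H : BL R f h) : Differentiable ℝ f := H.contDiff.differentiable (by simp)

theorem parseval (H : BL R f h) {g : V → ℝ} {k : V → ℂ} (K : IsFourierPair (fun x => (g x : ℂ)) k) :
    ((∫ x, g x * f x : ℝ) : ℂ) = ∫ ξ, k ξ * conj (h ξ) := by
  rw [← K.parseval H.pair]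
  simp only [conj_ofReal]
  rw [← integral_complex_ofReal]
  congr 1; ext x; push_cast; rfl
end BL

end

section

theorem BL.int3 {R R' R'' : ℝ} {f g k : V → ℝ} {h h' h'' : V → ℂ} (F : BL R f h) (G : BL R' g h')
    (K : BL R'' k h'') : Integrable (fun x => f x * g x * k x) volume :=
  (int_mul_le F.memLp G.memLp).1.mul_bdd (c := CR R'' * nrm k) K.cont.aestronglyMeasurable
    (ae_of_all _ fun x => K.bound x)

theorem int3_le {f g k : V → ℝ} (hf : MemLp f 2 volume) (hg : MemLp g 2 volume)
    (hk : AEStronglyMeasurable k volume) {b : ℝ} (hb : ∀ x, |k x| ≤ b) :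
    |∫ x, f x * g x * k x| ≤ b * (nrm f * nrm g) := by
  have h1 := int_mul_le hf hg
  calc |∫ x, f x * g x * k x| ≤ ∫ x, |f x * g x * k x| := abs_integral_le_integral_abs
    _ ≤ ∫ x, b * |f x * g x| := by
        apply integral_mono
        · exact (h1.1.mul_bdd (c := b) hk (ae_of_all _ hb)).abs
        · exact h1.1.abs.const_mul b
        · intro x
          simp only
          rw [abs_mul, mul_comm]
          gcongr
          exact hb x
    _ = b * ∫ x, |f x * g x| := integral_const_mul _ _
    _ ≤ _ := by
        have : 0 ≤ b := (abs_nonneg _).trans (hb 0)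
        gcongr
        exact h1.2

/-- Triple frequency orthogonality. -/
theorem BL.triple_zero {R R' R'' : ℝ} {f g k : V → ℝ} {h h' h'' : V → ℂ} (F : BL R f h) (G : BL R' g h')
    (K : BL R'' k h'') (hk : ∀ ξ : V, ‖ξ‖ < R + R' → h'' ξ = 0) : ∫ x, f x * g x * k x = 0 := by
  have hsph : ∀ᵐ η : V, ‖η‖ ≠ R + R' := by
    have := Measure.addHaar_sphere (volume : Measure V) 0 (R + R')
    rw [ae_iff]; convert this using 2; ext; simp
  have key : ∀ ξ : V, ‖ξ‖ ≤ R →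
      ∫ x, (Real.fourierChar (inner ℝ ξ x) • ((g x * k x : ℝ) : ℂ)) = 0 := by
    intro ξ hξ
    have hm : MemLp (fun η => h' (η - ξ)) 2 volume :=
      G.hm.comp_measurePreserving (measurePreserving_sub_right volume ξ)
    have hi : Integrable (fun η => h' (η - ξ)) volume := G.int_h.comp_sub_right ξ
    have hp := (pair_fourierInv hi hm).parseval K.pair
    have e : ∀ x, 𝓕⁻ (fun η => h' (η - ξ)) x = Real.fourierChar (inner ℝ ξ x) • (g x : ℂ) := by
      intro x
      rw [G.eq, Real.fourierInv_eq, Real.fourierInv_eq, ← integral_add_right_eq_self _ ξ, Circle.smul_def, ← integral_smul]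
      congr 1; ext η
      simp only [add_sub_cancel_right, inner_add_left]
      rw [AddChar.map_add_eq_mul, mul_comm, mul_smul, Circle.smul_def]
    simp only [e, conj_ofReal] at hp
    rw [integral_congr_ae (f := fun η => h' (η - ξ) * conj (h'' η)) (g := fun _ => 0) ?_] at hp
    · simp only [integral_zero] at hp
      rw [← hp]
      congr 1; ext x; push_cast; rw [smul_mul_assoc]
    · filter_upwards [hsph] with η hη
      rcases lt_or_gt_of_ne hη with h1 | h1
      · rw [hk η h1]; simp
      · rw [G.supp]
        · simp
        · have := norm_sub_norm_le η ξ
          linarith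
  have hc : ((∫ x, f x * g x * k x : ℝ) : ℂ) = 0 := by
    rw [← integral_complex_ofReal]
    have e1 : ∀ x, ((f x * g x * k x : ℝ) : ℂ) = ∫ ξ, Real.fourierChar (inner ℝ ξ x) • h ξ * ((g x * k x : ℝ) : ℂ) := by
      intro x
      rw [integral_mul_const, mul_assoc]
      rw [ofReal_mul, F.eq x, Real.fourierInv_eq]
    simp_rw [e1]
    rw [integral_integral_swap]
    · rw [integral_congr_ae (g := fun _ => 0)]
      · simp
      · refine ae_of_all _ fun ξ => ?_
        simp only
        by_cases hξ : ‖ξ‖ ≤ R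
        · have := key ξ hξ
          have e2 : ∀ x, Real.fourierChar (inner ℝ ξ x) • h ξ * ((g x * k x : ℝ) : ℂ) =
              h ξ * (Real.fourierChar (inner ℝ ξ x) • ((g x * k x : ℝ) : ℂ)) := by
            intro x; rw [smul_mul_assoc, mul_smul_comm]
          simp_rw [e2]
          rw [integral_const_mul, this, mul_zero]
        · rw [F.supp ξ (by simpa using hξ)]; simp
    · have h0 : Integrable (fun p : V × V => ((g p.1 * k p.1 : ℝ) : ℂ) * h p.2) (volume.prod volume) :=
        Integrable.mul_prod (int_mul_le G.memLp K.memLp).1.ofReal F.int_h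
      have : (uncurry fun (x ξ : V) => Real.fourierChar (inner ℝ ξ x) • h ξ * ((g x * k x : ℝ) : ℂ)) =
        fun p : V × V => Real.fourierChar (inner ℝ p.2 p.1) • (((g p.1 * k p.1 : ℝ) : ℂ) * h p.2) := by
        ext p; simp only [uncurry]; rw [smul_mul_assoc, mul_comm]
      rw [this]
      refine h0.mono ?_ (ae_of_all _ fun p => by simp)
      refine AEStronglyMeasurable.smul ?_ h0.1
      exact (Continuous.aestronglyMeasurable (by fun_prop))
  exact_mod_cast hc

/-- The trilinear form. -/
def tri (a b c : Fin 3 → V → ℝ) : ℝ := ∑ i, ∑ j, ∫ x, a i x * b j x * pd (c j) i x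

theorem pd_mul {f g : V → ℝ} (hf : Differentiable ℝ f) (hg : Differentiable ℝ g) (i : Fin 3) (x : V) :
    pd (fun y => f y * g y) i x = pd f i x * g x + f x * pd g i x := by
  simp only [pd]
  rw [fderiv_fun_mul (hf x) (hg x)]
  simp; ring

theorem tri_antisymm {R R' R'' : ℝ} {a b c : Fin 3 → V → ℝ} {ha hb hc : Fin 3 → V → ℂ}
    (A : ∀ i, BL R (a i) (ha i)) (B : ∀ i, BL R' (b i) (hb i)) (C : ∀ i, BL R'' (c i) (hc i))
    (hdiv : ∀ x, ∑ i, pd (a i) i x = 0) : tri a b c = - tri a c b := by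
  have ibp : ∀ i j, ∫ x, a i x * b j x * pd (c j) i x =
      - ((∫ x, pd (a i) i x * b j x * c j x) + ∫ x, a i x * c j x * pd (b j) i x) := by
    intro i j
    have h1 := integral_mul_fderiv_eq_neg_fderiv_mul_of_integrable (μ := (volume : Measure V))
      (f := fun x => a i x * b j x) (g := c j) (v := EuclideanSpace.single i (1:ℝ)) ?_ ?_ ?_ ?_ ?_
    · have e : ∀ x, fderiv ℝ (fun x => a i x * b j x) x (EuclideanSpace.single i (1:ℝ)) * c j x =
        pd (a i) i x * b j x * c j x + a i x * c j x * pd (b j) i x := by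
        intro x
        have := pd_mul (A i).diff (B j).diff i x
        rw [pd] at this; rw [this]; ring
      simp_rw [e] at h1
      rw [integral_add (((A i).pd i).int3 (B j) (C j)) ((A i).int3 (C j) ((B j).pd i))] at h1
      exact h1
    · have e : ∀ x, fderiv ℝ (fun x => a i x * b j x) x (EuclideanSpace.single i (1:ℝ)) * c j x =
        pd (a i) i x * b j x * c j x + a i x * c j x * pd (b j) i x := by
        intro x
        have := pd_mul (A i).diff (B j).diff i x
        rw [pd] at this; rw [this]; ring
      simp_rw [e]
      exact (((A i).pd i).int3 (B j) (C j)).add ((A i).int3 (C j) ((B j).pd i))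
    · exact (A i).int3 (B j) ((C j).pd i)
    · exact (A i).int3 (B j) (C j)
    · exact fun x _ => ((A i).diff x).mul ((B j).diff x)
    · exact fun x _ => (C j).diff x
  have z : ∀ j, ∑ i, ∫ x, pd (a i) i x * b j x * c j x = 0 := by
    intro j
    rw [← integral_finsetSum _ fun i _ => ((A i).pd i).int3 (B j) (C j)]
    simp_rw [← Finset.sum_mul, hdiv]; simp
  unfold tri
  simp_rw [ibp, Finset.sum_neg_distrib, Finset.sum_add_distrib]
  rw [Finset.sum_comm]
  simp [z]

theorem tri_add_left {R R' : ℝ} {ι κ : Type*} (s : Finset ι) (s' : Finset κ) {a : ι → Fin 3 → V → ℝ} {b : κ → Fin 3 → V → ℝ}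
    {c : Fin 3 → V → ℝ} {ha : ι → Fin 3 → V → ℂ} {hb : κ → Fin 3 → V → ℂ} {hc : Fin 3 → V → ℂ}
    (A : ∀ p ∈ s, ∀ i, BL R (a p i) (ha p i)) (B : ∀ p ∈ s', ∀ i, BL R (b p i) (hb p i)) (C : ∀ i, BL R' (c i) (hc i)) :
    tri (fun i x => ∑ p ∈ s, a p i x) (fun i x => ∑ p ∈ s', b p i x) c = ∑ p ∈ s, ∑ q ∈ s', tri (a p) (b q) c := by
  have e : ∀ i j, ∫ x, (∑ p ∈ s, a p i x) * (∑ p ∈ s', b p j x) * pd (c j) i x =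
      ∑ p ∈ s, ∑ q ∈ s', ∫ x, a p i x * b q j x * pd (c j) i x := by
    intro i j
    simp_rw [Finset.sum_mul_sum, Finset.sum_mul]
    rw [integral_finsetSum]
    · refine Finset.sum_congr rfl fun p hp => ?_
      rw [integral_finsetSum]
      exact fun q hq => (A p hp i).int3 (B q hq j) ((C j).pd i)
    · intro p hp
      apply integrable_finsetSum
      exact fun q hq => (A p hp i).int3 (B q hq j) ((C j).pd i)
  unfold tri
  simp_rw [e]
  simp_rw [Finset.sum_comm (s := (Finset.univ : Finset (Fin 3))) (t := s)]
  simp_rw [Finset.sum_comm (s := (Finset.univ : Finset (Fin 3))) (t := s')]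

theorem pd_sum {ι : Type*} (s : Finset ι) {c : ι → V → ℝ} (hc : ∀ p ∈ s, Differentiable ℝ (c p)) (w : ι → ℝ)
    (i : Fin 3) (x : V) : pd (fun x => ∑ p ∈ s, w p * c p x) i x = ∑ p ∈ s, w p * pd (c p) i x := by
  simp only [pd]
  rw [fderiv_fun_sum fun p hp => ((hc p hp) x).const_mul (w p)]
  simp only [sum_apply]
  refine Finset.sum_congr rfl fun p hp => ?_
  rw [fderiv_const_mul ((hc p hp) x)]; simp

theorem tri_sum_right {R : ℝ} {ι : Type*} (s : Finset ι) (w : ι → ℝ) {a b : Fin 3 → V → ℝ}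
    {c : ι → Fin 3 → V → ℝ} {hc : ι → Fin 3 → V → ℂ}
    (A : ∀ i, MemLp (a i) 2 volume) (B : ∀ i, MemLp (b i) 2 volume) (C : ∀ p ∈ s, ∀ i, BL R (c p i) (hc p i)) :
    tri a b (fun i x => ∑ p ∈ s, w p * c p i x) = ∑ p ∈ s, w p * tri a b (c p) := by
  have e : ∀ i j, ∫ x, a i x * b j x * pd (fun x => ∑ p ∈ s, w p * c p j x) i x =
      ∑ p ∈ s, w p * ∫ x, a i x * b j x * pd (c p j) i x := by
    intro i j
    simp_rw [pd_sum s (fun p hp => (C p hp j).diff) w, Finset.mul_sum, ← integral_const_mul]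
    rw [integral_finsetSum]
    · refine Finset.sum_congr rfl fun p hp => ?_
      congr 1; ext x; ring
    · intro p hp
      have := ((int_mul_le (A i) (B j)).1.mul_bdd (c := CR R * nrm (pd (c p j) i)) ((C p hp j).pd i).cont.aestronglyMeasurable
        (ae_of_all _ fun x => ((C p hp j).pd i).bound x)).const_mul (w p)
      refine this.congr (ae_of_all _ fun x => ?_)
      simp only; ring
  unfold tri
  simp_rw [e]
  simp_rw [Finset.sum_comm (s := (Finset.univ : Finset (Fin 3))) (t := s), Finset.mul_sum]

end

section

theorem sum_perm (s : Finset ℕ) (Q : ℕ → ℕ → ℕ → ℝ) :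
    ∑ p ∈ s, ∑ q ∈ s, ∑ r ∈ s, (Q p q r + Q p r q + Q q p r + Q q r p + Q r p q + Q r q p) =
      6 * ∑ p ∈ s, ∑ q ∈ s, ∑ r ∈ s, Q p q r := by
  have a1 : ∀ Q : ℕ → ℕ → ℕ → ℝ, ∑ p ∈ s, ∑ q ∈ s, ∑ r ∈ s, Q p r q = ∑ p ∈ s, ∑ q ∈ s, ∑ r ∈ s, Q p q r :=
    fun Q => Finset.sum_congr rfl fun p _ => Finset.sum_comm
  have a2 : ∀ Q : ℕ → ℕ → ℕ → ℝ, ∑ p ∈ s, ∑ q ∈ s, ∑ r ∈ s, Q q p r = ∑ p ∈ s, ∑ q ∈ s, ∑ r ∈ s, Q p q r :=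
    fun Q => Finset.sum_comm
  simp_rw [Finset.sum_add_distrib]
  rw [a1 Q, a2 Q, a2 (fun q p r => Q q r p), a1 Q, a1 (fun p r q => Q r p q), a2 Q,
    a1 (fun p r q => Q r q p), a2 (fun r p q => Q r q p), a1 Q]
  ring

theorem comb {t : ℕ → ℕ → ℕ → ℝ} {lam mu b n : ℕ → ℝ} {K : ℝ} (hK : 0 ≤ K)
    (hl : ∀ p, 0 ≤ lam p) (hl2 : ∀ e a, e ≤ a + 1 → lam e ≤ 2 * lam a)
    (hm : ∀ p, 0 ≤ mu p) (hm2 : ∀ e a, e ≤ a + 1 → mu e ≤ 4 * mu a)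
    (hb : ∀ p, 0 ≤ b p) (hn : ∀ p, 0 ≤ n p)
    (h1 : ∀ p q r, |t p q r| ≤ K * (lam r * b p * n q * n r))
    (h2 : ∀ p q r, |t p q r| ≤ K * (lam r * b q * n p * n r))
    (h3 : ∀ p q r, |t p q r| ≤ K * (lam q * b r * n p * n q))
    (hz : ∀ p q r, (p + 2 ≤ r ∧ q + 2 ≤ r) ∨ (p + 2 ≤ q ∧ r + 2 ≤ q) ∨ (q + 2 ≤ p ∧ r + 2 ≤ p) → t p q r = 0)
    (P : ℕ) :
    |∑ p ∈ Finset.range P, ∑ q ∈ Finset.range P, ∑ r ∈ Finset.range P, mu r * t p q r| ≤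
      72 * K * ∑ a ∈ Finset.range P, mu a * lam a * (∑ m ∈ Finset.range (a+1), b m) * n a ^ 2 := by
  set Q : ℕ → ℕ → ℕ → ℝ := fun m a c =>
    if m ≤ a ∧ a ≤ c + 1 ∧ c ≤ a + 1 then b m * (mu a * lam a * n a ^ 2) else 0 with hQ
  have Q0 : ∀ m a c, 0 ≤ Q m a c := by
    intro m a c; simp only [hQ]
    split_ifs
    · have := hb m; have := hm a; have := hl a; positivity
    · exact le_rfl
  have sub : ∀ a c e f, a ≤ c + 1 → c ≤ a + 1 → e ≤ a + 1 → e ≤ c + 1 → f ≤ a + 1 → f ≤ c + 1 →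
      mu e * (lam f * (n a * n c)) ≤ 4 * (mu a * lam a * n a ^ 2 + mu c * lam c * n c ^ 2) := by
    intro a c e f _ _ he he' hf hf'
    have x1 : mu e * lam f ≤ 8 * (mu a * lam a) := by
      calc mu e * lam f ≤ (4 * mu a) * (2 * lam a) :=
            mul_le_mul (hm2 _ _ he) (hl2 _ _ hf) (hl f) (by have := hm a; positivity)
        _ = _ := by ring
    have x2 : mu e * lam f ≤ 8 * (mu c * lam c) := by
      calc mu e * lam f ≤ (4 * mu c) * (2 * lam c) :=
            mul_le_mul (hm2 _ _ he') (hl2 _ _ hf') (hl f) (by have := hm c; positivity)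
        _ = _ := by ring
    have x0 : 0 ≤ mu e * lam f := mul_nonneg (hm e) (hl f)
    have : n a * n c ≤ (n a ^ 2 + n c ^ 2) / 2 := by nlinarith [sq_nonneg (n a - n c)]
    calc mu e * (lam f * (n a * n c)) = (mu e * lam f) * (n a * n c) := by ring
      _ ≤ (mu e * lam f) * ((n a ^ 2 + n c ^ 2) / 2) := by gcongr
      _ = ((mu e * lam f) * n a ^ 2 + (mu e * lam f) * n c ^ 2) / 2 := by ring
      _ ≤ ((8 * (mu a * lam a)) * n a ^ 2 + (8 * (mu c * lam c)) * n c ^ 2) / 2 := by gcongr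
      _ = _ := by ring
  have main : ∀ m a c e f : ℕ, ∀ τ : ℝ, |τ| ≤ K * (lam f * b m * n a * n c) → m ≤ a → m ≤ c →
      a ≤ c + 1 → c ≤ a + 1 → e ≤ a + 1 → e ≤ c + 1 → f ≤ a + 1 → f ≤ c + 1 →
      |mu e * τ| ≤ 4 * K * (Q m a c + Q m c a) := by
    intro m a c e f τ hτ i1 i2 i3 i4 i5 i6 i7 i8
    have s := sub a c e f i3 i4 i5 i6 i7 i8
    have q1 : Q m a c = b m * (mu a * lam a * n a ^ 2) := by simp only [hQ]; rw [if_pos ⟨i1, i3, i4⟩]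
    have q2 : Q m c a = b m * (mu c * lam c * n c ^ 2) := by simp only [hQ]; rw [if_pos ⟨i2, i4, i3⟩]
    rw [q1, q2, abs_mul, abs_of_nonneg (hm e)]
    have := hb m
    have := hm e
    calc mu e * |τ| ≤ mu e * (K * (lam f * b m * n a * n c)) := by gcongr
      _ = K * b m * (mu e * (lam f * (n a * n c))) := by ring
      _ ≤ K * b m * (4 * (mu a * lam a * n a ^ 2 + mu c * lam c * n c ^ 2)) := by gcongr
      _ = _ := by ring
  have term : ∀ p q r, |mu r * t p q r| ≤
      4 * K * (Q p q r + Q p r q + Q q p r + Q q r p + Q r p q + Q r q p) := by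
    intro p q r
    have nn : 0 ≤ 4 * K * (Q p q r + Q p r q + Q q p r + Q q r p + Q r p q + Q r q p) := by
      have := Q0 p q r; have := Q0 p r q; have := Q0 q p r; have := Q0 q r p
      have := Q0 r p q; have := Q0 r q p; positivity
    by_cases hv : (p + 2 ≤ r ∧ q + 2 ≤ r) ∨ (p + 2 ≤ q ∧ r + 2 ≤ q) ∨ (q + 2 ≤ p ∧ r + 2 ≤ p)
    · rw [hz p q r hv]; simpa using nn
    · have mm : ∀ A B : ℝ, A ≤ B → 4 * K * A ≤ 4 * K * B := fun A B h => by gcongr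
      by_cases c1 : p ≤ q ∧ p ≤ r
      · refine (main p q r r r _ (h1 p q r) (by omega) (by omega) (by omega) (by omega) (by omega)
          (by omega) (by omega) (by omega)).trans (mm _ _ ?_)
        linarith [Q0 p q r, Q0 p r q, Q0 q p r, Q0 q r p, Q0 r p q, Q0 r q p]
      · by_cases c2 : q ≤ p ∧ q ≤ r
        · refine (main q p r r r _ (h2 p q r) (by omega) (by omega) (by omega) (by omega) (by omega)
            (by omega) (by omega) (by omega)).trans (mm _ _ ?_)
          linarith [Q0 p q r, Q0 p r q, Q0 q p r, Q0 q r p, Q0 r p q, Q0 r q p]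
        · refine (main r p q r q _ (h3 p q r) (by omega) (by omega) (by omega) (by omega) (by omega)
            (by omega) (by omega) (by omega)).trans (mm _ _ ?_)
          linarith [Q0 p q r, Q0 p r q, Q0 q p r, Q0 q r p, Q0 r p q, Q0 r q p]
  set s := Finset.range P
  have A : |∑ p ∈ s, ∑ q ∈ s, ∑ r ∈ s, mu r * t p q r| ≤ ∑ p ∈ s, ∑ q ∈ s, ∑ r ∈ s,
      4 * K * (Q p q r + Q p r q + Q q p r + Q q r p + Q r p q + Q r q p) := by
    refine (Finset.abs_sum_le_sum_abs _ _).trans (Finset.sum_le_sum fun p _ => ?_)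
    refine (Finset.abs_sum_le_sum_abs _ _).trans (Finset.sum_le_sum fun q _ => ?_)
    exact (Finset.abs_sum_le_sum_abs _ _).trans (Finset.sum_le_sum fun r _ => term p q r)
  refine A.trans ?_
  simp_rw [← Finset.mul_sum]
  rw [sum_perm]
  have B : ∑ p ∈ s, ∑ q ∈ s, ∑ r ∈ s, Q p q r ≤
      3 * ∑ a ∈ s, mu a * lam a * (∑ m ∈ Finset.range (a+1), b m) * n a ^ 2 := by
    have in1 : ∀ m a, ∑ c ∈ s, Q m a c ≤ if m ≤ a then 3 * (b m * (mu a * lam a * n a ^ 2)) else 0 := by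
      intro m a
      have w0 : 0 ≤ b m * (mu a * lam a * n a ^ 2) := by
        have := hb m; have := hm a; have := hl a; positivity
      split_ifs with hma
      · have : ∀ c, Q m a c = if c ∈ Finset.Icc (a - 1) (a + 1) then b m * (mu a * lam a * n a ^ 2) else 0 := by
          intro c; simp only [hQ, Finset.mem_Icc]
          congr 1; apply propext; omega
        simp_rw [this]
        rw [← Finset.sum_filter, Finset.sum_const, nsmul_eq_mul]
        gcongr
        have c1 : (s.filter (· ∈ Finset.Icc (a - 1) (a + 1))).card ≤ (Finset.Icc (a-1) (a+1)).card :=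
          Finset.card_le_card fun x hx => (Finset.mem_filter.1 hx).2
        rw [Nat.card_Icc] at c1
        exact_mod_cast c1.trans (by omega)
      · apply le_of_eq
        apply Finset.sum_eq_zero
        intro c _
        simp only [hQ]; rw [if_neg]; exact fun h => hma h.1
    calc ∑ p ∈ s, ∑ q ∈ s, ∑ r ∈ s, Q p q r
        ≤ ∑ m ∈ s, ∑ a ∈ s, if m ≤ a then 3 * (b m * (mu a * lam a * n a ^ 2)) else 0 :=
          Finset.sum_le_sum fun m _ => Finset.sum_le_sum fun a _ => in1 m a
      _ = ∑ a ∈ s, ∑ m ∈ s, if m ≤ a then 3 * (b m * (mu a * lam a * n a ^ 2)) else 0 := Finset.sum_comm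
      _ ≤ ∑ a ∈ s, 3 * (mu a * lam a * (∑ m ∈ Finset.range (a+1), b m) * n a ^ 2) := by
          refine Finset.sum_le_sum fun a ha => ?_
          rw [← Finset.sum_filter]
          have : s.filter (· ≤ a) = Finset.range (a+1) := by
            ext m; simp only [Finset.mem_filter, Finset.mem_range, s] at ha ⊢; omega
          rw [this, Finset.mul_sum, Finset.sum_mul, Finset.mul_sum]
          apply le_of_eq
          refine Finset.sum_congr rfl fun m _ => by ring
      _ = _ := by rw [Finset.mul_sum]
  calc 4 * K * (6 * ∑ p ∈ s, ∑ q ∈ s, ∑ r ∈ s, Q p q r) ≤ 4 * K * (6 * (3 * ∑ a ∈ s, mu a * lam a * (∑ m ∈ Finset.range (a+1), b m) * n a ^ 2)) := by gcongr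
    _ = _ := by ring

/-- Littlewood–Paley pieces of a divergence-free field. -/
structure Pieces (L : ℝ) (U : ℕ → Fin 3 → V → ℝ) (H : ℕ → Fin 3 → V → ℂ) : Prop where
  pos : 0 < L
  bl : ∀ p i, BL (L * 2 ^ p) (U p i) (H p i)
  low : ∀ p i (ξ : V), 1 ≤ p → ‖ξ‖ < L * 2 ^ p / 2 → H p i ξ = 0
  div : ∀ p x, ∑ i, pd (U p i) i x = 0

theorem tri_bd {a b c : Fin 3 → V → ℝ} {X : ℝ}
    (h : ∀ i j, |∫ x, a i x * b j x * pd (c j) i x| ≤ X) : |tri a b c| ≤ 9 * X := by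
  unfold tri
  refine (Finset.abs_sum_le_sum_abs _ _).trans ?_
  calc ∑ i, |∑ j, ∫ x, a i x * b j x * pd (c j) i x| ≤ ∑ i : Fin 3, ∑ j : Fin 3, X :=
        Finset.sum_le_sum fun i _ => (Finset.abs_sum_le_sum_abs _ _).trans
          (Finset.sum_le_sum fun j _ => h i j)
    _ = 9 * X := by simp; ring

theorem Pieces.est {L : ℝ} {U : ℕ → Fin 3 → V → ℝ} {H : ℕ → Fin 3 → V → ℂ} (X : Pieces L U H)
    {b n mu : ℕ → ℝ} (hb : ∀ p i x, |U p i x| ≤ b p) (hn : ∀ p i, nrm (U p i) ≤ n p)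
    (hm : ∀ p, 0 ≤ mu p) (hm2 : ∀ e a, e ≤ a + 1 → mu e ≤ 4 * mu a) (P : ℕ) :
    |∑ p ∈ Finset.range P, ∑ q ∈ Finset.range P, ∑ r ∈ Finset.range P, mu r * tri (U p) (U q) (U r)| ≤
      72 * (18 * π) * ∑ a ∈ Finset.range P, mu a * (L * 2 ^ a) * (∑ m ∈ Finset.range (a+1), b m) * n a ^ 2 := by
  have b0 : ∀ p, 0 ≤ b p := fun p => (abs_nonneg _).trans (hb p 0 0)
  have n0 : ∀ p, 0 ≤ n p := fun p => (nrm_nonneg _).trans (hn p 0)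
  have L0 := X.pos
  have l0 : ∀ p : ℕ, 0 ≤ L * 2 ^ p := fun p => by positivity
  have hpd : ∀ r i j, nrm (pd (U r j) i) ≤ 2 * π * (L * 2 ^ r) * n r := fun r i j =>
    ((X.bl r j).pd_nrm (l0 r) i).trans (by gcongr; exact hn r j)
  have h1 : ∀ p q r, |tri (U p) (U q) (U r)| ≤ (18 * π) * ((L * 2 ^ r) * b p * n q * n r) := by
    intro p q r
    refine (tri_bd (X := b p * (n q * (2 * π * (L * 2 ^ r) * n r))) fun i j => ?_).trans (le_of_eq (by ring))
    have := int3_le (X.bl q j).memLp ((X.bl r j).pd i).memLp (X.bl p i).cont.aestronglyMeasurable (hb p i)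
    calc |∫ x, U p i x * U q j x * pd (U r j) i x| = |∫ x, U q j x * pd (U r j) i x * U p i x| := by
          congr 2; ext x; ring
      _ ≤ _ := this
      _ ≤ _ := by
        have := b0 p; have := n0 q
        gcongr
        · exact nrm_nonneg _
        · exact hn q j
        · exact hpd r i j
  have h2 : ∀ p q r, |tri (U p) (U q) (U r)| ≤ (18 * π) * ((L * 2 ^ r) * b q * n p * n r) := by
    intro p q r
    refine (tri_bd (X := b q * (n p * (2 * π * (L * 2 ^ r) * n r))) fun i j => ?_).trans (le_of_eq (by ring))
    have := int3_le (X.bl p i).memLp ((X.bl r j).pd i).memLp (X.bl q j).cont.aestronglyMeasurable (hb q j)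
    calc |∫ x, U p i x * U q j x * pd (U r j) i x| = |∫ x, U p i x * pd (U r j) i x * U q j x| := by
          congr 2; ext x; ring
      _ ≤ _ := this
      _ ≤ _ := by
        have := b0 q; have := n0 p
        gcongr
        · exact nrm_nonneg _
        · exact hn p i
        · exact hpd r i j
  refine comb (t := fun p q r => tri (U p) (U q) (U r)) (lam := fun p => L * 2 ^ p) (by positivity) l0 ?_ hm hm2 b0 n0 h1 h2 ?_ ?_ P
  · intro e a h
    have : (2:ℝ) ^ e ≤ 2 ^ (a + 1) := pow_le_pow_right₀ (by norm_num) h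
    calc L * 2 ^ e ≤ L * 2 ^ (a+1) := by gcongr
      _ = _ := by ring
  · intro p q r
    rw [tri_antisymm (X.bl p) (X.bl q) (X.bl r) (X.div p), abs_neg]
    exact h2 p r q
  · have ar : ∀ p q r : ℕ, p + 2 ≤ r → q + 2 ≤ r → ∀ ξ : V, ‖ξ‖ < L * 2 ^ p + L * 2 ^ q → ‖ξ‖ < L * 2 ^ r / 2 := by
      intro p q r h1 h2 ξ h
      have a1 : (2:ℝ) ^ (p + 2) ≤ 2 ^ r := pow_le_pow_right₀ (by norm_num) h1
      have a2 : (2:ℝ) ^ (q + 2) ≤ 2 ^ r := pow_le_pow_right₀ (by norm_num) h2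
      rw [pow_add] at a1 a2
      nlinarith
    intro p q r h
    simp only [tri]
    refine Finset.sum_eq_zero fun i _ => Finset.sum_eq_zero fun j _ => ?_
    rcases h with h | h | h
    · refine (X.bl p i).triple_zero (X.bl q j) ((X.bl r j).pd i) fun ξ hξ => ?_
      rw [X.low r j ξ (by omega) (ar p q r h.1 h.2 ξ hξ), mul_zero]
    · have := (X.bl p i).triple_zero ((X.bl r j).pd i) (X.bl q j) fun ξ hξ => 
        X.low q j ξ (by omega) (ar p r q h.1 h.2 ξ hξ)
      rw [← this]; congr 1; ext x; ring
    · have := (X.bl q j).triple_zero ((X.bl r j).pd i) (X.bl p i) fun ξ hξ => 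
        X.low p i ξ (by omega) (ar q r p h.1 h.2 ξ hξ)
      rw [← this]; congr 1; ext x; ring

/-- The key finite-sum estimate. -/
theorem Pieces.est2 {L : ℝ} {U : ℕ → Fin 3 → V → ℝ} {H : ℕ → Fin 3 → V → ℂ} (X : Pieces L U H)
    {b n mu : ℕ → ℝ} (hb : ∀ p i x, |U p i x| ≤ b p) (hn : ∀ p i, nrm (U p i) ≤ n p)
    (hm : ∀ p, 0 ≤ mu p) (hm2 : ∀ e a, e ≤ a + 1 → mu e ≤ 4 * mu a) (N P : ℕ) (Mu : ℝ)
    (hN : ∀ r, N ≤ r → mu r = Mu) (hP : N ≤ P) :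
    |tri (fun i x => ∑ p ∈ Finset.range P, U p i x) (fun i x => ∑ p ∈ Finset.range P, U p i x)
      (fun i x => ∑ r ∈ Finset.range N, (Mu - mu r) * U r i x)| ≤
      72 * (18 * π) * ∑ a ∈ Finset.range P, mu a * (L * 2 ^ a) * (∑ m ∈ Finset.range (a+1), b m) * n a ^ 2 := by
  have L0 := X.pos
  have blP : ∀ p ∈ Finset.range P, ∀ i, BL (L * 2 ^ P) (U p i) (H p i) := by
    intro p hp i
    refine (X.bl p i).mono ?_
    have : (2:ℝ) ^ p ≤ 2 ^ P := pow_le_pow_right₀ (by norm_num) (Finset.mem_range.1 hp).le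
    gcongr
  have e0 : (fun (i : Fin 3) (x : V) => ∑ r ∈ Finset.range N, (Mu - mu r) * U r i x) =
      fun i x => ∑ r ∈ Finset.range P, (Mu - mu r) * U r i x := by
    ext i x
    apply Finset.sum_subset (Finset.range_mono hP)
    intro r _ hr
    rw [hN r (by simpa using hr)]; simp
  have blS := fun i => BL.sum (Finset.range P) (fun p hp => blP p hp i)
  rw [e0, tri_sum_right (Finset.range P) _ (fun i => (blS i).memLp) (fun i => (blS i).memLp) blP]
  have e1 : ∀ r ∈ Finset.range P, tri (fun i x => ∑ p ∈ Finset.range P, U p i x) (fun i x => ∑ p ∈ Finset.range P, U p i x) (U r) =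
      ∑ p ∈ Finset.range P, ∑ q ∈ Finset.range P, tri (U p) (U q) (U r) := fun r hr =>
    tri_add_left _ _ blP blP (blP r hr)
  rw [Finset.sum_congr rfl fun r hr => by rw [e1 r hr]]
  set s := Finset.range P
  have z : ∑ p ∈ s, ∑ q ∈ s, ∑ r ∈ s, tri (U p) (U q) (U r) = 0 := by
    refine Finset.sum_eq_zero fun p _ => ?_
    have : ∑ q ∈ s, ∑ r ∈ s, tri (U p) (U q) (U r) = - ∑ q ∈ s, ∑ r ∈ s, tri (U p) (U q) (U r) := by
      conv_lhs => rw [Finset.sum_comm]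
      rw [← Finset.sum_neg_distrib]
      refine Finset.sum_congr rfl fun q _ => ?_
      rw [← Finset.sum_neg_distrib]
      refine Finset.sum_congr rfl fun r _ => tri_antisymm (X.bl p) (X.bl r) (X.bl q) (X.div p)
    linarith
  have e2 : ∑ r ∈ s, (Mu - mu r) * ∑ p ∈ s, ∑ q ∈ s, tri (U p) (U q) (U r) =
      - ∑ p ∈ s, ∑ q ∈ s, ∑ r ∈ s, mu r * tri (U p) (U q) (U r) := by
    have a : ∑ r ∈ s, (Mu - mu r) * ∑ p ∈ s, ∑ q ∈ s, tri (U p) (U q) (U r) =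
        ∑ p ∈ s, ∑ q ∈ s, ∑ r ∈ s, (Mu - mu r) * tri (U p) (U q) (U r) := by
      simp_rw [Finset.mul_sum]
      rw [Finset.sum_comm]
      exact Finset.sum_congr rfl fun p _ => Finset.sum_comm
    rw [a]
    simp_rw [sub_mul, Finset.sum_sub_distrib, ← Finset.mul_sum]
    rw [z]; simp
  rw [e2, abs_neg]
  exact X.est hb hn hm hm2 P

end

section

theorem time_ident {Z G : ℝ → ℝ} {z0 C : ℝ} (hZ : AEStronglyMeasurable Z (volume.restrict (Set.Ioi 0)))
    (hG : AEStronglyMeasurable G (volume.restrict (Set.Ioi 0)))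
    (bZ : ∀ᵐ t ∂(volume.restrict (Set.Ioi (0:ℝ))), |Z t| ≤ C)
    (bG : ∀ᵐ t ∂(volume.restrict (Set.Ioi (0:ℝ))), |G t| ≤ C)
    (hw : ∀ θ : ℝ → ℝ, ContDiff ℝ (⊤ : ℕ∞) θ → HasCompactSupport θ →
      (∫ t in Set.Ioi (0:ℝ), (deriv θ t * Z t + θ t * G t)) + θ 0 * z0 = 0) :
    ∀ᵐ t ∂(volume.restrict (Set.Ioi (0:ℝ))), Z t = z0 + ∫ s in Set.Ioc 0 t, G s := by
  have iOn : ∀ {F : ℝ → ℝ}, AEStronglyMeasurable F (volume.restrict (Set.Ioi 0)) →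
      (∀ᵐ t ∂(volume.restrict (Set.Ioi (0:ℝ))), |F t| ≤ C) → ∀ b, IntegrableOn F (Set.Ioc 0 b) := by
    intro F hF bF b
    have : IsFiniteMeasure (volume.restrict (Set.Ioc 0 b)) := ⟨by simp⟩
    refine Integrable.of_bound (hF.mono_set Set.Ioc_subset_Ioi_self) C ?_
    exact ae_restrict_of_ae_restrict_of_subset Set.Ioc_subset_Ioi_self bF
  have iG := iOn hG bG
  have iZ := iOn hZ bZ
  set I : ℝ → ℝ := fun t => ∫ s in Set.Ioc 0 t, G s with hI
  have Icont : ContinuousOn I (Set.Ioi 0) := by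
    intro t ht
    have h1 : ContinuousOn (fun x => ∫ s in (0:ℝ)..x, G s) (Set.uIcc 0 (t+1)) := by
      apply intervalIntegral.continuousOn_primitive_interval
      rw [Set.uIcc_of_le (by have : (0:ℝ) < t := ht; linarith), integrableOn_Icc_iff_integrableOn_Ioc]
      exact iG (t+1)
    have ht' : (0:ℝ) < t := ht
    have h2 : ContinuousAt (fun x => ∫ s in (0:ℝ)..x, G s) t := h1.continuousAt (by
      rw [Set.uIcc_of_le (by linarith)]; exact Icc_mem_nhds ht' (by linarith))
    refine (h2.congr ?_).continuousWithinAt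
    filter_upwards [lt_mem_nhds ht'] with x hx
    rw [intervalIntegral.integral_of_le hx.le]
  have key := IsOpen.ae_eq_zero_of_integral_contDiff_smul_eq_zero (μ := (volume : Measure ℝ))
    (U := Set.Ioi (0:ℝ)) isOpen_Ioi (f := fun t => Z t - z0 - I t) ?_ ?_
  · rw [ae_restrict_iff' measurableSet_Ioi]
    filter_upwards [key] with t ht h
    have := ht h
    simp only [hI] at this
    linarith
  · have lZ : LocallyIntegrableOn Z (Set.Ioi 0) := by
      intro t ht
      have ht' : (0:ℝ) < t := ht
      refine ⟨Set.Ioc 0 (t+1), mem_nhdsWithin_of_mem_nhds (Ioc_mem_nhds ht' (by linarith)), iZ _⟩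
    have lz : LocallyIntegrableOn (fun _ : ℝ => z0) (Set.Ioi 0) := continuousOn_const.locallyIntegrableOn measurableSet_Ioi
    exact (lZ.sub lz).sub (Icont.locallyIntegrableOn measurableSet_Ioi)
  · intro ψ hψ hψs hψt
    obtain ⟨b, hb0, hb⟩ : ∃ b : ℝ, 0 < b ∧ ∀ s, b ≤ s → ψ s = 0 := by
      obtain ⟨r, hr⟩ := hψs.isCompact.isBounded.subset_closedBall 0
      refine ⟨|r| + 1, by positivity, fun s hs => ?_⟩
      by_contra h
      have := hr (subset_tsupport _ h)
      rw [Metric.mem_closedBall, dist_zero_right, Real.norm_eq_abs] at this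
      have := le_abs_self s; have := le_abs_self r; linarith
    have hn : ∀ s, s ≤ 0 → ψ s = 0 := by
      intro s hs; by_contra h
      exact absurd (hψt (subset_tsupport _ h)) (by simpa using hs)
    have ψi : Integrable ψ volume := hψ.continuous.integrable_of_hasCompactSupport hψs
    set c := ∫ s, ψ s with hc
    set θ0 : ℝ → ℝ := fun t => (∫ s in (0:ℝ)..t, ψ s) - c with hθ0
    have dθ0 : ∀ t, HasDerivAt θ0 (ψ t) t := fun t =>
      (intervalIntegral.integral_hasDerivAt_right (hψ.continuous.intervalIntegrable _ _)
        (hψ.continuous.stronglyMeasurableAtFilter _ _) hψ.continuous.continuousAt).sub_const c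
    have sθ0 : ContDiff ℝ (⊤ : ℕ∞) θ0 := by
      rw [contDiff_infty_iff_deriv]
      refine ⟨fun t => (dθ0 t).differentiableAt, ?_⟩
      have : deriv θ0 = ψ := funext fun t => (dθ0 t).deriv
      rw [this]; exact hψ
    have θ0eq : ∀ t, 0 ≤ t → θ0 t = - ∫ s in Set.Ioi t, ψ s := by
      intro t ht
      have e1 : c = ∫ s in Set.Ioi 0, ψ s := by
        rw [hc, ← integral_indicator measurableSet_Ioi]
        congr 1; ext s
        by_cases hs : s ∈ Set.Ioi (0:ℝ)
        · simp [hs]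
        · rw [Set.indicator_of_notMem hs, hn s (by simpa using hs)]
      have := intervalIntegral.integral_interval_add_Ioi (μ := volume) (a := 0) (b := t) ψi.integrableOn ψi.integrableOn
      simp only [hθ0]; rw [e1, ← this]; ring
    set χ : ℝ → ℝ := fun t => Real.smoothTransition (t + 2) with hχ
    have sχ : ContDiff ℝ (⊤ : ℕ∞) χ := Real.smoothTransition.contDiff.comp (contDiff_id.add contDiff_const)
    have χ1 : ∀ t, -1 ≤ t → χ t = 1 := fun t ht => Real.smoothTransition.one_of_one_le (by linarith)
    have χ0 : ∀ t, t ≤ -2 → χ t = 0 := fun t ht => Real.smoothTransition.zero_of_nonpos (by linarith)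
    have hb2 : ∀ t, b ≤ t → θ0 t = 0 := by
      intro t ht
      rw [θ0eq t (hb0.le.trans ht), setIntegral_eq_zero_of_forall_eq_zero, neg_zero]
      exact fun s hs => hb s (ht.trans (le_of_lt hs))
    have := hw (fun t => χ t * θ0 t) (sχ.mul sθ0) ?_
    · have e1 : ∀ t ∈ Set.Ioi (0:ℝ), deriv (fun t => χ t * θ0 t) t * Z t + χ t * θ0 t * G t = ψ t * Z t + θ0 t * G t := by
        intro t ht
        have ht' : (0:ℝ) < t := ht
        have : (fun t => χ t * θ0 t) =ᶠ[nhds t] θ0 := by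
          filter_upwards [lt_mem_nhds ht'] with x hx
          rw [χ1 x (by linarith), one_mul]
        rw [this.deriv_eq, (dθ0 t).deriv, χ1 t (by linarith), one_mul]
      rw [setIntegral_congr_fun measurableSet_Ioi e1] at this
      rw [χ1 0 (by norm_num), one_mul] at this
      have z : θ0 0 = - c := by simp [hθ0]
      rw [z] at this
      -- Fubini
      have cut : ∀ {F : ℝ → ℝ}, (∀ s, s ≤ 0 ∨ b ≤ s → F s = 0) → ∫ s, F s = ∫ s in Set.Ioc 0 b, F s := by
        intro F hF
        rw [← integral_indicator measurableSet_Ioc]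
        congr 1; ext s
        by_cases hs : s ∈ Set.Ioc 0 b
        · simp [hs]
        · rw [Set.indicator_of_notMem hs, hF s]
          by_contra hcon; push Not at hcon; exact hs ⟨hcon.1, hcon.2.le⟩
      have iψZ : IntegrableOn (fun t => ψ t * Z t) (Set.Ioi 0) := by
        have h1 : IntegrableOn (fun t => ψ t * Z t) (Set.Ioc 0 b) := by
          obtain ⟨B, hB⟩ := hψs.exists_bound_of_continuous hψ.continuous
          exact (iZ b).bdd_mul hψ.continuous.aestronglyMeasurable (ae_of_all _ hB)
        refine h1.of_forall_diff_eq_zero measurableSet_Ioi fun x hx => ?_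
        rw [hb x, zero_mul]
        by_contra h; push Not at h; exact hx.2 ⟨hx.1, h.le⟩
      have iθG : IntegrableOn (fun t => θ0 t * G t) (Set.Ioi 0) := by
        have h1 : IntegrableOn (fun t => θ0 t * G t) (Set.Ioc 0 b) := by
          obtain ⟨B, hB⟩ := isCompact_Icc.exists_bound_of_continuousOn (sθ0.continuous.continuousOn (s := Set.Icc 0 b))
          refine (iG b).bdd_mul (c := B) sθ0.continuous.aestronglyMeasurable ?_
          rw [ae_restrict_iff' measurableSet_Ioc]
          exact ae_of_all _ fun x hx => hB x ⟨hx.1.le, hx.2⟩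
        refine h1.of_forall_diff_eq_zero measurableSet_Ioi fun x hx => ?_
        rw [hb2 x, zero_mul]
        by_contra h; push Not at h; exact hx.2 ⟨hx.1, h.le⟩
      rw [integral_add iψZ iθG] at this
      have swap : ∫ t in Set.Ioi 0, θ0 t * G t = - ∫ s, ψ s * I s := by
        set G' := (Set.Ioc 0 b).indicator G with hG'
        have iG' : Integrable G' volume := (integrable_indicator_iff measurableSet_Ioc).2 (iG b)
        have iK : Integrable (fun p : ℝ × ℝ => {p : ℝ × ℝ | p.1 < p.2}.indicator (fun p => G' p.1 * ψ p.2) p) (volume.prod volume) :=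
          (iG'.mul_prod ψi).indicator (measurableSet_lt measurable_fst measurable_snd)
        have sw := integral_integral_swap (f := fun t s => {p : ℝ × ℝ | p.1 < p.2}.indicator (fun p => G' p.1 * ψ p.2) (t, s)) iK
        have l : ∀ t, ∫ s, {p : ℝ × ℝ | p.1 < p.2}.indicator (fun p => G' p.1 * ψ p.2) (t, s) = - (Set.Ioi 0).indicator (fun t => θ0 t * G t) t := by
          intro t
          have e : ∀ s, {p : ℝ × ℝ | p.1 < p.2}.indicator (fun p => G' p.1 * ψ p.2) (t, s) = G' t * (Set.Ioi t).indicator ψ s := by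
            intro s
            by_cases h : t < s
            · rw [Set.indicator_of_mem (show (t,s) ∈ {p : ℝ × ℝ | p.1 < p.2} from h), Set.indicator_of_mem (show s ∈ Set.Ioi t from h)]
            · rw [Set.indicator_of_notMem (show (t,s) ∉ {p : ℝ × ℝ | p.1 < p.2} from h), Set.indicator_of_notMem (show s ∉ Set.Ioi t from h), mul_zero]
          simp_rw [e]
          rw [integral_const_mul, integral_indicator measurableSet_Ioi]
          by_cases ht : t ∈ Set.Ioi (0:ℝ)
          · have ht' : (0:ℝ) < t := ht
            rw [Set.indicator_of_mem ht, θ0eq t ht'.le]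
            by_cases htb : t ≤ b
            · rw [hG', Set.indicator_of_mem (show t ∈ Set.Ioc 0 b from ⟨ht', htb⟩)]; ring
            · have := hb2 t (by linarith)
              rw [θ0eq t ht'.le] at this
              rw [neg_eq_zero.1 this]; simp
          · rw [Set.indicator_of_notMem ht, hG', Set.indicator_of_notMem (fun h => ht h.1)]; simp
        have r : ∀ s, ∫ t, {p : ℝ × ℝ | p.1 < p.2}.indicator (fun p => G' p.1 * ψ p.2) (t, s) = ψ s * I s := by
          intro s
          have e : ∀ t, {p : ℝ × ℝ | p.1 < p.2}.indicator (fun p => G' p.1 * ψ p.2) (t, s) = ψ s * (Set.Iio s).indicator G' t := by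
            intro t
            by_cases h : t < s
            · rw [Set.indicator_of_mem (show (t,s) ∈ {p : ℝ × ℝ | p.1 < p.2} from h), Set.indicator_of_mem (show t ∈ Set.Iio s from h), mul_comm]
            · rw [Set.indicator_of_notMem (show (t,s) ∉ {p : ℝ × ℝ | p.1 < p.2} from h), Set.indicator_of_notMem (show t ∉ Set.Iio s from h), mul_zero]
          simp_rw [e]
          rw [integral_const_mul]
          by_cases h0 : s ≤ 0
          · rw [hn s h0]; simp
          by_cases h1 : b ≤ s
          · rw [hb s h1]; simp
          push Not at h0 h1
          congr 1
          rw [hG', Set.indicator_indicator, integral_indicator (measurableSet_Iio.inter measurableSet_Ioc), hI]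
          simp only
          rw [integral_Ioc_eq_integral_Ioo]
          congr 2; ext t; simp only [Set.mem_inter_iff, Set.mem_Iio, Set.mem_Ioc, Set.mem_Ioo]
          constructor
          · rintro ⟨a, b, c⟩; exact ⟨b, a⟩
          · rintro ⟨a, c⟩; exact ⟨c, a, by linarith⟩
        simp_rw [l, r] at sw
        rw [integral_neg, integral_indicator measurableSet_Ioi] at sw
        linarith
      rw [swap] at this
      have fin : ∫ t, ψ t • (Z t - z0 - I t) = (∫ t in Set.Ioi 0, ψ t * Z t) - c * z0 - ∫ s, ψ s * I s := by
        have e0 : ∫ t in Set.Ioi 0, ψ t * Z t = ∫ t, ψ t * Z t := by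
          rw [← integral_indicator measurableSet_Ioi]
          congr 1; ext s
          by_cases hs : s ∈ Set.Ioi (0:ℝ)
          · simp [hs]
          · rw [Set.indicator_of_notMem hs, hn s (by simpa using hs), zero_mul]
        have iψZ' : Integrable (fun t => ψ t * Z t) volume := by
          refine iψZ.integrable_of_forall_notMem_eq_zero fun x hx => ?_
          rw [hn x (by simpa using hx), zero_mul]
        have iψI : Integrable (fun t => ψ t * I t) volume := by
          have : Continuous (fun t => ψ t * I t) := by
            rw [continuous_iff_continuousAt]
            intro t
            by_cases ht : t ∈ Set.Ioi (0:ℝ)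
            · exact hψ.continuous.continuousAt.mul (Icont.continuousAt (isOpen_Ioi.mem_nhds ht))
            · have h1 := notMem_tsupport_iff_eventuallyEq.1 fun h => ht (hψt h)
              have h2 : (fun t => ψ t * I t) =ᶠ[nhds t] fun _ => 0 := by
                filter_upwards [h1] with x hx
                rw [hx]; simp
              exact continuousAt_const.congr h2.symm
          refine this.integrable_of_hasCompactSupport (hψs.mul_right)
        rw [e0, hc, ← integral_mul_const, ← integral_sub iψZ' (ψi.mul_const _), ← integral_sub _ iψI]
        · congr 1; ext t; simp only [smul_eq_mul]; ring
        · exact iψZ'.sub (ψi.mul_const _)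
      rw [fin]; linarith
    · refine HasCompactSupport.intro (isCompact_Icc (a := -2) (b := b)) fun t ht => ?_
      rw [Set.mem_Icc, not_and_or] at ht
      rcases ht with h | h
      · rw [χ0 t (by linarith), zero_mul]
      · rw [hb2 t (by linarith), mul_zero]

end

section

def prI (v : V → V) (w : Fin 3 → V → ℝ) (x : V) : ℝ := ∑ j, v x j * w j x
def FI (ν : ℝ) (v : V → V) (w : Fin 3 → V → ℝ) (x : V) : ℝ :=
  ν * (∑ j, v x j * ∑ i, pd (pd (w j) i) i x) + ∑ i, ∑ j, v x i * v x j * pd (w j) i x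
def prE (v : V → V) (w : Fin 3 → V → ℝ) : ℝ := ∫ x, prI v w x
def Fop (ν : ℝ) (v : V → V) (w : Fin 3 → V → ℝ) : ℝ := ∫ x, FI ν v w x

structure Adm (w : Fin 3 → V → ℝ) (g : V → ℝ) (B : ℝ) : Prop where
  smooth : ∀ j, ContDiff ℝ (⊤ : ℕ∞) (w j)
  hg : MemLp g 2 volume
  b0 : ∀ j x, |w j x| ≤ g x
  b1 : ∀ i j x, |pd (w j) i x| ≤ B
  b2 : ∀ i j x, |pd (pd (w j) i) i x| ≤ g x

theorem contDiff_pd {f : V → ℝ} (hf : ContDiff ℝ (⊤ : ℕ∞) f) (i : Fin 3) : ContDiff ℝ (⊤ : ℕ∞) (pd f i) := by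
  have : ContDiff ℝ (⊤ : ℕ∞) (fderiv ℝ f) := hf.fderiv_right (by simp)
  exact this.clm_apply contDiff_const

theorem co_le (v : V) (i : Fin 3) : |v i| ≤ ‖v‖ := by
  have := PiLp.norm_apply_le v i
  rwa [Real.norm_eq_abs] at this

theorem memLp_co {v : V → V} (hv : MemLp v 2 volume) (i : Fin 3) : MemLp (fun x => v x i) 2 volume := by
  refine hv.of_le ?_ (ae_of_all _ fun x => PiLp.norm_apply_le (v x) i)
  exact (EuclideanSpace.proj (𝕜 := ℝ) i : V →L[ℝ] ℝ).continuous.comp_aestronglyMeasurable hv.1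

theorem nrm_co {v : V → V} (hv : MemLp v 2 volume) (i : Fin 3) : nrm (fun x => v x i) ≤ nrm v := by
  have := nrm_le_of_le (f := fun x => v x i) hv (c := 1) (by norm_num)
    (ae_of_all _ fun x => by rw [one_mul]; exact PiLp.norm_apply_le (v x) i)
  simpa using this

namespace Adm
variable {w : Fin 3 → V → ℝ} {g : V → ℝ} {B : ℝ}

theorem prI_le (A : Adm w g B) (v : V → V) (x : V) : |prI v w x| ≤ 3 * (‖v x‖ * g x) := by
  unfold prI
  refine (Finset.abs_sum_le_sum_abs _ _).trans ?_
  calc ∑ j, |v x j * w j x| ≤ ∑ j : Fin 3, ‖v x‖ * g x := Finset.sum_le_sum fun j _ => by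
        rw [abs_mul]
        exact mul_le_mul (co_le _ _) (A.b0 j x) (abs_nonneg _) (norm_nonneg _)
    _ = _ := by simp

theorem FI_le (A : Adm w g B) (ν : ℝ) (v : V → V) (x : V) :
    |FI ν v w x| ≤ |ν| * (9 * (‖v x‖ * g x)) + 9 * B * ‖v x‖ ^ 2 := by
  unfold FI
  refine (abs_add_le _ _).trans (add_le_add ?_ ?_)
  · rw [abs_mul]
    gcongr
    refine (Finset.abs_sum_le_sum_abs _ _).trans ?_
    calc ∑ j, |v x j * ∑ i, pd (pd (w j) i) i x| ≤ ∑ j : Fin 3, ‖v x‖ * (∑ i : Fin 3, g x) :=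
          Finset.sum_le_sum fun j _ => by
            rw [abs_mul]
            exact mul_le_mul (co_le _ _) ((Finset.abs_sum_le_sum_abs _ _).trans
              (Finset.sum_le_sum fun i _ => A.b2 i j x)) (abs_nonneg _) (norm_nonneg _)
      _ = _ := by simp; ring
  · refine (Finset.abs_sum_le_sum_abs _ _).trans ?_
    calc ∑ i, |∑ j, v x i * v x j * pd (w j) i x| ≤ ∑ i : Fin 3, ∑ j : Fin 3, ‖v x‖ * ‖v x‖ * B :=
          Finset.sum_le_sum fun i _ => (Finset.abs_sum_le_sum_abs _ _).trans
            (Finset.sum_le_sum fun j _ => by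
              rw [abs_mul, abs_mul]
              exact mul_le_mul (mul_le_mul (co_le _ _) (co_le _ _) (abs_nonneg _) (norm_nonneg _))
                (A.b1 i j x) (abs_nonneg _) (by positivity))
      _ = _ := by simp; ring

theorem cont2 (A : Adm w g B) (i j : Fin 3) : Continuous (NSE.pd (NSE.pd (w j) i) i) :=
  (contDiff_pd (contDiff_pd (A.smooth j) i) i).continuous
theorem cont1 (A : Adm w g B) (i j : Fin 3) : Continuous (NSE.pd (w j) i) :=
  (contDiff_pd (A.smooth j) i).continuous

theorem prI_meas (A : Adm w g B) {v : V → V} (hv : MemLp v 2 volume) : AEStronglyMeasurable (prI v w) volume := by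
  unfold prI
  have := fun j => (memLp_co hv j).1
  have := fun j => (A.smooth j).continuous.aestronglyMeasurable (μ := (volume : Measure V))
  fun_prop

theorem FI_meas (A : Adm w g B) (ν : ℝ) {v : V → V} (hv : MemLp v 2 volume) : AEStronglyMeasurable (FI ν v w) volume := by
  unfold FI
  have := fun j => (memLp_co hv j).1
  have := fun i j => (A.cont2 i j).aestronglyMeasurable (μ := (volume : Measure V))
  have := fun i j => (A.cont1 i j).aestronglyMeasurable (μ := (volume : Measure V))
  fun_prop

theorem dom0 (A : Adm w g B) {v : V → V} (hv : MemLp v 2 volume) : Integrable (fun x => ‖v x‖ * g x) volume :=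
  (int_mul_le hv.norm A.hg).1

theorem dom (A : Adm w g B) (ν : ℝ) {v : V → V} (hv : MemLp v 2 volume) :
    Integrable (fun x => |ν| * (9 * (‖v x‖ * g x)) + 9 * B * ‖v x‖ ^ 2) volume :=
  (((A.dom0 hv).const_mul _).const_mul _).add ((int_sq hv).const_mul _)

theorem prI_int (A : Adm w g B) {v : V → V} (hv : MemLp v 2 volume) : Integrable (prI v w) volume :=
  ((A.dom0 hv).const_mul 3).mono' (A.prI_meas hv) (ae_of_all _ (A.prI_le v))

theorem FI_int (A : Adm w g B) (ν : ℝ) {v : V → V} (hv : MemLp v 2 volume) : Integrable (FI ν v w) volume :=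
  (A.dom ν hv).mono' (A.FI_meas ν hv) (ae_of_all _ (A.FI_le ν v))

theorem prE_le (A : Adm w g B) {v : V → V} (hv : MemLp v 2 volume) : |prE v w| ≤ 3 * (nrm v * nrm g) := by
  unfold prE
  refine abs_integral_le_integral_abs.trans ?_
  calc ∫ x, |prI v w x| ≤ ∫ x, 3 * |‖v x‖ * g x| :=
        integral_mono (A.prI_int hv).abs ((A.dom0 hv).abs.const_mul 3) fun x =>
          (A.prI_le v x).trans (by gcongr; exact le_abs_self _)
    _ = 3 * ∫ x, |‖v x‖ * g x| := integral_const_mul _ _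
    _ ≤ _ := by
      gcongr
      refine (int_mul_le hv.norm A.hg).2.trans (le_of_eq ?_)
      rw [nrm, nrm, nrm, eLpNorm_norm]

theorem Fop_le (A : Adm w g B) (ν : ℝ) {v : V → V} (hv : MemLp v 2 volume) :
    |Fop ν v w| ≤ |ν| * (9 * (nrm v * nrm g)) + 9 * B * nrm v ^ 2 := by
  unfold Fop
  refine abs_integral_le_integral_abs.trans ?_
  have h1 := (((A.dom0 hv).abs.const_mul 9).const_mul |ν|)
  have h2 := ((int_sq hv).const_mul (9 * B))
  calc ∫ x, |FI ν v w x| ≤ ∫ x, (|ν| * (9 * |‖v x‖ * g x|) + 9 * B * ‖v x‖ ^ 2) :=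
        integral_mono (A.FI_int ν hv).abs (h1.add h2) fun x =>
          (A.FI_le ν v x).trans (by gcongr; exact le_abs_self _)
    _ = |ν| * (9 * ∫ x, |‖v x‖ * g x|) + 9 * B * nrm v ^ 2 := by
      rw [integral_add h1 h2, integral_const_mul, integral_const_mul, integral_const_mul, nrm_sq hv]
    _ ≤ _ := by
      gcongr
      refine (int_mul_le hv.norm A.hg).2.trans (le_of_eq ?_)
      rw [nrm, nrm, nrm, eLpNorm_norm]

theorem prE_sm (A : Adm w g B) {u : ℝ → V → V} (hu : Measurable (Function.uncurry u)) :
    StronglyMeasurable (fun t => prE (u t) w) := by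
  have hc : ∀ j : Fin 3, Measurable (fun p : ℝ × V => u p.1 p.2 j) := fun j =>
    (EuclideanSpace.proj (𝕜 := ℝ) j : V →L[ℝ] ℝ).measurable.comp hu
  have : Measurable (Function.uncurry fun t x => prI (u t) w x) := by
    unfold prI Function.uncurry
    have := fun j => (A.smooth j).continuous.measurable
    fun_prop
  exact this.stronglyMeasurable.integral_prod_right

theorem Fop_sm (A : Adm w g B) (ν : ℝ) {u : ℝ → V → V} (hu : Measurable (Function.uncurry u)) :
    StronglyMeasurable (fun t => Fop ν (u t) w) := by
  have hc : ∀ j : Fin 3, Measurable (fun p : ℝ × V => u p.1 p.2 j) := fun j =>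
    (EuclideanSpace.proj (𝕜 := ℝ) j : V →L[ℝ] ℝ).measurable.comp hu
  have : Measurable (Function.uncurry fun t x => FI ν (u t) w x) := by
    unfold FI Function.uncurry
    have := fun i j => (A.cont2 i j).measurable
    have := fun i j => (A.cont1 i j).measurable
    fun_prop
  exact this.stronglyMeasurable.integral_prod_right

theorem prE_lim {wn : ℕ → Fin 3 → V → ℝ} (A : ∀ n, Adm (wn n) g B) {v : V → V} (hv : MemLp v 2 volume)
    (h0 : ∀ j x, Tendsto (fun n => wn n j x) atTop (nhds (w j x))) :
    Tendsto (fun n => prE v (wn n)) atTop (nhds (prE v w)) := by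
  refine tendsto_integral_of_dominated_convergence _ (fun n => (A n).prI_meas hv)
    (((A 0).dom0 hv).const_mul 3) (fun n => ae_of_all _ ((A n).prI_le v)) (ae_of_all _ fun x => ?_)
  unfold prI
  exact tendsto_finsetSum _ fun j _ => (h0 j x).const_mul _

theorem Fop_lim {wn : ℕ → Fin 3 → V → ℝ} (A : ∀ n, Adm (wn n) g B) (ν : ℝ) {v : V → V} (hv : MemLp v 2 volume)
    (h1 : ∀ i j x, Tendsto (fun n => NSE.pd (wn n j) i x) atTop (nhds (NSE.pd (w j) i x)))
    (h2 : ∀ i j x, Tendsto (fun n => NSE.pd (NSE.pd (wn n j) i) i x) atTop (nhds (NSE.pd (NSE.pd (w j) i) i x))) :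
    Tendsto (fun n => Fop ν v (wn n)) atTop (nhds (Fop ν v w)) := by
  refine tendsto_integral_of_dominated_convergence _ (fun n => (A n).FI_meas ν hv)
    ((A 0).dom ν hv) (fun n => ae_of_all _ ((A n).FI_le ν v)) (ae_of_all _ fun x => ?_)
  unfold FI
  refine ((tendsto_finsetSum _ fun j _ => (tendsto_finsetSum _ fun i _ => h2 i j x).const_mul _).const_mul _).add ?_
  exact tendsto_finsetSum _ fun i _ => tendsto_finsetSum _ fun j _ => (h1 i j x).const_mul _
end Adm

/-- The integrated weak identity. -/
def WI (ν : ℝ) (u₀ : V → V) (u : ℝ → V → V) (w : Fin 3 → V → ℝ) : Prop :=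
  ∀ᵐ t ∂(volume.restrict (Set.Ioi (0:ℝ))), prE (u t) w = prE u₀ w + ∫ s in Set.Ioc 0 t, Fop ν (u s) w

theorem WI_lim {ν : ℝ} {u₀ : V → V} {u : ℝ → V → V} {wn : ℕ → Fin 3 → V → ℝ} {w : Fin 3 → V → ℝ} {C : ℝ}
    (h : ∀ n, WI ν u₀ u (wn n)) (h0 : Tendsto (fun n => prE u₀ (wn n)) atTop (nhds (prE u₀ w)))
    (h1 : ∀ t, 0 < t → Tendsto (fun n => prE (u t) (wn n)) atTop (nhds (prE (u t) w)))
    (h2 : ∀ t, 0 < t → Tendsto (fun n => Fop ν (u t) (wn n)) atTop (nhds (Fop ν (u t) w)))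
    (hm : ∀ n, StronglyMeasurable (fun t => Fop ν (u t) (wn n)))
    (hC : ∀ n, ∀ᵐ t ∂(volume.restrict (Set.Ioi (0:ℝ))), |Fop ν (u t) (wn n)| ≤ C) : WI ν u₀ u w := by
  unfold WI at *
  rw [← ae_all_iff] at h
  filter_upwards [h, ae_restrict_mem measurableSet_Ioi] with t ht ht0
  refine tendsto_nhds_unique (h1 t ht0) ?_
  simp_rw [ht]
  refine h0.add ?_
  have : IsFiniteMeasure (volume.restrict (Set.Ioc 0 t)) := ⟨by simp⟩
  refine tendsto_integral_of_dominated_convergence (fun _ => C) (fun n => (hm n).aestronglyMeasurable)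
    (integrable_const C) (fun n => ae_restrict_of_ae_restrict_of_subset Set.Ioc_subset_Ioi_self (hC n)) ?_
  filter_upwards [ae_restrict_mem measurableSet_Ioc] with s hs
  exact h2 s hs.1

theorem LH_bound {ν : ℝ} {u₀ : V → V} {u : ℝ → V → V} (hu : IsLerayHopf ν u₀ u) :
    ∃ M : ℝ, 0 ≤ M ∧ ∀ᵐ t ∂(volume.restrict (Set.Ioi (0:ℝ))), nrm (u t) ≤ M := by
  refine ⟨(essSup (fun t => eLpNorm (u t) 2 volume) (volume.restrict (Set.Ioi (0:ℝ)))).toReal, ENNReal.toReal_nonneg, ?_⟩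
  filter_upwards [ae_le_essSup (f := fun t => eLpNorm (u t) 2 volume) (μ := volume.restrict (Set.Ioi (0:ℝ)))] with t ht
  exact ENNReal.toReal_mono hu.bddL2.ne ht

theorem WI_test {ν : ℝ} {u₀ : V → V} {u : ℝ → V → V} (hu : IsLerayHopf ν u₀ u)
    {w : Fin 3 → V → ℝ} {g : V → ℝ} {B : ℝ} (A : Adm w g B) (hs : ∀ j, HasCompactSupport (w j))
    (hdiv : ∀ x, ∑ i, pd (w i) i x = 0) : WI ν u₀ u w := by
  obtain ⟨M, M0, hM⟩ := LH_bound hu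
  have Bn : 0 ≤ B := (abs_nonneg _).trans (A.b1 0 0 0)
  have gn := nrm_nonneg g
  have b1 : ∀ᵐ t ∂(volume.restrict (Set.Ioi (0:ℝ))), |prE (u t) w| ≤ 3 * (M * nrm g) + (|ν| * (9 * (M * nrm g)) + 9 * B * M ^ 2) := by
    filter_upwards [hM, ae_restrict_mem measurableSet_Ioi] with t h1 ht
    refine (A.prE_le (hu.memL2 t ht)).trans ?_
    have : 0 ≤ |ν| * (9 * (M * nrm g)) + 9 * B * M ^ 2 := by positivity
    have : 3 * (nrm (u t) * nrm g) ≤ 3 * (M * nrm g) := by gcongr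
    linarith
  have b2 : ∀ᵐ t ∂(volume.restrict (Set.Ioi (0:ℝ))), |Fop ν (u t) w| ≤ 3 * (M * nrm g) + (|ν| * (9 * (M * nrm g)) + 9 * B * M ^ 2) := by
    filter_upwards [hM, ae_restrict_mem measurableSet_Ioi] with t h1 ht
    refine (A.Fop_le ν (hu.memL2 t ht)).trans ?_
    have := nrm_nonneg (u t)
    have : 0 ≤ 3 * (M * nrm g) := by positivity
    have : |ν| * (9 * (nrm (u t) * nrm g)) + 9 * B * nrm (u t) ^ 2 ≤ |ν| * (9 * (M * nrm g)) + 9 * B * M ^ 2 := by gcongr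
    linarith
  refine time_ident (A.prE_sm hu.meas).aestronglyMeasurable (A.Fop_sm ν hu.meas).aestronglyMeasurable b1 b2 ?_
  intro θ hθ hθs
  have := hu.weak (fun t x => WithLp.toLp 2 (fun j => θ t * w j x)) ?_ ?_ ?_
  · refine Eq.trans ?_ this
    congr 1
    · refine setIntegral_congr_fun measurableSet_Ioi fun t ht => ?_
      have hv := hu.memL2 t ht
      simp only [prE, Fop]
      rw [← integral_const_mul, ← integral_const_mul, ← integral_add ((A.prI_int hv).const_mul _) ((A.FI_int ν hv).const_mul _)]
      congr 1; ext x
      have e1 : ∀ j, deriv (fun s => θ s * w j x) t = deriv θ t * w j x := fun j => by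
        rw [deriv_mul_const (hθ.differentiable (by simp) t)]
      have e2 : ∀ j i y, pd (fun z => θ t * w j z) i y = θ t * pd (w j) i y := by
        intro j i y
        simp only [pd]; rw [fderiv_const_mul ((A.smooth j).differentiable (by simp) y)]; simp
      have e3 : ∀ j i y, pd (fun z => θ t * pd (w j) i z) i y = θ t * pd (pd (w j) i) i y := by
        intro j i y
        conv_lhs => rw [pd]
        rw [fderiv_const_mul ((contDiff_pd (A.smooth j) i).differentiable (by simp) y)]
        simp [pd]
      simp only [e1, e2, e3, prI, FI, Fin.sum_univ_three]
      ring
    · rw [prE, ← integral_const_mul]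
      congr 1; ext x; simp only [prI, Fin.sum_univ_three]; ring
  · unfold Function.uncurry
    rw [contDiff_piLp]
    intro j
    exact (hθ.comp contDiff_fst).mul ((A.smooth j).comp contDiff_snd)
  · have hK : IsCompact (tsupport θ ×ˢ ⋃ j, tsupport (w j)) :=
      hθs.isCompact.prod (isCompact_iUnion fun j => (hs j).isCompact)
    refine HasCompactSupport.intro hK fun p hp => ?_
    simp only [Function.uncurry]
    ext j
    simp only [PiLp.zero_apply]
    by_contra h
    apply hp
    refine ⟨subset_tsupport _ (left_ne_zero_of_mul h), Set.mem_iUnion.2 ⟨j, subset_tsupport _ (right_ne_zero_of_mul h)⟩⟩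
  · intro t x
    have e2 : ∀ j i y, pd (fun z => θ t * w j z) i y = θ t * pd (w j) i y := by
      intro j i y
      simp only [pd]; rw [fderiv_const_mul ((A.smooth j).differentiable (by simp) y)]; simp
    simp only [e2]
    rw [← Finset.mul_sum, hdiv, mul_zero]

end

section

/-- Sequences of smooth functions uniformly dominated. -/
def Ok0 (f : ℕ → V → ℝ) : Prop := (∀ n, ContDiff ℝ (⊤ : ℕ∞) (f n)) ∧
      ∃ g : V → ℝ, MemLp g 2 volume ∧ ∃ B : ℝ, ∀ n x, |f n x| ≤ g x ∧ |f n x| ≤ B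

/-- Sequences of smooth functions uniformly dominated together with derivatives up to order `k`. -/
def Ok : ℕ → (ℕ → V → ℝ) → Prop
  | 0, f => Ok0 f
  | k + 1, f => Ok0 f ∧ ∀ i, Ok k (fun n => pd (f n) i)

theorem Ok.mk {k : ℕ} {f : ℕ → V → ℝ} (h : Ok0 f) (h' : ∀ i, Ok k (fun n => pd (f n) i)) : Ok (k+1) f := by
  rw [Ok]; exact ⟨h, h'⟩
theorem Ok.z {k : ℕ} {f : ℕ → V → ℝ} (h : Ok k f) : Ok0 f := by
  cases k with
  | zero => rwa [Ok] at h
  | succ k => rw [Ok] at h; exact h.1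
theorem Ok.d {k : ℕ} {f : ℕ → V → ℝ} (h : Ok (k+1) f) : ∀ i, Ok k (fun n => pd (f n) i) := by
  rw [Ok] at h; exact h.2

theorem Ok.add {k : ℕ} : ∀ {f f' : ℕ → V → ℝ}, Ok k f → Ok k f' → Ok k (fun n x => f n x + f' n x) := by
  have base : ∀ {f f' : ℕ → V → ℝ}, Ok0 f → Ok0 f' → Ok0 (fun n x => f n x + f' n x) := by
    rintro f f' ⟨s, g, hg, B, h⟩ ⟨s', g', hg', B', h'⟩
    refine ⟨fun n => (s n).add (s' n), g + g', hg.add hg', B + B', fun n x => ⟨?_, ?_⟩⟩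
    · exact (abs_add_le _ _).trans (add_le_add (h n x).1 (h' n x).1)
    · exact (abs_add_le _ _).trans (add_le_add (h n x).2 (h' n x).2)
  induction k with
  | zero => simp only [Ok]; exact @base
  | succ k ih =>
    rintro f f' h h'
    refine Ok.mk (base h.z h'.z) fun i => ?_
    have e : (fun n => pd (fun x => f n x + f' n x) i) = fun n x => pd (f n) i x + pd (f' n) i x := by
      funext n x
      simp only [pd]
      rw [fderiv_fun_add ((h.z.1 n).differentiable (by simp) x) ((h'.z.1 n).differentiable (by simp) x)]
      rfl
    rw [e]; exact ih (h.d i) (h'.d i)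

theorem pd_scale {ψ : V → ℝ} (hψ : ContDiff ℝ (⊤ : ℕ∞) ψ) (c : ℝ) (i : Fin 3) (x : V) :
    pd (fun x => ψ (c • x)) i x = c * pd ψ i (c • x) := by
  have h : HasFDerivAt (fun x : V => c • x) (c • ContinuousLinearMap.id ℝ V) x := (hasFDerivAt_id x).const_smul c
  have h2 := ((hψ.differentiable (by simp) (c • x)).hasFDerivAt).comp x h
  have h3 : fderiv ℝ (fun x => ψ (c • x)) x = _ := h2.fderiv
  simp only [pd]
  rw [h3]; simp

theorem Ok.base {R : ℝ} (k : ℕ) : ∀ {r : ℕ → ℝ} {ψ : V → ℝ} {b : V → ℝ} {hb : V → ℂ}, (∀ n, |r n| ≤ 1) →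
    ContDiff ℝ (⊤ : ℕ∞) ψ → HasCompactSupport ψ → BL R b hb →
    Ok k (fun n x => r n * ψ (((n:ℝ) + 1)⁻¹ • x) * b x) := by
  have sm : ∀ {ψ : V → ℝ} (n : ℕ), ContDiff ℝ (⊤ : ℕ∞) ψ → ContDiff ℝ (⊤ : ℕ∞) (fun x : V => ψ (((n:ℝ) + 1)⁻¹ • x)) :=
    fun n h => h.comp (contDiff_const_smul _)
  have base : ∀ {r : ℕ → ℝ} {ψ : V → ℝ} {b : V → ℝ} {hb : V → ℂ}, (∀ n, |r n| ≤ 1) →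
    ContDiff ℝ (⊤ : ℕ∞) ψ → HasCompactSupport ψ → BL R b hb →
    Ok0 (fun n x => r n * ψ (((n:ℝ) + 1)⁻¹ • x) * b x) := by
    intro r ψ b hb hr hψ hs H
    obtain ⟨C, hC⟩ := hψ.continuous.bounded_above_of_compact_support hs
    have hC0 : 0 ≤ C := (norm_nonneg _).trans (hC 0)
    refine ⟨fun n => (contDiff_const.mul (sm n hψ)).mul H.contDiff, fun x => C * |b x|, H.memLp.abs.const_mul C,
      C * (CR R * nrm b), fun n x => ?_⟩
    have : |r n * ψ (((n:ℝ) + 1)⁻¹ • x) * b x| ≤ C * |b x| := by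
      rw [abs_mul, abs_mul]
      have h1 := hC (((n:ℝ) + 1)⁻¹ • x)
      rw [Real.norm_eq_abs] at h1
      gcongr
      calc _ ≤ 1 * C := mul_le_mul (hr n) h1 (abs_nonneg _) (by norm_num)
        _ = C := one_mul _
    exact ⟨this, this.trans (by gcongr; exact H.bound x)⟩
  induction k with
  | zero => simp only [Ok]; exact @base
  | succ k ih =>
    intro r ψ b hb hr hψ hs H
    refine Ok.mk (base hr hψ hs H) fun i => ?_
    have e : (fun n : ℕ => pd (fun x => r n * ψ (((n:ℝ) + 1)⁻¹ • x) * b x) i) =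
        fun n x => (r n * ((n:ℝ) + 1)⁻¹) * pd ψ i (((n:ℝ) + 1)⁻¹ • x) * b x
          + r n * ψ (((n:ℝ) + 1)⁻¹ • x) * pd b i x := by
      funext n x
      have h1 := pd_scale hψ ((n:ℝ) + 1)⁻¹ i x
      have d1 := (sm n hψ).differentiable (by simp) x
      simp only [pd] at h1 ⊢
      rw [fderiv_fun_mul (d1.const_mul _) (H.diff x), fderiv_const_mul d1]
      simp [h1]; ring
    rw [e]
    refine Ok.add (ih (r := fun n => r n * ((n:ℝ) + 1)⁻¹) (fun n => ?_) (contDiff_pd hψ i) ?_ H) (ih hr hψ hs (H.pd i))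
    · rw [abs_mul]
      refine mul_le_one₀ (hr n) (abs_nonneg _) ?_
      rw [abs_of_nonneg (by positivity)]
      exact inv_le_one_of_one_le₀ (by have : (0:ℝ) ≤ n := by positivity
                                      linarith)
    · exact hs.fderiv_apply ℝ _

theorem Ok.adm {e : ℕ → Fin 3 → V → ℝ} (h : ∀ j, Ok 2 (fun n => e n j)) :
    ∃ g B, ∀ n, Adm (e n) g B := by
  have h0 := fun j => (h j).z.2
  have h1 := fun i j => ((h j).d i).z.2
  have h2 := fun i j => (((h j).d i).d i).z.2
  choose g0 m0 B0 k0 using h0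
  choose g1 m1 B1 k1 using h1
  choose g2 m2 B2 k2 using h2
  have n0 : ∀ j x, 0 ≤ g0 j x := fun j x => (abs_nonneg _).trans (k0 j 0 x).1
  have n2 : ∀ i j x, 0 ≤ g2 i j x := fun i j x => (abs_nonneg _).trans (k2 i j 0 x).1
  have nB : ∀ i j, 0 ≤ B1 i j := fun i j => (abs_nonneg _).trans (k1 i j 0 0).2
  refine ⟨fun x => ∑ j, (g0 j x + ∑ i, g2 i j x), ∑ i, ∑ j, B1 i j, fun n =>
    ⟨fun j => (h j).z.1 n, ?_, fun j x => ?_, fun i j x => ?_, fun i j x => ?_⟩⟩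
  · exact memLp_finsetSum _ fun j _ => (m0 j).add (memLp_finsetSum _ fun i _ => m2 i j)
  · refine (k0 j n x).1.trans ?_
    refine le_trans ?_ (Finset.single_le_sum (f := fun j => g0 j x + ∑ i, g2 i j x)
      (fun j _ => add_nonneg (n0 j x) (Finset.sum_nonneg fun i _ => n2 i j x)) (Finset.mem_univ j))
    have := Finset.sum_nonneg fun i (_ : i ∈ Finset.univ) => n2 i j x
    linarith
  · refine (k1 i j n x).2.trans ?_
    refine le_trans ?_ (Finset.single_le_sum (f := fun i => ∑ j, B1 i j)
      (fun i _ => Finset.sum_nonneg fun j _ => nB i j) (Finset.mem_univ i))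
    exact Finset.single_le_sum (f := fun j => B1 i j) (fun j _ => nB i j) (Finset.mem_univ j)
  · refine (k2 i j n x).1.trans ?_
    refine le_trans ?_ (Finset.single_le_sum (f := fun j => g0 j x + ∑ i, g2 i j x)
      (fun j _ => add_nonneg (n0 j x) (Finset.sum_nonneg fun i _ => n2 i j x)) (Finset.mem_univ j))
    have := Finset.single_le_sum (f := fun i => g2 i j x) (fun i _ => n2 i j x) (Finset.mem_univ i)
    have := n0 j x
    dsimp only at *; linarith

def curl (A : Fin 3 → V → ℝ) (j : Fin 3) (x : V) : ℝ := pd (A (j+2)) (j+1) x - pd (A (j+1)) (j+2) x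

theorem pd_comm {f : V → ℝ} (hf : ContDiff ℝ (⊤ : ℕ∞) f) (i j : Fin 3) (x : V) :
    pd (pd f i) j x = pd (pd f j) i x := by
  have hs : IsSymmSndFDerivAt ℝ f x := hf.contDiffAt.isSymmSndFDerivAt (by simp; exact WithTop.coe_le_coe.2 le_top)
  have hd : DifferentiableAt ℝ (fderiv ℝ f) x :=
    (hf.fderiv_right (m := (⊤ : ℕ∞)) (by simp)).differentiable (by simp) x
  have e : ∀ a b : Fin 3, pd (pd f a) b x = fderiv ℝ (fderiv ℝ f) x (EuclideanSpace.single b 1) (EuclideanSpace.single a 1) := by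
    intro a b
    unfold pd
    rw [fderiv_clm_apply hd (differentiableAt_const _)]
    simp
  rw [e, e]; exact hs _ _

theorem div_curl {A : Fin 3 → V → ℝ} (hA : ∀ j, ContDiff ℝ (⊤ : ℕ∞) (A j)) (x : V) :
    ∑ i, pd (curl A i) i x = 0 := by
  have e : ∀ i, pd (curl A i) i x = pd (pd (A (i+2)) (i+1)) i x - pd (pd (A (i+1)) (i+2)) i x := by
    intro i
    have : curl A i = fun x => pd (A (i+2)) (i+1) x - pd (A (i+1)) (i+2) x := rfl
    rw [this]
    conv_lhs => rw [pd]
    rw [fderiv_fun_sub ((contDiff_pd (hA _) _).differentiable (by simp) x) ((contDiff_pd (hA _) _).differentiable (by simp) x)]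
    rfl
  simp only [e, Fin.sum_univ_three]
  have a1 : (1 : Fin 3) + 1 = 2 := rfl
  have a2 : (1 : Fin 3) + 2 = 0 := rfl
  have a3 : (2 : Fin 3) + 1 = 0 := rfl
  have a4 : (2 : Fin 3) + 2 = 1 := rfl
  simp only [zero_add, a1, a2, a3, a4]
  rw [pd_comm (hA 2) 1 0, pd_comm (hA 1) 2 0, pd_comm (hA 0) 2 1]
  ring

theorem WI_curl {ν : ℝ} {u₀ : V → V} {u : ℝ → V → V} (hu : IsLerayHopf ν u₀ u) (hu0 : MemLp u₀ 2 volume)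
    {R : ℝ} {A : Fin 3 → V → ℝ} {H : Fin 3 → V → ℂ} (hA : ∀ j, BL R (A j) (H j)) : WI ν u₀ u (curl A) := by
  obtain ⟨χ, hχ⟩ : ∃ χ : ContDiffBump (0 : V), χ.rIn = 1 := ⟨⟨1, 2, by norm_num, by norm_num⟩, rfl⟩
  have cχ : ContDiff ℝ (⊤ : ℕ∞) (χ : V → ℝ) := χ.contDiff
  let a : ℕ → Fin 3 → V → ℝ := fun n j x => 1 * χ (((n:ℝ) + 1)⁻¹ • x) * A j x
  have oka : ∀ k j, Ok k (fun n => a n j) := fun k j => Ok.base k (r := fun _ => 1) (by simp) cχ χ.hasCompactSupport (hA j)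
  have oka' : ∀ k j, Ok k (fun n x => -1 * χ (((n:ℝ) + 1)⁻¹ • x) * A j x) := fun k j =>
    Ok.base k (r := fun _ => -1) (by simp) cχ χ.hasCompactSupport (hA j)
  have oke : ∀ j, Ok 2 (fun n => curl (a n) j) := by
    intro j
    have := ((oka 3 (j+2)).d (j+1)).add ((oka' 3 (j+1)).d (j+2))
    convert this using 3 with n x
    have : (fun x => -1 * χ (((n:ℝ) + 1)⁻¹ • x) * A (j+1) x) = fun x => - (a n (j+1) x) := by
      funext x; simp [a]
    rw [curl, this, sub_eq_add_neg]
    congr 1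
    simp only [pd, fderiv_fun_neg]; rfl
  obtain ⟨g, B, hadm⟩ := Ok.adm oke
  have hsa : ∀ n j, HasCompactSupport (a n j) := by
    intro n j
    have h1 : HasCompactSupport (fun x : V => χ (((n:ℝ) + 1)⁻¹ • x)) :=
      χ.hasCompactSupport.comp_smul (by positivity)
    have := (h1.mul_left (f := fun _ => (1:ℝ))).mul_right (f' := A j)
    exact this
  have hw : ∀ n, WI ν u₀ u (curl (a n)) := fun n => WI_test hu (hadm n)
    (fun j => by
      have h1 : HasCompactSupport (pd (a n (j+2)) (j+1)) := (hsa n (j+2)).fderiv_apply ℝ _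
      have h2 : HasCompactSupport (pd (a n (j+1)) (j+2)) := (hsa n (j+1)).fderiv_apply ℝ _
      exact h1.sub h2) (div_curl fun j => (oka 0 j).z.1 n)
  have hev : ∀ x : V, ∀ᶠ n : ℕ in atTop, ∀ j, curl (a n) j =ᶠ[nhds x] curl A j := by
    intro x
    obtain ⟨n0, hn0⟩ := exists_nat_gt (‖x‖ + 1)
    filter_upwards [eventually_ge_atTop n0] with n hn
    have hn' : (n0:ℝ) ≤ n := by exact_mod_cast hn
    have : ∀ j, a n j =ᶠ[nhds x] A j := by
      intro j
      filter_upwards [Metric.ball_mem_nhds x one_pos] with y hy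
      have : χ (((n:ℝ) + 1)⁻¹ • y) = 1 := by
        apply χ.one_of_mem_closedBall
        rw [hχ, mem_closedBall_zero_iff, norm_smul, norm_inv, Real.norm_of_nonneg (by positivity), inv_mul_le_iff₀ (by positivity)]
        have : ‖y‖ ≤ ‖x‖ + dist y x := by
          rw [dist_eq_norm]; have := norm_add_le x (y - x); simpa using this
        have := Metric.mem_ball.1 hy
        linarith
      simp [a, this]
    intro j
    have e1 := (this (j+2)).fderiv (𝕜 := ℝ)
    have e2 := (this (j+1)).fderiv (𝕜 := ℝ)
    filter_upwards [e1, e2] with y h1 h2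
    simp only [curl, pd, h1, h2]
  have pdev : ∀ {f f' : V → ℝ} {x : V} (i : Fin 3), f =ᶠ[nhds x] f' → pd f i =ᶠ[nhds x] pd f' i := by
    intro f f' x i h
    filter_upwards [h.fderiv (𝕜 := ℝ)] with y hy
    simp only [pd, hy]
  obtain ⟨M, M0, hM⟩ := LH_bound hu
  have Bn : 0 ≤ B := (abs_nonneg _).trans ((hadm 0).b1 0 0 0)
  have l0 : ∀ j x, Tendsto (fun n => curl (a n) j x) atTop (nhds (curl A j x)) := fun j x =>
    tendsto_const_nhds.congr' ((hev x).mono fun n h => (h j).eq_of_nhds.symm)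
  refine WI_lim (C := |ν| * (9 * (M * nrm g)) + 9 * B * M ^ 2) hw (Adm.prE_lim hadm hu0 l0)
    (fun t ht => Adm.prE_lim hadm (hu.memL2 t ht) l0) (fun t ht => Adm.Fop_lim hadm ν (hu.memL2 t ht)
      (fun i j x => tendsto_const_nhds.congr' ((hev x).mono fun n h => (pdev i (h j)).eq_of_nhds.symm))
      (fun i j x => tendsto_const_nhds.congr' ((hev x).mono fun n h => (pdev i (pdev i (h j))).eq_of_nhds.symm)))
    (fun n => (hadm n).Fop_sm ν hu.meas) (fun n => ?_)
  filter_upwards [hM, ae_restrict_mem measurableSet_Ioi] with t h1 ht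
  refine ((hadm n).Fop_le ν (hu.memL2 t ht)).trans ?_
  have := nrm_nonneg (u t)
  have := nrm_nonneg g
  gcongr

end

section

theorem finv_congr {h h' : V → ℂ} (e : h =ᵐ[volume] h') (x : V) : 𝓕⁻ h x = 𝓕⁻ h' x := by
  rw [Real.fourierInv_eq, Real.fourierInv_eq]
  exact integral_congr_ae (e.mono fun ξ hξ => by simp only [hξ])

theorem BL.ext {R R' : ℝ} {f f' : V → ℝ} {h h' : V → ℂ} (H : BL R f h) (H' : BL R' f' h') (e : h =ᵐ[volume] h') : f = f' := by
  ext x; rw [H.f_eq, H'.f_eq, finv_congr e]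

theorem memLp_mult {m : V → ℝ} {v : V → ℂ} {C : ℝ} (hm : Measurable m) (hC : ∀ ξ, |m ξ| ≤ C) (hv : MemLp v 2 volume) :
    MemLp (fun ξ => (m ξ : ℂ) * v ξ) 2 volume := by
  refine MemLp.of_le_mul (c := C) hv ?_ (ae_of_all _ fun ξ => ?_)
  · exact (Complex.measurable_ofReal.comp hm).aestronglyMeasurable.mul hv.1
  · rw [norm_mul, Complex.norm_real, Real.norm_eq_abs]; gcongr; exact hC ξ

/-- The real function with Fourier transform `m v`. -/
def mulF (m : V → ℝ) (v : V → ℂ) (x : V) : ℝ := (𝓕⁻ (fun ξ => (m ξ : ℂ) * v ξ) x).re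

theorem BL.ofMult {R C : ℝ} {f : V → ℝ} {v : V → ℂ} {m : V → ℝ} (hp : IsFourierPair (fun x => (f x : ℂ)) v)
    (hm : Measurable m) (hC : ∀ ξ, |m ξ| ≤ C) (he : ∀ ξ, m (-ξ) = m ξ) (hs : ∀ ξ, R < ‖ξ‖ → m ξ * v ξ = 0) :
    BL R (mulF m v) (fun ξ => (m ξ : ℂ) * v ξ) := by
  refine BL.of_herm (memLp_mult hm hC hp.2.1) hs ?_
  filter_upwards [herm_of_real hp] with ξ hξ
  rw [map_mul, conj_ofReal, he, hξ]

def KR (R : ℝ) : ℝ := CR R * (2 * π * R) + (1 + 3 * (2 * π * R) ^ 2)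

theorem KR_nonneg {R : ℝ} (hR : 0 ≤ R) : 0 ≤ KR R := by have := CR_nonneg R; unfold KR; positivity

theorem nrm_abs (f : V → ℝ) : nrm (fun x => |f x|) = nrm f := by
  rw [nrm, nrm]; congr 1; exact eLpNorm_norm f

theorem nrm_sum_le {ι : Type*} (s : Finset ι) {f : ι → V → ℝ} (h : ∀ i ∈ s, MemLp (f i) 2 volume) :
    nrm (fun x => ∑ i ∈ s, f i x) ≤ ∑ i ∈ s, nrm (f i) := by
  induction s using Finset.induction_on with
  | empty => simp [nrm]
  | insert a s ha ih =>
    simp only [Finset.sum_insert ha]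
    have h2 := memLp_finsetSum s (fun i hi => h i (by simp [hi]))
    refine (nrm_add_le (h a (by simp)) h2).trans ?_
    gcongr
    exact ih fun i hi => h i (by simp [hi])

theorem BL.adm {R : ℝ} (hR : 0 ≤ R) {w : Fin 3 → V → ℝ} {H : Fin 3 → V → ℂ} (hw : ∀ j, BL R (w j) (H j)) :
    ∃ g, Adm w g (KR R * ∑ j, nrm (w j)) ∧ nrm g ≤ KR R * ∑ j, nrm (w j) := by
  have hn := fun j => nrm_nonneg (w j)
  have hc := CR_nonneg R
  have l1 : ∀ j, nrm (w j) ≤ ∑ j, nrm (w j) := fun j => Finset.single_le_sum (fun j _ => hn j) (Finset.mem_univ j)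
  have m2 : ∀ i j, MemLp (fun x => |NSE.pd (NSE.pd (w j) i) i x|) 2 volume := fun i j => (((hw j).pd i).pd i).memLp.abs
  have m0 : ∀ j, MemLp (fun x => |w j x|) 2 volume := fun j => (hw j).memLp.abs
  have mg : ∀ j, MemLp (fun x => |w j x| + ∑ i, |NSE.pd (NSE.pd (w j) i) i x|) 2 volume := fun j =>
    (m0 j).add (memLp_finsetSum _ fun i _ => m2 i j)
  refine ⟨fun x => ∑ j, (|w j x| + ∑ i, |NSE.pd (NSE.pd (w j) i) i x|), ⟨fun j => (hw j).contDiff,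
    memLp_finsetSum _ fun j _ => mg j, fun j x => ?_, fun i j x => ?_, fun i j x => ?_⟩, ?_⟩
  · refine le_trans ?_ (Finset.single_le_sum (f := fun j => |w j x| + ∑ i, |NSE.pd (NSE.pd (w j) i) i x|)
      (fun j _ => by positivity) (Finset.mem_univ j))
    exact le_add_of_nonneg_right (by positivity)
  · refine (((hw j).pd i).bound x).trans ?_
    calc CR R * nrm (NSE.pd (w j) i) ≤ CR R * (2 * π * R * nrm (w j)) := by gcongr; exact (hw j).pd_nrm hR i
      _ = (CR R * (2 * π * R)) * nrm (w j) := by ring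
      _ ≤ KR R * ∑ j, nrm (w j) := by
        have := l1 j
        have hK : CR R * (2 * π * R) ≤ KR R := by unfold KR; exact le_add_of_nonneg_right (by positivity)
        have := KR_nonneg hR
        have := hn j
        gcongr
  · refine le_trans ?_ (Finset.single_le_sum (f := fun j => |w j x| + ∑ i, |NSE.pd (NSE.pd (w j) i) i x|)
      (fun j _ => by positivity) (Finset.mem_univ j))
    exact (Finset.single_le_sum (f := fun i => |NSE.pd (NSE.pd (w j) i) i x|) (fun i _ => abs_nonneg _) (Finset.mem_univ i)).trans
      (le_add_of_nonneg_left (abs_nonneg _))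
  · refine (nrm_sum_le _ fun j _ => mg j).trans ?_
    rw [Finset.mul_sum]
    refine Finset.sum_le_sum fun j _ => ?_
    refine (nrm_add_le (m0 j) (memLp_finsetSum _ fun i _ => m2 i j)).trans ?_
    have h3 : nrm (fun x => ∑ i, |NSE.pd (NSE.pd (w j) i) i x|) ≤ 3 * ((2 * π * R) ^ 2 * nrm (w j)) := by
      refine (nrm_sum_le _ fun i _ => m2 i j).trans ?_
      calc _ ≤ ∑ i : Fin 3, (2 * π * R) ^ 2 * nrm (w j) := Finset.sum_le_sum fun i _ => by
            rw [nrm_abs]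
            refine (((hw j).pd i).pd_nrm hR i).trans ?_
            have := (hw j).pd_nrm hR i
            calc _ ≤ 2 * π * R * (2 * π * R * nrm (w j)) := by gcongr
              _ = _ := by ring
        _ = _ := by simp
    rw [nrm_abs]
    have : 0 ≤ CR R * (2 * π * R) * nrm (w j) := by have := hn j; positivity
    calc _ ≤ nrm (w j) + 3 * ((2 * π * R) ^ 2 * nrm (w j)) := by gcongr
      _ ≤ KR R * nrm (w j) := by unfold KR; linarith

theorem prE_bd {R : ℝ} (hR : 0 ≤ R) {w : Fin 3 → V → ℝ} {H : Fin 3 → V → ℂ} (hw : ∀ j, BL R (w j) (H j))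
    {v : V → V} (hv : MemLp v 2 volume) : |prE v w| ≤ 3 * nrm v * KR R * ∑ j, nrm (w j) := by
  obtain ⟨g, A, hg⟩ := BL.adm hR hw
  refine (A.prE_le hv).trans ?_
  have := nrm_nonneg v
  calc 3 * (nrm v * nrm g) ≤ 3 * (nrm v * (KR R * ∑ j, nrm (w j))) := by gcongr
    _ = _ := by ring

theorem Fop_bd {R : ℝ} (hR : 0 ≤ R) {w : Fin 3 → V → ℝ} {H : Fin 3 → V → ℂ} (hw : ∀ j, BL R (w j) (H j))
    (ν : ℝ) {v : V → V} (hv : MemLp v 2 volume) {M : ℝ} (hM : nrm v ≤ M) :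
    |Fop ν v w| ≤ (9 * |ν| * M + 9 * M ^ 2) * KR R * ∑ j, nrm (w j) := by
  obtain ⟨g, A, hg⟩ := BL.adm hR hw
  refine (A.Fop_le ν hv).trans ?_
  have := nrm_nonneg v
  have := nrm_nonneg g
  have := KR_nonneg hR
  have : 0 ≤ ∑ j, nrm (w j) := Finset.sum_nonneg fun j _ => nrm_nonneg (w j)
  generalize ∑ j, nrm (w j) = N at *
  have hM0 : 0 ≤ M := by linarith
  have h1 : nrm v * nrm g ≤ M * (KR R * N) := mul_le_mul hM hg (by assumption) hM0
  have h2 : nrm v ^ 2 ≤ M ^ 2 := pow_le_pow_left₀ (by assumption) hM 2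
  have h3 := mul_le_mul_of_nonneg_left h1 (abs_nonneg ν)
  have h4 := mul_le_mul_of_nonneg_left h2 (show 0 ≤ KR R * N by positivity)
  linarith

theorem pd_lin {f f' : V → ℝ} (hf : ContDiff ℝ (⊤ : ℕ∞) f) (hf' : ContDiff ℝ (⊤ : ℕ∞) f') (a : ℝ) (i : Fin 3) :
    pd (fun x => a * f x + f' x) i = fun x => a * pd f i x + pd f' i x := by
  funext x
  simp only [pd]
  have d := hf.differentiable (by simp) x
  rw [fderiv_fun_add (d.const_mul a) (hf'.differentiable (by simp) x), fderiv_const_mul d]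
  simp

theorem prE_lin {w w' : Fin 3 → V → ℝ} {g g' : V → ℝ} {B B' : ℝ} (A : Adm w g B) (A' : Adm w' g' B') (a : ℝ)
    {v : V → V} (hv : MemLp v 2 volume) : prE v (fun j x => a * w j x + w' j x) = a * prE v w + prE v w' := by
  unfold prE
  rw [← integral_const_mul, ← integral_add ((A.prI_int hv).const_mul _) (A'.prI_int hv)]
  congr 1; ext x; simp only [prI, Fin.sum_univ_three]; ring

theorem Fop_lin {w w' : Fin 3 → V → ℝ} {g g' : V → ℝ} {B B' : ℝ} (A : Adm w g B) (A' : Adm w' g' B') (a ν : ℝ)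
    {v : V → V} (hv : MemLp v 2 volume) : Fop ν v (fun j x => a * w j x + w' j x) = a * Fop ν v w + Fop ν v w' := by
  unfold Fop
  rw [← integral_const_mul, ← integral_add ((A.FI_int ν hv).const_mul _) (A'.FI_int ν hv)]
  congr 1; ext x
  simp only [FI, pd_lin (A.smooth _) (A'.smooth _), pd_lin (contDiff_pd (A.smooth _) _) (contDiff_pd (A'.smooth _) _), Fin.sum_univ_three]; ring

theorem tend_low {h : V → ℂ} (hh : MemLp h 2 volume) :
    Tendsto (fun n : ℕ => nrm ({ξ : V | ‖ξ‖ < ((n:ℝ) + 1)⁻¹}.indicator h)) atTop (nhds 0) := by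
  have ms : ∀ n : ℕ, MeasurableSet {ξ : V | ‖ξ‖ < ((n:ℝ) + 1)⁻¹} := fun n => measurableSet_lt measurable_norm measurable_const
  have hi : ∀ n : ℕ, MemLp ({ξ : V | ‖ξ‖ < ((n:ℝ) + 1)⁻¹}.indicator h) 2 volume := fun n => hh.indicator (ms n)
  have e : ∀ n : ℕ, nrm ({ξ : V | ‖ξ‖ < ((n:ℝ) + 1)⁻¹}.indicator h) ^ 2 = ∫ ξ, ‖({ξ : V | ‖ξ‖ < ((n:ℝ) + 1)⁻¹}.indicator h) ξ‖ ^ 2 := fun n => nrm_sq (hi n)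
  have hl : Tendsto (fun n : ℕ => nrm ({ξ : V | ‖ξ‖ < ((n:ℝ) + 1)⁻¹}.indicator h) ^ 2) atTop (nhds 0) := by
    have : Tendsto (fun n : ℕ => ∫ ξ, ‖({ξ : V | ‖ξ‖ < ((n:ℝ) + 1)⁻¹}.indicator h) ξ‖ ^ 2) atTop (nhds (∫ ξ : V, (0:ℝ))) := by
      refine tendsto_integral_of_dominated_convergence (fun ξ => ‖h ξ‖ ^ 2)
        (fun n => ((hi n).1.norm.pow 2)) (int_sq hh) (fun n => ae_of_all _ fun ξ => ?_) ?_
      · rw [Real.norm_of_nonneg (by positivity)]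
        gcongr
        exact norm_indicator_le_norm_self _ _
      · have h0 : ∀ᵐ ξ : V, ξ ≠ 0 := by
          rw [ae_iff]; simp
        filter_upwards [h0] with ξ hξ
        have hp : 0 < ‖ξ‖ := norm_pos_iff.2 hξ
        obtain ⟨n0, hn0⟩ := exists_nat_gt (‖ξ‖⁻¹)
        refine tendsto_const_nhds.congr' ?_
        filter_upwards [eventually_ge_atTop n0] with n hn
        have hn' : (n0:ℝ) ≤ n := by exact_mod_cast hn
        have : ξ ∉ {ξ : V | ‖ξ‖ < ((n:ℝ) + 1)⁻¹} := by
          simp only [Set.mem_ofPred_eq, not_lt]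
          rw [inv_le_comm₀ (by positivity) hp]
          linarith
        rw [Set.indicator_of_notMem this]; simp
    simp only [integral_zero] at this
    simp_rw [e]; exact this
  have := hl.sqrt
  rw [Real.sqrt_zero] at this
  exact this.congr fun n => Real.sqrt_sq (nrm_nonneg _)

theorem normsq (ξ : V) : ‖ξ‖ ^ 2 = ξ 0 ^ 2 + ξ 1 ^ 2 + ξ 2 ^ 2 := by
  rw [EuclideanSpace.norm_sq_eq, Fin.sum_univ_three]; simp

theorem WI_BL1 {ν : ℝ} {u₀ : V → V} {u : ℝ → V → V} (hu : IsLerayHopf ν u₀ u) (hu0 : MemLp u₀ 2 volume)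
    {R δ : ℝ} (hδ : 0 < δ) {w : Fin 3 → V → ℝ} {H : Fin 3 → V → ℂ} (hw : ∀ j, BL R (w j) (H j))
    (hlow : ∀ j ξ, ‖ξ‖ < δ → H j ξ = 0) (hdiv : ∀ᵐ ξ : V, ∑ i, H i ξ * ((ξ i : ℝ) : ℂ) = 0) : WI ν u₀ u w := by
  let m : V → ℝ := fun ξ => if ‖ξ‖ < δ then 0 else (4 * π ^ 2 * ‖ξ‖ ^ 2)⁻¹
  have mm : Measurable m := by
    refine Measurable.ite (measurableSet_lt measurable_norm measurable_const) measurable_const ?_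
    fun_prop
  have mC : ∀ ξ, |m ξ| ≤ (4 * π ^ 2 * δ ^ 2)⁻¹ := by
    intro ξ
    by_cases h : ‖ξ‖ < δ
    · simp only [m, h, if_true, abs_zero]; positivity
    · simp only [m, h, if_false]
      push Not at h
      rw [abs_of_nonneg (by positivity)]
      gcongr
  have hψ : ∀ j, BL R (mulF m (H j)) (fun ξ => (m ξ : ℂ) * H j ξ) := fun j =>
    BL.ofMult (hw j).pair mm mC (fun ξ => by simp [m]) (fun ξ hξ => by simp [(hw j).supp ξ hξ])
  have hA : ∀ j, BL R (curl (fun j => mulF m (H j)) j) _ := fun j => ((hψ (j+2)).pd (j+1)).sub ((hψ (j+1)).pd (j+2))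
  have hB : ∀ j, BL R (curl (curl (fun j => mulF m (H j))) j) _ := fun j => ((hA (j+2)).pd (j+1)).sub ((hA (j+1)).pd (j+2))
  have : w = curl (curl (fun j => mulF m (H j))) := by
    funext j
    refine (hw j).ext (hB j) ?_
    filter_upwards [hdiv] with ξ hξ
    by_cases h : ‖ξ‖ < δ
    · simp [hlow _ ξ h]
    · have hm : (4 * π ^ 2 * ((ξ 0 : ℝ) ^ 2 + (ξ 1 : ℝ) ^ 2 + (ξ 2 : ℝ) ^ 2) : ℂ) * m ξ = 1 := by
        have : m ξ = (4 * π ^ 2 * ‖ξ‖ ^ 2)⁻¹ := by simp [m, h]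
        rw [this, normsq]
        have h0 : ‖ξ‖ ^ 2 ≠ 0 := by
          push Not at h
          have : 0 < ‖ξ‖ := hδ.trans_le h
          positivity
        rw [normsq] at h0
        have hp := Real.pi_ne_zero
        have : (4 * π ^ 2 * (ξ 0 ^ 2 + ξ 1 ^ 2 + ξ 2 ^ 2)) * (4 * π ^ 2 * (ξ 0 ^ 2 + ξ 1 ^ 2 + ξ 2 ^ 2))⁻¹ = 1 :=
          mul_inv_cancel₀ (by positivity)
        exact_mod_cast this
      rw [Fin.sum_univ_three] at hξ
      have a1 : (1 : Fin 3) + 1 = 2 := rfl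
      have a2 : (1 : Fin 3) + 2 = 0 := rfl
      have a3 : (2 : Fin 3) + 1 = 0 := rfl
      have a4 : (2 : Fin 3) + 2 = 1 := rfl
      have hI : I ^ 2 = -1 := I_sq
      fin_cases j
      · simp only [Fin.zero_eta, Fin.mk_one, Fin.reduceFinMk, zero_add, a1, a2, a3, a4]
        linear_combination (-(H 0 ξ)) * hm + (4 * π ^ 2 * m ξ * (ξ 0 : ℝ)) * hξ + (-4 * π ^ 2 * m ξ * ((ξ 1 : ℝ) * ((ξ 0 : ℝ) * H 1 ξ - (ξ 1 : ℝ) * H 0 ξ) - (ξ 2 : ℝ) * ((ξ 2 : ℝ) * H 0 ξ - (ξ 0 : ℝ) * H 2 ξ))) * hI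
      · simp only [Fin.zero_eta, Fin.mk_one, Fin.reduceFinMk, zero_add, a1, a2, a3, a4]
        linear_combination (-(H 1 ξ)) * hm + (4 * π ^ 2 * m ξ * (ξ 1 : ℝ)) * hξ + (-4 * π ^ 2 * m ξ * ((ξ 2 : ℝ) * ((ξ 1 : ℝ) * H 2 ξ - (ξ 2 : ℝ) * H 1 ξ) - (ξ 0 : ℝ) * ((ξ 0 : ℝ) * H 1 ξ - (ξ 1 : ℝ) * H 0 ξ))) * hI
      · simp only [Fin.zero_eta, Fin.mk_one, Fin.reduceFinMk, zero_add, a1, a2, a3, a4]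
        linear_combination (-(H 2 ξ)) * hm + (4 * π ^ 2 * m ξ * (ξ 2 : ℝ)) * hξ + (-4 * π ^ 2 * m ξ * ((ξ 0 : ℝ) * ((ξ 2 : ℝ) * H 0 ξ - (ξ 0 : ℝ) * H 2 ξ) - (ξ 1 : ℝ) * ((ξ 1 : ℝ) * H 2 ξ - (ξ 2 : ℝ) * H 1 ξ))) * hI
  rw [this]
  exact WI_curl hu hu0 hA

theorem WI_BL {ν : ℝ} {u₀ : V → V} {u : ℝ → V → V} (hu : IsLerayHopf ν u₀ u) (hu0 : MemLp u₀ 2 volume)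
    {R : ℝ} (hR : 0 ≤ R) {w : Fin 3 → V → ℝ} {H : Fin 3 → V → ℂ} (hw : ∀ j, BL R (w j) (H j))
    (hdiv : ∀ᵐ ξ : V, ∑ i, H i ξ * ((ξ i : ℝ) : ℂ) = 0) : WI ν u₀ u w := by
  let S : ℕ → Set V := fun n => {ξ : V | ‖ξ‖ < ((n:ℝ) + 1)⁻¹}
  have ms : ∀ n : ℕ, MeasurableSet (S n) := fun n => measurableSet_lt measurable_norm measurable_const
  let m : ℕ → V → ℝ := fun n => (S n).indicator 1
  have mm : ∀ n, Measurable (m n) := fun n => measurable_one.indicator (ms n)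
  have mC : ∀ n ξ, |m n ξ| ≤ 1 := fun n ξ => by by_cases h : ξ ∈ S n <;> simp [m, h]
  have me : ∀ n ξ, m n (-ξ) = m n ξ := fun n ξ => by simp [m, S, Set.indicator]
  have hd : ∀ n j, BL R (mulF (m n) (H j)) (fun ξ => (m n ξ : ℂ) * H j ξ) := fun n j =>
    BL.ofMult (hw j).pair (mm n) (mC n) (me n) (fun ξ hξ => by simp [(hw j).supp ξ hξ])
  have hwn : ∀ n j, BL R (fun x => -1 * mulF (m n) (H j) x + w j x) _ := fun n j => ((hd n j).cmul (-1)).add (hw j)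
  have hW : ∀ n, WI ν u₀ u (fun j x => -1 * mulF (m n) (H j) x + w j x) := by
    intro n
    refine WI_BL1 hu hu0 (δ := ((n:ℝ) + 1)⁻¹) (by positivity) (hwn n) (fun j ξ hξ => ?_) ?_
    · have : m n ξ = 1 := Set.indicator_of_mem (s := S n) hξ 1
      rw [this]; push_cast; ring
    · filter_upwards [hdiv] with ξ hξ
      rw [Fin.sum_univ_three] at hξ ⊢
      push_cast
      linear_combination (1 - (m n ξ : ℂ)) * hξ
  have hlim : Tendsto (fun n => ∑ j, nrm (mulF (m n) (H j))) atTop (nhds 0) := by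
    have : ∀ j ∈ (Finset.univ : Finset (Fin 3)), Tendsto (fun n => nrm (mulF (m n) (H j))) atTop (nhds 0) := by
      intro j _
      refine (tend_low (hw j).hm).congr fun n => ?_
      rw [(hd n j).nrm_eq]
      congr 1; ext ξ
      by_cases h : ξ ∈ S n
      · have h' : ‖ξ‖ < ((n:ℝ) + 1)⁻¹ := h
        simp [m, h, h']
      · have h' : ¬ ‖ξ‖ < ((n:ℝ) + 1)⁻¹ := h
        simp [m, h, h']
    simpa using tendsto_finsetSum Finset.univ this
  obtain ⟨gw, Aw, -⟩ := BL.adm hR hw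
  obtain ⟨M, M0, hM⟩ := LH_bound hu
  have p0 : ∀ v : V → V, MemLp v 2 volume →
      Tendsto (fun n => prE v (fun j x => -1 * mulF (m n) (H j) x + w j x)) atTop (nhds (prE v w)) := by
    intro v hv
    have h1 : Tendsto (fun n => prE v (fun j => mulF (m n) (H j))) atTop (nhds 0) := by
      refine squeeze_zero_norm (fun n => prE_bd hR (hd n) hv) ?_
      simpa using hlim.const_mul (3 * nrm v * KR R)
    have h2 := (h1.const_mul (-1)).add_const (prE v w)
    simp only [mul_zero, zero_add] at h2
    refine h2.congr fun n => ?_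
    obtain ⟨g, A, -⟩ := BL.adm hR (hd n)
    exact (prE_lin A Aw (-1) hv).symm
  have p1 : ∀ v : V → V, MemLp v 2 volume →
      Tendsto (fun n => Fop ν v (fun j x => -1 * mulF (m n) (H j) x + w j x)) atTop (nhds (Fop ν v w)) := by
    intro v hv
    have h1 : Tendsto (fun n => Fop ν v (fun j => mulF (m n) (H j))) atTop (nhds 0) := by
      refine squeeze_zero_norm (fun n => Fop_bd hR (hd n) ν hv le_rfl) ?_
      simpa using hlim.const_mul ((9 * |ν| * nrm v + 9 * nrm v ^ 2) * KR R)
    have h2 := (h1.const_mul (-1)).add_const (Fop ν v w)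
    simp only [mul_zero, zero_add] at h2
    refine h2.congr fun n => ?_
    obtain ⟨g, A, -⟩ := BL.adm hR (hd n)
    exact (Fop_lin A Aw (-1) ν hv).symm
  refine WI_lim (C := (9 * |ν| * M + 9 * M ^ 2) * KR R * ∑ j, (nrm (w j) + nrm (w j))) hW (p0 u₀ hu0) (fun t ht => p0 _ (hu.memL2 t ht)) (fun t ht => p1 _ (hu.memL2 t ht))
    (fun n => ?_) (fun n => ?_)
  · obtain ⟨g, A, -⟩ := BL.adm hR (hwn n)
    exact A.Fop_sm ν hu.meas
  · filter_upwards [hM, ae_restrict_mem measurableSet_Ioi] with t h1 ht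
    refine (Fop_bd hR (hwn n) ν (hu.memL2 t ht) h1).trans ?_
    have := KR_nonneg hR
    refine mul_le_mul_of_nonneg_left (Finset.sum_le_sum fun j _ => ?_) (by positivity)
    refine (nrm_add_le ((hd n j).cmul (-1)).memLp (hw j).memLp).trans ?_
    gcongr
    rw [((hd n j).cmul (-1)).nrm_eq, (hw j).nrm_eq]
    refine (nrm_le_of_le (hw j).hm (c := 1) (by norm_num) (ae_of_all _ fun ξ => ?_)).trans (by rw [one_mul])
    have := mC n ξ
    rw [norm_mul, norm_mul, Complex.norm_real, Complex.norm_real]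
    simp only [Real.norm_eq_abs, abs_neg, abs_one, one_mul]
    have h0 := norm_nonneg (H j ξ)
    exact mul_le_of_le_one_left h0 this

end

section

theorem sq_ident {Z g : ℝ → ℝ} {z0 C : ℝ} (hg : AEStronglyMeasurable g (volume.restrict (Set.Ioi (0:ℝ))))
    (hC : ∀ᵐ t ∂(volume.restrict (Set.Ioi (0:ℝ))), |g t| ≤ C)
    (h : ∀ᵐ t ∂(volume.restrict (Set.Ioi (0:ℝ))), Z t = z0 + ∫ s in Set.Ioc 0 t, g s) :
    ∀ᵐ t ∂(volume.restrict (Set.Ioi (0:ℝ))), Z t ^ 2 = z0 ^ 2 + 2 * ∫ s in Set.Ioc 0 t, Z s * g s := by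
  filter_upwards [h, ae_restrict_mem measurableSet_Ioi] with t ht ht0
  have ht0' : (0:ℝ) ≤ t := le_of_lt ht0
  let Y : ℝ → ℝ := fun x => z0 + ∫ s in (0:ℝ)..x, g s
  have hi : IntervalIntegrable g volume 0 t := by
    rw [intervalIntegrable_iff_integrableOn_Ioc_of_le ht0']
    have : IsFiniteMeasure (volume.restrict (Set.Ioc 0 t)) := ⟨by simp⟩
    exact (integrable_const C).mono' (hg.mono_measure (Measure.restrict_mono Set.Ioc_subset_Ioi_self le_rfl))
      (ae_restrict_of_ae_restrict_of_subset Set.Ioc_subset_Ioi_self hC)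
  have ac0 := hi.absolutelyContinuousOnInterval_intervalIntegral (c := 0) (by simp)
  have ac : AbsolutelyContinuousOnInterval Y 0 t := by
    have hc : AbsolutelyContinuousOnInterval (fun _ : ℝ => z0) 0 t :=
      (LipschitzWith.const z0).lipschitzOnWith.absolutelyContinuousOnInterval
    exact hc.fun_add ac0
  have hd : ∀ᵐ s, s ∈ Set.Ioc 0 t → deriv Y s = g s ∧ Y s = Z s := by
    have h1 := hi.ae_hasDerivAt_integral
    have h2 := (ae_restrict_iff' measurableSet_Ioi).1 h
    filter_upwards [h1, h2] with s h1 h2 hs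
    refine ⟨?_, ?_⟩
    · have := h1 (by rw [Set.uIcc_of_le ht0']; exact ⟨hs.1.le, hs.2⟩) 0 (by simp)
      exact (this.const_add z0).deriv
    · rw [h2 hs.1]; simp only [Y]; rw [intervalIntegral.integral_of_le hs.1.le]
  have key := AbsolutelyContinuousOnInterval.integral_deriv_mul_eq_sub ac ac
  have e : ∫ x in (0:ℝ)..t, deriv Y x * Y x + Y x * deriv Y x = ∫ s in Set.Ioc 0 t, 2 * (Z s * g s) := by
    rw [intervalIntegral.integral_of_le ht0']
    refine setIntegral_congr_ae measurableSet_Ioc ?_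
    filter_upwards [hd] with s hs hst
    rw [(hs hst).1, (hs hst).2]; ring
  rw [e, integral_const_mul] at key
  have e1 : Y t = Z t := by rw [ht]; simp only [Y]; rw [intervalIntegral.integral_of_le ht0']
  have e0 : Y 0 = z0 := by simp [Y]
  rw [e1, e0] at key
  linarith

theorem hilb {H : Type*} [NormedAddCommGroup H] [InnerProductSpace ℝ H] [CompleteSpace H] [TopologicalSpace.SeparableSpace H]
    {U : ℝ → H} {U0 : H} {G : ℝ → H → ℝ} {C M : ℝ} (hC0 : 0 ≤ C)
    (hG : ∀ᵐ s ∂(volume.restrict (Set.Ioi (0:ℝ))), ∃ L : H →L[ℝ] ℝ, (∀ e, L e = G s e) ∧ ‖L‖ ≤ C)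
    (hm : ∀ e, AEStronglyMeasurable (fun s => G s e) (volume.restrict (Set.Ioi (0:ℝ))))
    (hU : ∀ᵐ s ∂(volume.restrict (Set.Ioi (0:ℝ))), ‖U s‖ ≤ M)
    (hw : ∀ e, ∀ᵐ t ∂(volume.restrict (Set.Ioi (0:ℝ))), inner ℝ (U t) e = inner ℝ U0 e + ∫ s in Set.Ioc 0 t, G s e) :
    AEStronglyMeasurable (fun s => G s (U s)) (volume.restrict (Set.Ioi (0:ℝ))) ∧
    (∀ᵐ s ∂(volume.restrict (Set.Ioi (0:ℝ))), |G s (U s)| ≤ C * M) ∧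
    ∀ᵐ t ∂(volume.restrict (Set.Ioi (0:ℝ))), ‖U t‖ ^ 2 = ‖U0‖ ^ 2 + 2 * ∫ s in Set.Ioc 0 t, G s (U s) := by
  obtain ⟨W, b, hb⟩ := exists_hilbertBasis ℝ H
  have hcW : Countable W := by
    have o := b.orthonormal
    refine Pairwise.countable_of_isOpen_disjoint (s := fun i : W => Metric.ball (b i) (1/2)) ?_ (fun i => Metric.isOpen_ball)
      (fun i => ⟨b i, Metric.mem_ball_self (by norm_num)⟩)
    intro i j hij
    refine Metric.ball_disjoint_ball ?_
    rw [dist_eq_norm]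
    have h0 : inner ℝ (b i) (b j) = 0 := o.2 hij
    have h1 := norm_sub_sq_real (b i) (b j)
    rw [h0, o.1 i, o.1 j] at h1
    nlinarith [norm_nonneg (b i - b j)]
  have hbd : ∀ e, ∀ᵐ s ∂(volume.restrict (Set.Ioi (0:ℝ))), |G s e| ≤ C * ‖e‖ := by
    intro e
    filter_upwards [hG] with s ⟨L, h1, h2⟩
    rw [← h1]
    exact (L.le_opNorm e).trans (by gcongr)
  have hlm : ∀ e, AEStronglyMeasurable (fun t => inner ℝ (U t) e) (volume.restrict (Set.Ioi (0:ℝ))) := by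
    intro e
    have hii : ∀ a c, IntervalIntegrable ((Set.Ioi (0:ℝ)).indicator (fun s => G s e)) volume a c := by
      intro a c
      rw [intervalIntegrable_iff]
      have fm : IsFiniteMeasure (volume.restrict (Set.uIoc a c)) := ⟨by simp [Set.uIoc]⟩
      refine Integrable.mono' (integrable_const (C * ‖e‖)) ?_ ?_
      · exact ((aestronglyMeasurable_indicator_iff measurableSet_Ioi).2 (hm e)).restrict
      · refine ae_restrict_of_ae ?_
        filter_upwards [(ae_restrict_iff' measurableSet_Ioi).1 (hbd e)] with s hs
        by_cases h : s ∈ Set.Ioi (0:ℝ)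
        · rw [Set.indicator_of_mem h]; exact hs h
        · rw [Set.indicator_of_notMem h, norm_zero]; positivity
    have hc := (intervalIntegral.continuous_primitive hii 0).const_add (inner ℝ U0 e)
    refine hc.aestronglyMeasurable.congr ?_
    filter_upwards [hw e, ae_restrict_mem measurableSet_Ioi] with t ht ht0
    rw [ht, intervalIntegral.integral_of_le (le_of_lt ht0)]
    congr 1
    refine setIntegral_congr_fun measurableSet_Ioc fun s hs => ?_
    exact Set.indicator_of_mem (Set.Ioc_subset_Ioi_self hs) _
  let Q : Finset W → ℝ → ℝ := fun F s => ∑ i ∈ F, inner ℝ (U s) (b i) * G s (b i)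
  have hQm : ∀ F, AEStronglyMeasurable (Q F) (volume.restrict (Set.Ioi (0:ℝ))) := fun F => by
    have h1 := fun i : W => hlm (b i)
    have h2 := fun i : W => hm (b i)
    fun_prop
  have hrep : ∀ x : H, ∀ i, b.repr x i = inner ℝ x (b i) := fun x i => by
    rw [b.repr_apply_apply, real_inner_comm]
  have hQl : ∀ᵐ s ∂(volume.restrict (Set.Ioi (0:ℝ))), Tendsto (fun F => Q F s) atTop (nhds (G s (U s))) := by
    filter_upwards [hG] with s ⟨L, h1, h2⟩
    have := (b.hasSum_repr (U s)).mapL L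
    simp only [hrep, map_smul, smul_eq_mul] at this
    simp only [h1] at this
    simpa [HasSum] using this
  have hQb : ∀ F, ∀ᵐ s ∂(volume.restrict (Set.Ioi (0:ℝ))), |Q F s| ≤ C * M := by
    intro F
    filter_upwards [hG, hU] with s ⟨L, h1, h2⟩ hs
    have e : Q F s = L (∑ i ∈ F, inner ℝ (U s) (b i) • b i) := by
      simp only [Q]; rw [map_sum]; simp only [map_smul, smul_eq_mul]; simp only [h1]
    have hn : ‖∑ i ∈ F, inner ℝ (U s) (b i) • b i‖ ≤ ‖U s‖ := by
      have o := b.orthonormal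
      have h3 : ‖∑ i ∈ F, inner ℝ (U s) (b i) • b i‖ ^ 2 = ∑ i ∈ F, ‖inner ℝ (b i) (U s)‖ ^ 2 := by
        rw [← real_inner_self_eq_norm_sq, o.inner_sum]
        refine Finset.sum_congr rfl fun i _ => ?_
        rw [real_inner_comm (b i)]; simp [sq]
      have h4 := o.sum_inner_products_le (U s) (s := F)
      rw [← h3] at h4
      exact le_of_sq_le_sq h4 (norm_nonneg _)
    rw [e]
    exact (L.le_opNorm _).trans (mul_le_mul h2 (hn.trans hs) (norm_nonneg _) hC0)
  refine ⟨aestronglyMeasurable_of_tendsto_ae atTop hQm hQl, ?_, ?_⟩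
  · filter_upwards [hG, hU] with s ⟨L, h1, h2⟩ hs
    rw [← h1]
    exact (L.le_opNorm _).trans (mul_le_mul h2 hs (norm_nonneg _) hC0)
  · have hall : ∀ᵐ t ∂(volume.restrict (Set.Ioi (0:ℝ))), ∀ i, inner ℝ (U t) (b i) ^ 2 = inner ℝ U0 (b i) ^ 2
        + 2 * ∫ s in Set.Ioc 0 t, inner ℝ (U s) (b i) * G s (b i) := by
      rw [ae_all_iff]
      intro i
      exact sq_ident (hm (b i)) (hbd (b i)) (hw (b i))
    filter_upwards [hall, ae_restrict_mem measurableSet_Ioi] with t ht ht0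
    have fm : IsFiniteMeasure (volume.restrict (Set.Ioc 0 t)) := ⟨by simp⟩
    have le : volume.restrict (Set.Ioc 0 t) ≤ volume.restrict (Set.Ioi 0) := Measure.restrict_mono Set.Ioc_subset_Ioi_self le_rfl
    have hs : ∀ x : H, Tendsto (fun F : Finset W => ∑ i ∈ F, inner ℝ x (b i) ^ 2) atTop (nhds (‖x‖ ^ 2)) := by
      intro x
      have := b.hasSum_inner_mul_inner x x
      rw [real_inner_self_eq_norm_sq] at this
      refine Tendsto.congr (fun F => ?_) this
      refine Finset.sum_congr rfl fun i _ => ?_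
      simp only [real_inner_comm x (b i), sq]
    have hI : Tendsto (fun F => ∫ s in Set.Ioc 0 t, Q F s) atTop (nhds (∫ s in Set.Ioc 0 t, G s (U s))) := by
      refine tendsto_integral_filter_of_dominated_convergence (fun _ => C * M) (Eventually.of_forall fun F => (hQm F).mono_measure le)
        (Eventually.of_forall fun F => ae_mono le (hQb F)) (integrable_const _) (ae_mono le hQl)
    refine tendsto_nhds_unique (hs (U t)) ?_
    refine Tendsto.congr (fun F => ?_) ((hs U0).add (hI.const_mul 2))
    simp only [ht, Finset.sum_add_distrib, Q]
    congr 1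
    rw [integral_finsetSum, Finset.mul_sum]
    intro i _
    refine Integrable.mono' (integrable_const (M * (C * 1))) (((hlm (b i)).mul (hm (b i))).mono_measure le) (ae_mono le ?_)
    filter_upwards [hU, hbd (b i)] with s h1 h2
    have nb : ‖b i‖ = 1 := b.orthonormal.1 i
    rw [nb] at h2
    rw [norm_mul]
    refine mul_le_mul ?_ h2 (norm_nonneg _) ((norm_nonneg _).trans h1)
    refine (norm_inner_le_norm _ _).trans ?_
    rw [nb, mul_one]; exact h1

end

section

theorem memLp_comp {v : V → V} (hv : MemLp v 2 volume) (k : Fin 3) : MemLp (comp v k) 2 volume :=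
  (memLp_co hv k).ofReal

theorem comp_pair {v : V → V} (hv : MemLp v 2 volume) (k : Fin 3) :
    IsFourierPair (fun x => ((v x k : ℝ) : ℂ)) (FT (comp v k)) := FT_pair (memLp_comp hv k)

theorem FT_comp_nrm {v : V → V} (hv : MemLp v 2 volume) (k : Fin 3) : nrm (FT (comp v k)) ≤ nrm v := by
  have h := (comp_pair hv k).norm_eq
  have e : nrm (FT (comp v k)) = nrm (fun x => v x k) := by
    unfold nrm; rw [← h]
    congr 1
    refine eLpNorm_congr_norm_ae (ae_of_all _ fun x => by simp)
  rw [e]; exact nrm_co hv k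

structure Msk (q : V → ℝ) (R C : ℝ) : Prop where
  meas : Measurable q
  bd : ∀ ξ, |q ξ| ≤ C
  even : ∀ ξ, q (-ξ) = q ξ
  supp : ∀ ξ, R < ‖ξ‖ → q ξ = 0
  hR : 0 ≤ R

def lm (q : V → ℝ) (j k : Fin 3) (ξ : V) : ℝ := q ξ * ((if j = k then 1 else 0) - ξ j * ξ k / ‖ξ‖ ^ 2)

theorem Msk.C0 {q : V → ℝ} {R C : ℝ} (hq : Msk q R C) : 0 ≤ C := (abs_nonneg _).trans (hq.bd 0)

theorem Msk.lm {q : V → ℝ} {R C : ℝ} (hq : Msk q R C) (j k : Fin 3) : Msk (lm q j k) R (C * 2) := by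
  refine ⟨?_, ?_, ?_, ?_, hq.hR⟩
  · have := hq.meas
    have h1 : ∀ j : Fin 3, Measurable (fun ξ : V => ξ j) := fun j => (EuclideanSpace.proj (𝕜 := ℝ) j : V →L[ℝ] ℝ).measurable
    unfold NSE.lm
    fun_prop
  · intro ξ
    unfold NSE.lm
    rw [abs_mul]
    refine mul_le_mul (hq.bd ξ) ?_ (abs_nonneg _) hq.C0
    refine (abs_sub _ _).trans ?_
    have h1 : |(if j = k then (1:ℝ) else 0)| ≤ 1 := by split_ifs <;> simp
    have h2 : |ξ j * ξ k / ‖ξ‖ ^ 2| ≤ 1 := by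
      rw [abs_div, abs_mul, abs_of_nonneg (sq_nonneg ‖ξ‖)]
      refine div_le_one_of_le₀ ?_ (sq_nonneg _)
      rw [sq]
      exact mul_le_mul (co_le _ _) (co_le _ _) (abs_nonneg _) (norm_nonneg _)
    linarith
  · intro ξ
    simp [NSE.lm, hq.even ξ]
  · intro ξ h
    simp [NSE.lm, hq.supp ξ h]

theorem lm_div (q : V → ℝ) (k : Fin 3) (ξ : V) : ∑ j, lm q j k ξ * ξ j = 0 := by
  by_cases h : ξ = 0
  · simp [h]
  · have hn : ξ 0 ^ 2 + ξ 1 ^ 2 + ξ 2 ^ 2 ≠ 0 := by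
      rw [← normsq]; positivity
    unfold lm
    rw [normsq, Fin.sum_univ_three]
    fin_cases k <;> simp <;> field_simp <;> ring

theorem lm_fix (q : V → ℝ) (j : Fin 3) (ξ : V) (z : Fin 3 → ℂ) (h : ∑ i, z i * ((ξ i : ℝ) : ℂ) = 0) :
    ∑ k, (lm q j k ξ : ℂ) * z k = q ξ * z j := by
  have : ∀ k, (lm q j k ξ : ℂ) * z k = (if j = k then (q ξ : ℂ) * z k else 0)
      - (q ξ : ℂ) * ξ j / ‖ξ‖ ^ 2 * (z k * ((ξ k : ℝ) : ℂ)) := by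
    intro k
    unfold lm
    split_ifs <;> push_cast <;> ring
  simp only [this, Finset.sum_sub_distrib, ← Finset.mul_sum, h]
  simp

theorem lm_symm (q : V → ℝ) (j k : Fin 3) : lm q j k = lm q k j := by
  ext ξ; unfold lm
  simp only [eq_comm (a := j), mul_comm (ξ j)]

def PQ (q : V → ℝ) (v : V → V) (j : Fin 3) (x : V) : ℝ := mulF q (FT (comp v j)) x
def PiQ (q : V → ℝ) (v : V → V) (j : Fin 3) (x : V) : ℝ := ∑ k, mulF (lm q j k) (FT (comp v k)) x

variable {q : V → ℝ} {R C : ℝ}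

theorem PQ_bl (hq : Msk q R C) {v : V → V} (hv : MemLp v 2 volume) (j : Fin 3) :
    BL R (PQ q v j) (fun ξ => (q ξ : ℂ) * FT (comp v j) ξ) :=
  BL.ofMult (comp_pair hv j) hq.meas hq.bd hq.even (fun ξ h => by simp [hq.supp ξ h])

theorem PiQ_bl (hq : Msk q R C) {v : V → V} (hv : MemLp v 2 volume) (j : Fin 3) :
    BL R (PiQ q v j) (fun ξ => ∑ k, (lm q j k ξ : ℂ) * FT (comp v k) ξ) :=
  BL.sum _ fun k _ => BL.ofMult (comp_pair hv k) (hq.lm j k).meas (hq.lm j k).bd (hq.lm j k).even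
    (fun ξ h => by simp [(hq.lm j k).supp ξ h])

theorem PiQ_div (v : V → V) (ξ : V) : ∑ i, (∑ k, (lm q i k ξ : ℂ) * FT (comp v k) ξ) * ((ξ i : ℝ) : ℂ) = 0 := by
  simp only [Finset.sum_mul]
  rw [Finset.sum_comm]
  refine Finset.sum_eq_zero fun k _ => ?_
  have := lm_div q k ξ
  have h2 : ∑ i, (lm q i k ξ : ℂ) * (ξ i : ℂ) = 0 := by exact_mod_cast this
  calc _ = (∑ i, (lm q i k ξ : ℂ) * (ξ i : ℂ)) * FT (comp v k) ξ := by
        rw [Finset.sum_mul]; exact Finset.sum_congr rfl fun i _ => by ring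
    _ = 0 := by rw [h2, zero_mul]

theorem FT_lin {e e' e'' : V → V} (he : MemLp e 2 volume) (he' : MemLp e' 2 volume) (he'' : MemLp e'' 2 volume) (a : ℝ)
    (h : ∀ᵐ x, e'' x = a • e x + e' x) (k : Fin 3) :
    ∀ᵐ ξ, FT (comp e'' k) ξ = (a : ℂ) * FT (comp e k) ξ + FT (comp e' k) ξ := by
  have p1 := ((comp_pair he k).smul (a : ℂ)).add (comp_pair he' k)
  have p2 : IsFourierPair (comp e'' k) ((a:ℂ) • FT (comp e k) + FT (comp e' k)) := by
    refine p1.congr ?_ (ae_eq_refl _)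
    filter_upwards [h] with x hx
    simp [comp, hx]
  filter_upwards [FT_of_pair p2] with ξ h
  rw [h]; simp

theorem PiQ_lin (hq : Msk q R C) {e e' e'' : V → V} (he : MemLp e 2 volume) (he' : MemLp e' 2 volume) (he'' : MemLp e'' 2 volume) (a : ℝ)
    (h : ∀ᵐ x, e'' x = a • e x + e' x) : PiQ q e'' = fun j x => a * PiQ q e j x + PiQ q e' j x := by
  funext j
  refine BL.ext (PiQ_bl hq he'' j) (((PiQ_bl hq he j).cmul a).add (PiQ_bl hq he' j)) ?_
  have := fun k => FT_lin he he' he'' a h k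
  rw [← ae_all_iff] at this
  filter_upwards [this] with ξ hξ
  simp only [hξ, Finset.mul_sum, ← Finset.sum_add_distrib]
  exact Finset.sum_congr rfl fun k _ => by ring

theorem nrm_mult {m : V → ℝ} {v : V → ℂ} {C : ℝ} (hC : ∀ ξ, |m ξ| ≤ C) (hv : MemLp v 2 volume) :
    nrm (fun ξ => (m ξ : ℂ) * v ξ) ≤ C * nrm v := by
  refine nrm_le_of_le hv ((abs_nonneg _).trans (hC 0)) (ae_of_all _ fun ξ => ?_)
  rw [norm_mul, Complex.norm_real]
  exact mul_le_mul_of_nonneg_right (hC ξ) (norm_nonneg _)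

theorem PiQ_nrm (hq : Msk q R C) {v : V → V} (hv : MemLp v 2 volume) (j : Fin 3) : nrm (PiQ q v j) ≤ 6 * C * nrm v := by
  have b := fun k => BL.ofMult (R := R) (comp_pair hv k) (hq.lm j k).meas (hq.lm j k).bd (hq.lm j k).even
    (fun ξ h => by simp [(hq.lm j k).supp ξ h])
  unfold PiQ
  refine (nrm_sum_le _ fun k _ => (b k).memLp).trans ?_
  calc ∑ k, nrm (mulF (lm q j k) (FT (comp v k))) ≤ ∑ k : Fin 3, C * 2 * nrm v := Finset.sum_le_sum fun k _ => by
        rw [(b k).nrm_eq]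
        refine (nrm_mult (hq.lm j k).bd (FT_memLp _)).trans ?_
        exact mul_le_mul_of_nonneg_left (FT_comp_nrm hv k) (hq.lm j k).C0
    _ = _ := by simp; ring

theorem PQ_nrm (hq : Msk q R C) {v : V → V} (hv : MemLp v 2 volume) (j : Fin 3) : nrm (PQ q v j) ≤ C * nrm v := by
  rw [(PQ_bl hq hv j).nrm_eq]
  exact (nrm_mult hq.bd (FT_memLp _)).trans (mul_le_mul_of_nonneg_left (FT_comp_nrm hv j) hq.C0)

def PV (q : V → ℝ) (v : V → V) (x : V) : V := WithLp.toLp 2 (fun j => PQ q v j x)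

theorem PV_memLp (hq : Msk q R C) {v : V → V} (hv : MemLp v 2 volume) : MemLp (PV q v) 2 volume := by
  rw [memLp_piLp_iff]
  exact fun i => (PQ_bl hq hv i).memLp

theorem PV_FT (hq : Msk q R C) {v : V → V} (hv : MemLp v 2 volume) {e : V → V} (he : e =ᵐ[volume] PV q v) (k : Fin 3) :
    ∀ᵐ ξ, FT (comp e k) ξ = (q ξ : ℂ) * FT (comp v k) ξ := by
  refine FT_of_pair ((PQ_bl hq hv k).pair.congr ?_ (ae_eq_refl _))
  filter_upwards [he] with x hx
  simp [comp, hx, PV]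

theorem PiQ_PV (hq : Msk q R C) {v : V → V} (hv : MemLp v 2 volume) (hd : DivFreeF v) {e : V → V} (he : e =ᵐ[volume] PV q v) :
    PiQ q e = PQ (fun ξ => q ξ ^ 2) v := by
  have hem : MemLp e 2 volume := (PV_memLp hq hv).ae_eq he.symm
  have hq2 : Msk (fun ξ => q ξ ^ 2) R (C ^ 2) := ⟨hq.meas.pow_const 2, fun ξ => by
    rw [abs_pow]; exact pow_le_pow_left₀ (abs_nonneg _) (hq.bd ξ) 2, fun ξ => by simp [hq.even], fun ξ h => by simp [hq.supp ξ h], hq.hR⟩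
  funext j
  refine BL.ext (PiQ_bl hq hem j) (PQ_bl hq2 hv j) ?_
  have := fun k => PV_FT hq hv he k
  rw [← ae_all_iff] at this
  filter_upwards [this, hd] with ξ h1 h2
  simp only [h1]
  rw [lm_fix]
  · push_cast; ring
  · calc _ = (q ξ : ℂ) * ∑ i, FT (comp v i) ξ * ((ξ i : ℝ) : ℂ) := by
          rw [Finset.mul_sum]; exact Finset.sum_congr rfl fun i _ => by ring
      _ = 0 := by rw [h2, mul_zero]

theorem prE_eq (hq : Msk q R C) {v e : V → V} (hv : MemLp v 2 volume) (hd : DivFreeF v) (he : MemLp e 2 volume) :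
    prE v (PiQ q e) = ∑ j, ∫ x, e x j * PQ q v j x := by
  have A : ∀ j, ((∫ x, v x j * PiQ q e j x : ℝ) : ℂ) = ∫ ξ, FT (comp v j) ξ * conj (∑ k, (lm q j k ξ : ℂ) * FT (comp e k) ξ) :=
    fun j => (PiQ_bl hq he j).parseval (comp_pair hv j)
  have B : ∀ j, ((∫ x, e x j * PQ q v j x : ℝ) : ℂ) = ∫ ξ, conj (FT (comp e j) ξ) * ((q ξ : ℂ) * FT (comp v j) ξ) := by
    intro j
    have h := (PQ_bl hq hv j).parseval (comp_pair he j)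
    have h2 := congrArg conj h
    rw [Complex.conj_ofReal, ← integral_conj] at h2
    rw [h2]
    simp
  have I1 : ∀ j, Integrable (fun x => v x j * PiQ q e j x) volume := fun j => (int_mul_le (memLp_co hv j) (PiQ_bl hq he j).memLp).1
  have IA : ∀ j, Integrable (fun ξ => FT (comp v j) ξ * conj (∑ k, (lm q j k ξ : ℂ) * FT (comp e k) ξ)) volume := fun j =>
    (FT_memLp _).integrable_mul (PiQ_bl hq he j).hm.star
  have IB : ∀ j, Integrable (fun ξ => conj (FT (comp e j) ξ) * ((q ξ : ℂ) * FT (comp v j) ξ)) volume := fun j =>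
    (FT_memLp _).star.integrable_mul (PQ_bl hq hv j).hm
  have e1 : prE v (PiQ q e) = ∑ j, ∫ x, v x j * PiQ q e j x := by
    unfold prE prI
    rw [integral_finsetSum _ fun j _ => I1 j]
  rw [e1]
  apply Complex.ofReal_injective
  rw [Complex.ofReal_sum, Complex.ofReal_sum]
  simp only [A, B]
  rw [← integral_finsetSum _ fun j _ => IA j, ← integral_finsetSum _ fun j _ => IB j]
  refine integral_congr_ae ?_
  filter_upwards [hd] with ξ hξ
  simp only [map_sum, map_mul, Complex.conj_ofReal, Finset.mul_sum]
  rw [Finset.sum_comm]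
  refine Finset.sum_congr rfl fun k _ => ?_
  have := lm_fix q k ξ _ hξ
  calc _ = conj (FT (comp e k) ξ) * ∑ j, (lm q k j ξ : ℂ) * FT (comp v j) ξ := by
        rw [Finset.mul_sum]; exact Finset.sum_congr rfl fun j _ => by rw [lm_symm q k j]; ring
    _ = _ := by rw [this]

def En (m : V → ℝ) (v : V → V) : ℝ := ∑ j, ∫ ξ, m ξ * ‖FT (comp v j) ξ‖ ^ 2

theorem PV_nrm (hq : Msk q R C) {v : V → V} (hv : MemLp v 2 volume) : nrm (PV q v) ^ 2 = En (fun ξ => q ξ ^ 2) v := by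
  rw [nrm_sq (PV_memLp hq hv)]
  have e : ∀ x, ‖PV q v x‖ ^ 2 = ∑ j, ‖PQ q v j x‖ ^ 2 := fun x => by
    rw [EuclideanSpace.norm_sq_eq]; rfl
  simp only [e]
  rw [integral_finsetSum _ fun j _ => int_sq (PQ_bl hq hv j).memLp]
  unfold En
  refine Finset.sum_congr rfl fun j _ => ?_
  rw [← nrm_sq (PQ_bl hq hv j).memLp, (PQ_bl hq hv j).nrm_eq, nrm_sq (PQ_bl hq hv j).hm]
  simp [mul_pow]

theorem PV_nrm_le (hq : Msk q R C) {v : V → V} (hv : MemLp v 2 volume) : nrm (PV q v) ≤ 2 * C * nrm v := by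
  have h : nrm (PV q v) ^ 2 = ∑ j, nrm (PQ q v j) ^ 2 := by
    rw [nrm_sq (PV_memLp hq hv)]
    have e : ∀ x, ‖PV q v x‖ ^ 2 = ∑ j, ‖PQ q v j x‖ ^ 2 := fun x => by
      rw [EuclideanSpace.norm_sq_eq]; rfl
    simp only [e]
    rw [integral_finsetSum _ fun j _ => int_sq (PQ_bl hq hv j).memLp]
    exact Finset.sum_congr rfl fun j _ => (nrm_sq (PQ_bl hq hv j).memLp).symm
  have h2 : nrm (PV q v) ^ 2 ≤ 3 * (C * nrm v) ^ 2 := by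
    rw [h]
    calc _ ≤ ∑ j : Fin 3, (C * nrm v) ^ 2 := Finset.sum_le_sum fun j _ => pow_le_pow_left₀ (nrm_nonneg _) (PQ_nrm hq hv j) 2
      _ = _ := by simp
  have := mul_nonneg hq.C0 (nrm_nonneg v)
  nlinarith [nrm_nonneg (PV q v)]

theorem En_ident {ν : ℝ} {u₀ : V → V} {u : ℝ → V → V} (hu : IsLerayHopf ν u₀ u) (hu0 : MemLp u₀ 2 volume) (hd0 : DivFreeF u₀)
    (hq : Msk q R C) :
    AEStronglyMeasurable (fun s => Fop ν (u s) (PQ (fun ξ => q ξ ^ 2) (u s))) (volume.restrict (Set.Ioi (0:ℝ))) ∧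
    (∃ K, ∀ᵐ s ∂(volume.restrict (Set.Ioi (0:ℝ))), |Fop ν (u s) (PQ (fun ξ => q ξ ^ 2) (u s))| ≤ K) ∧
    ∀ᵐ t ∂(volume.restrict (Set.Ioi (0:ℝ))), En (fun ξ => q ξ ^ 2) (u t) = En (fun ξ => q ξ ^ 2) u₀ +
      2 * ∫ s in Set.Ioc 0 t, Fop ν (u s) (PQ (fun ξ => q ξ ^ 2) (u s)) := by
  obtain ⟨M, M0, hM⟩ := LH_bound hu
  let U : ℝ → Lp V 2 (volume : Measure V) := fun t => if h : 0 < t then (PV_memLp hq (hu.memL2 t h)).toLp (PV q (u t)) else 0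
  let G : ℝ → Lp V 2 (volume : Measure V) → ℝ := fun s e => Fop ν (u s) (PiQ q e)
  have hUc : ∀ t, 0 < t → U t =ᵐ[volume] PV q (u t) := fun t h => by
    simp only [U, dif_pos h]; exact MemLp.coeFn_toLp _
  let K := (9 * |ν| * M + 9 * M ^ 2) * KR R
  have hK : 0 ≤ K := mul_nonneg (by positivity) (KR_nonneg hq.hR)
  have hC := hq.C0
  have hin : ∀ (v : V → V) (hv : MemLp v 2 volume) (e : Lp V 2 (volume : Measure V)), DivFreeF v →
      inner ℝ ((PV_memLp hq hv).toLp (PV q v)) e = prE v (PiQ q e) := by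
    intro v hv e hd
    have he := Lp.memLp e
    rw [prE_eq hq hv hd he, L2.inner_def, ← integral_finsetSum _ fun j _ => (int_mul_le (memLp_co he j) (PQ_bl hq hv j).memLp).1]
    refine integral_congr_ae ?_
    filter_upwards [MemLp.coeFn_toLp (PV_memLp hq hv)] with x hx
    rw [hx, PiLp.inner_apply]
    rfl
  have hadm := fun e : Lp V 2 (volume : Measure V) => BL.adm hq.hR (fun j => PiQ_bl hq (Lp.memLp e) j)
  have : Fact ((2:ℝ≥0∞) ≠ ⊤) := ⟨by simp⟩
  have : SecondCountableTopology (Lp V 2 (volume : Measure V)) := Lp.SecondCountableTopology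
  have key := hilb (U := U) (U0 := (PV_memLp hq hu0).toLp (PV q u₀)) (G := G) (C := K * (18 * C)) (M := 2 * C * M)
    (by positivity) ?_ ?_ ?_ ?_
  · obtain ⟨k1, k2, k3⟩ := key
    have hGU : ∀ᵐ s ∂(volume.restrict (Set.Ioi (0:ℝ))), G s (U s) = Fop ν (u s) (PQ (fun ξ => q ξ ^ 2) (u s)) := by
      filter_upwards [hu.divFree, ae_restrict_mem measurableSet_Ioi] with s hs hs0
      simp only [G]
      rw [PiQ_PV hq (hu.memL2 s hs0) hs (hUc s hs0)]
    refine ⟨k1.congr hGU, ⟨K * (18 * C) * (2 * C * M), ?_⟩, ?_⟩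
    · filter_upwards [k2, hGU] with s h1 h2
      rw [← h2]; exact h1
    · filter_upwards [k3, ae_restrict_mem measurableSet_Ioi] with t ht ht0
      have n1 : ∀ (v : V → V) (hv : MemLp v 2 volume), ‖(PV_memLp hq hv).toLp (PV q v)‖ ^ 2 = En (fun ξ => q ξ ^ 2) v := by
        intro v hv
        rw [Lp.norm_toLp, ← PV_nrm hq hv]; rfl
      have : U t = (PV_memLp hq (hu.memL2 t ht0)).toLp (PV q (u t)) := by
        simp only [U]; exact dif_pos ht0
      rw [this, n1 _ (hu.memL2 t ht0), n1 _ hu0] at ht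
      rw [ht]
      congr 2
      refine integral_congr_ae ?_
      exact ae_restrict_of_ae_restrict_of_subset Set.Ioc_subset_Ioi_self hGU
  · filter_upwards [hM, ae_restrict_mem measurableSet_Ioi] with s hs hs0
    let L0 : Lp V 2 (volume : Measure V) →ₗ[ℝ] ℝ :=
      { toFun := G s
        map_add' := fun e e' => by
          obtain ⟨g, A, _⟩ := hadm e
          obtain ⟨g', A', _⟩ := hadm e'
          have := PiQ_lin hq (Lp.memLp e) (Lp.memLp e') (Lp.memLp (e + e')) 1 (by
            filter_upwards [Lp.coeFn_add e e'] with x hx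
            rw [hx]; simp)
          simp only [G]
          rw [this, Fop_lin A A' 1 ν (hu.memL2 s hs0), one_mul]
        map_smul' := fun a e => by
          obtain ⟨g, A, _⟩ := hadm e
          obtain ⟨g', A', _⟩ := hadm 0
          have h0 : PiQ q (0 : Lp V 2 (volume : Measure V)) = fun j x => 0 := by
            have := PiQ_lin hq (Lp.memLp e) (Lp.memLp (0 : Lp V 2 (volume : Measure V))) (Lp.memLp e) 1 (by
              filter_upwards [Lp.coeFn_zero V 2 (volume : Measure V)] with x hx
              rw [hx]; simp)
            funext j x
            have h := congrFun (congrFun this j) x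
            simpa using h
          have := PiQ_lin hq (Lp.memLp e) (Lp.memLp (0 : Lp V 2 (volume : Measure V))) (Lp.memLp (a • e)) a (by
            filter_upwards [Lp.coeFn_smul a e, Lp.coeFn_zero V 2 (volume : Measure V)] with x hx hx0
            rw [hx, hx0]; simp)
          simp only [G]
          rw [this, Fop_lin A A' a ν (hu.memL2 s hs0), h0]
          have : Fop ν (u s) (fun j x => 0) = 0 := by
            have z : ∀ i, NSE.pd (fun _ : V => (0:ℝ)) i = fun _ => 0 := fun i => by funext x; simp [NSE.pd]
            simp [Fop, FI, z]
          rw [this]; simp }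
    have hb : ∀ e, ‖L0 e‖ ≤ K * (18 * C) * ‖e‖ := by
      intro e
      refine (Fop_bd hq.hR (fun j => PiQ_bl hq (Lp.memLp e) j) ν (hu.memL2 s hs0) hs).trans ?_
      rw [mul_assoc K]
      refine mul_le_mul_of_nonneg_left ?_ hK
      calc _ ≤ ∑ j : Fin 3, 6 * C * nrm e := Finset.sum_le_sum fun j _ => PiQ_nrm hq (Lp.memLp e) j
        _ = _ := by rw [Lp.norm_def]; simp [nrm]; ring
    exact ⟨L0.mkContinuous _ hb, fun e => rfl, L0.mkContinuous_norm_le (by positivity) hb⟩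
  · intro e
    obtain ⟨g, A, _⟩ := hadm e
    exact (A.Fop_sm ν hu.meas).aestronglyMeasurable
  · filter_upwards [hM, ae_restrict_mem measurableSet_Ioi] with s hs hs0
    have : U s = (PV_memLp hq (hu.memL2 s hs0)).toLp (PV q (u s)) := by
      simp only [U]; exact dif_pos hs0
    rw [this, Lp.norm_toLp]
    exact (PV_nrm_le hq (hu.memL2 s hs0)).trans (mul_le_mul_of_nonneg_left hs (by positivity))
  · intro e
    have := WI_BL hu hu0 hq.hR (fun j => PiQ_bl hq (Lp.memLp e) j) (ae_of_all _ fun ξ => PiQ_div _ ξ)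
    filter_upwards [this, hu.divFree, ae_restrict_mem measurableSet_Ioi] with t ht hd ht0
    have hUt : U t = (PV_memLp hq (hu.memL2 t ht0)).toLp (PV q (u t)) := by
      simp only [U]; exact dif_pos ht0
    rw [hUt, hin _ (hu.memL2 t ht0) _ hd, hin _ hu0 _ hd0, ht]

end

section

def fs (v : V → V) (ξ : V) : ℝ := ∑ j : Fin 3, ‖FT (comp v j) ξ‖ ^ 2
def Ig (ω : V → ℝ) (v : V → V) : Prop := Integrable (fun ξ => ω ξ * fs v ξ) volume
def W (ω : V → ℝ) (v : V → V) : ℝ := ∫ ξ, ω ξ * fs v ξ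
def EN (ω : V → ℝ) (v : V → V) : ℝ≥0∞ := ∫⁻ ξ, ENNReal.ofReal (ω ξ) * frSq v ξ

theorem fs_nonneg (v : V → V) (ξ : V) : 0 ≤ fs v ξ := Finset.sum_nonneg fun _ _ => sq_nonneg _

theorem frSq_eq (v : V → V) (ξ : V) : frSq v ξ = ENNReal.ofReal (fs v ξ) := by
  unfold frSq fs
  rw [ENNReal.ofReal_sum_of_nonneg fun _ _ => sq_nonneg _]
  refine Finset.sum_congr rfl fun j _ => ?_
  rw [ENNReal.ofReal_pow (norm_nonneg _), ofReal_norm_eq_enorm]; rfl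

theorem fs_int (v : V → V) : Integrable (fs v) volume := integrable_finsetSum _ fun j _ => int_sq (FT_memLp (comp v j))

theorem fs_meas (v : V → V) : AEStronglyMeasurable (fs v) volume := (fs_int v).1

theorem Ig_bd {ω : V → ℝ} (hω : Measurable ω) {C : ℝ} (hC : ∀ ξ, |ω ξ| ≤ C) (v : V → V) : Ig ω v :=
  (fs_int v).bdd_mul hω.aestronglyMeasurable (c := C) (ae_of_all _ hC)

theorem Ig_mono {ω ω' : V → ℝ} (hω : Measurable ω) (h : ∀ ξ, |ω ξ| ≤ ω' ξ) {v : V → V} (hi : Ig ω' v) : Ig ω v := by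
  refine Integrable.mono' hi (hω.aestronglyMeasurable.mul (fs_meas v)) (ae_of_all _ fun ξ => ?_)
  rw [norm_mul, Real.norm_eq_abs, Real.norm_of_nonneg (fs_nonneg v ξ)]
  exact mul_le_mul_of_nonneg_right (h ξ) (fs_nonneg v ξ)

theorem W_mono {ω ω' : V → ℝ} {v : V → V} (hi : Ig ω v) (hi' : Ig ω' v) (h : ∀ ξ, ω ξ ≤ ω' ξ) : W ω v ≤ W ω' v :=
  integral_mono hi hi' fun ξ => mul_le_mul_of_nonneg_right (h ξ) (fs_nonneg v ξ)

theorem Ig.lin {ω ω' : V → ℝ} {v : V → V} (hi : Ig ω v) (hi' : Ig ω' v) (a b : ℝ) : Ig (fun ξ => a * ω ξ + b * ω' ξ) v := by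
  refine Integrable.congr ((hi.const_mul a).add (hi'.const_mul b)) (ae_of_all _ fun ξ => ?_)
  simp only [Pi.add_apply]; ring

theorem W_lin {ω ω' : V → ℝ} {v : V → V} (hi : Ig ω v) (hi' : Ig ω' v) (a b : ℝ) :
    W (fun ξ => a * ω ξ + b * ω' ξ) v = a * W ω v + b * W ω' v := by
  unfold W
  rw [← integral_const_mul, ← integral_const_mul, ← integral_add (hi.const_mul a) (hi'.const_mul b)]
  exact integral_congr_ae (ae_of_all _ fun ξ => by simp only; ring)

theorem W_nonneg {ω : V → ℝ} (h : ∀ ξ, 0 ≤ ω ξ) (v : V → V) : 0 ≤ W ω v :=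
  integral_nonneg fun ξ => mul_nonneg (h ξ) (fs_nonneg v ξ)

theorem EN_eq {ω : V → ℝ} (h : ∀ ξ, 0 ≤ ω ξ) {v : V → V} (hi : Ig ω v) : EN ω v = ENNReal.ofReal (W ω v) := by
  unfold EN W
  rw [ofReal_integral_eq_lintegral_ofReal hi (ae_of_all _ fun ξ => mul_nonneg (h ξ) (fs_nonneg v ξ))]
  refine lintegral_congr fun ξ => ?_
  rw [frSq_eq, ENNReal.ofReal_mul (h ξ)]

theorem Ig_of_EN {ω : V → ℝ} (hω : Measurable ω) (h : ∀ ξ, 0 ≤ ω ξ) {v : V → V} (hi : EN ω v < ⊤) : Ig ω v := by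
  refine ⟨hω.aestronglyMeasurable.mul (fs_meas v), ?_⟩
  rw [hasFiniteIntegral_iff_ofReal (ae_of_all _ fun ξ => mul_nonneg (h ξ) (fs_nonneg v ξ))]
  refine lt_of_le_of_lt (le_of_eq ?_) hi
  refine lintegral_congr fun ξ => ?_
  rw [frSq_eq, ENNReal.ofReal_mul (h ξ)]

theorem En_eq_W {m : V → ℝ} (hm : Measurable m) {C : ℝ} (hC : ∀ ξ, |m ξ| ≤ C) (v : V → V) : En m v = W m v := by
  unfold En W fs
  simp only [Finset.mul_sum]
  rw [integral_finsetSum]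
  exact fun j _ => (int_sq (FT_memLp (comp v j))).bdd_mul hm.aestronglyMeasurable (c := C) (ae_of_all _ hC)

theorem W_one {v : V → V} (hv : MemLp v 2 volume) : W (fun _ => 1) v = nrm v ^ 2 := by
  unfold W fs
  simp only [one_mul]
  rw [integral_finsetSum _ fun j _ => int_sq (FT_memLp (comp v j)), nrm_sq hv]
  have e : ∀ x, ‖v x‖ ^ 2 = ∑ j, ‖v x j‖ ^ 2 := fun x => EuclideanSpace.norm_sq_eq _
  simp only [e]
  rw [integral_finsetSum _ fun j _ => int_sq (memLp_co hv j)]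
  refine Finset.sum_congr rfl fun j _ => ?_
  rw [← nrm_sq (memLp_co hv j), ← nrm_sq (FT_memLp (comp v j))]
  congr 1
  unfold nrm; rw [← (comp_pair hv j).norm_eq]
  congr 1
  exact eLpNorm_congr_norm_ae (ae_of_all _ fun x => by simp)

theorem Msk.mul_sq {m : V → ℝ} {R C : ℝ} (hm : Msk m R C) : Msk (fun ξ => m ξ * ‖ξ‖ ^ 2) R (C * R ^ 2) := by
  refine ⟨hm.meas.mul (by fun_prop), fun ξ => ?_, fun ξ => by simp [hm.even], fun ξ h => by simp [hm.supp ξ h], hm.hR⟩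
  rw [abs_mul, abs_of_nonneg (sq_nonneg ‖ξ‖)]
  by_cases h : R < ‖ξ‖
  · simp [hm.supp ξ h]
    have := hm.C0; positivity
  · push Not at h
    exact mul_le_mul (hm.bd ξ) (pow_le_pow_left₀ (norm_nonneg _) h 2) (sq_nonneg _) hm.C0

theorem Fop_eq {m : V → ℝ} {R C : ℝ} (hm : Msk m R C) (ν : ℝ) {v : V → V} (hv : MemLp v 2 volume) :
    Fop ν v (PQ m v) = - (4 * π ^ 2 * ν) * W (fun ξ => m ξ * ‖ξ‖ ^ 2) v + tri (fun i x => v x i) (fun i x => v x i) (PQ m v) := by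
  have B := fun j => PQ_bl hm hv j
  have I1 : ∀ i j, Integrable (fun x => v x j * pd (pd (PQ m v j) i) i x) volume := fun i j =>
    (int_mul_le (memLp_co hv j) (((B j).pd i).pd i).memLp).1
  have I2 : ∀ i j, Integrable (fun x => v x i * v x j * pd (PQ m v j) i x) volume := fun i j => by
    have h := (int_mul_le (memLp_co hv i) (memLp_co hv j)).1
    have K := (B j).pd i
    exact h.mul_bdd (c := CR R * nrm (pd (PQ m v j) i)) K.cont.aestronglyMeasurable (ae_of_all _ K.bound)
  have P : ∀ i j, ∫ x, v x j * pd (pd (PQ m v j) i) i x = - (4 * π ^ 2) * ∫ ξ, (m ξ * ξ i ^ 2) * ‖FT (comp v j) ξ‖ ^ 2 := by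
    intro i j
    have h := (((B j).pd i).pd i).parseval (comp_pair hv j)
    apply Complex.ofReal_injective
    rw [h, ← integral_const_mul, ← integral_complex_ofReal]
    refine integral_congr_ae (ae_of_all _ fun ξ => ?_)
    simp only [map_mul, Complex.conj_ofReal, Complex.conj_I, conj_ofNat]
    push_cast
    rw [← Complex.mul_conj']
    have hI := Complex.I_sq
    linear_combination (FT (comp v j) ξ) * 4 * π^2 * (ξ i : ℂ)^2 * m ξ * conj (FT (comp v j) ξ) * hI
  have I3 : ∀ i j, Integrable (fun ξ : V => (m ξ * ξ i ^ 2) * ‖FT (comp v j) ξ‖ ^ 2) volume := by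
    intro i j
    refine (int_sq (FT_memLp (comp v j))).bdd_mul (c := C * R ^ 2) ?_ (ae_of_all _ fun ξ => ?_)
    · have h1 : Measurable (fun ξ : V => ξ i) := (EuclideanSpace.proj (𝕜 := ℝ) i : V →L[ℝ] ℝ).measurable
      exact (hm.meas.mul (h1.pow_const 2)).aestronglyMeasurable
    · refine le_trans ?_ (hm.mul_sq.bd ξ)
      rw [norm_mul, abs_mul, Real.norm_eq_abs]
      refine mul_le_mul_of_nonneg_left ?_ (abs_nonneg _)
      rw [Real.norm_eq_abs, abs_pow, abs_pow, abs_norm]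
      exact pow_le_pow_left₀ (abs_nonneg _) (co_le _ _) 2
  unfold Fop FI tri
  rw [integral_add, integral_finsetSum]
  · congr 1
    · rw [integral_const_mul, integral_finsetSum]
      · have : ∀ j, ∫ x, v x j * ∑ i, pd (pd (PQ m v j) i) i x = - (4 * π ^ 2) * ∫ ξ, (m ξ * ‖ξ‖ ^ 2) * ‖FT (comp v j) ξ‖ ^ 2 := by
          intro j
          simp only [Finset.mul_sum]
          rw [integral_finsetSum _ fun i _ => I1 i j]
          simp only [P]
          rw [← Finset.mul_sum, ← integral_finsetSum _ fun i _ => I3 i j]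
          congr 2
          funext ξ
          rw [normsq, Fin.sum_univ_three]; ring
        simp only [this]
        rw [← Finset.mul_sum, ← En_eq_W hm.mul_sq.meas hm.mul_sq.bd]
        unfold En; ring
      · intro j _
        simp only [Finset.mul_sum]
        exact integrable_finsetSum _ fun i _ => I1 i j
    · refine Finset.sum_congr rfl fun i _ => ?_
      rw [integral_finsetSum _ fun j _ => I2 i j]
  · exact fun i _ => integrable_finsetSum _ fun j _ => I2 i j
  · refine Integrable.const_mul (integrable_finsetSum _ fun j _ => ?_) _
    simp only [Finset.mul_sum]
    exact integrable_finsetSum _ fun i _ => I1 i j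
  · exact integrable_finsetSum _ fun i _ => integrable_finsetSum _ fun j _ => I2 i j

theorem W_ident {ν : ℝ} {u₀ : V → V} {u : ℝ → V → V} (hu : IsLerayHopf ν u₀ u) (hu0 : MemLp u₀ 2 volume) (hd0 : DivFreeF u₀)
    {m : V → ℝ} {R C : ℝ} (hm : Msk m R C) (h0 : ∀ ξ, 0 ≤ m ξ) :
    AEStronglyMeasurable (fun s => Fop ν (u s) (PQ m (u s))) (volume.restrict (Set.Ioi (0:ℝ))) ∧
    (∃ K, ∀ᵐ s ∂(volume.restrict (Set.Ioi (0:ℝ))), |Fop ν (u s) (PQ m (u s))| ≤ K) ∧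
    ∀ᵐ t ∂(volume.restrict (Set.Ioi (0:ℝ))), W m (u t) = W m u₀ +
      2 * ∫ s in Set.Ioc 0 t, Fop ν (u s) (PQ m (u s)) := by
  have hq : Msk (fun ξ => √(m ξ)) R (√C) := ⟨hm.meas.sqrt, fun ξ => by
    rw [abs_of_nonneg (Real.sqrt_nonneg _)]; exact Real.sqrt_le_sqrt ((le_abs_self _).trans (hm.bd ξ)),
    fun ξ => by simp [hm.even], fun ξ h => by simp [hm.supp ξ h], hm.hR⟩
  have e : (fun ξ => √(m ξ) ^ 2) = m := by funext ξ; exact Real.sq_sqrt (h0 ξ)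
  have := En_ident hu hu0 hd0 hq
  simp only [e, En_eq_W hm.meas hm.bd] at this
  exact this

theorem W_tm {ν : ℝ} {u₀ : V → V} {u : ℝ → V → V} (hu : IsLerayHopf ν u₀ u) (hu0 : MemLp u₀ 2 volume) (hd0 : DivFreeF u₀)
    {m : V → ℝ} {R C : ℝ} (hm : Msk m R C) (h0 : ∀ ξ, 0 ≤ m ξ) :
    AEStronglyMeasurable (fun s => W m (u s)) (volume.restrict (Set.Ioi (0:ℝ))) := by
  obtain ⟨h1, ⟨K, h2⟩, h3⟩ := W_ident hu hu0 hd0 hm h0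
  set g := fun s => Fop ν (u s) (PQ m (u s))
  have hii : ∀ a c, IntervalIntegrable ((Set.Ioi (0:ℝ)).indicator g) volume a c := by
    intro a c
    rw [intervalIntegrable_iff]
    have fm : IsFiniteMeasure (volume.restrict (Set.uIoc a c)) := ⟨by simp [Set.uIoc]⟩
    refine Integrable.mono' (integrable_const |K|) ?_ ?_
    · exact ((aestronglyMeasurable_indicator_iff measurableSet_Ioi).2 h1).restrict
    · refine ae_restrict_of_ae ?_
      filter_upwards [(ae_restrict_iff' measurableSet_Ioi).1 h2] with s hs
      by_cases h : s ∈ Set.Ioi (0:ℝ)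
      · rw [Set.indicator_of_mem h]; exact (hs h).trans (le_abs_self _)
      · rw [Set.indicator_of_notMem h, norm_zero]; positivity
  have hc := ((intervalIntegral.continuous_primitive hii 0).const_mul 2).const_add (W m u₀)
  refine hc.aestronglyMeasurable.congr ?_
  filter_upwards [h3, ae_restrict_mem measurableSet_Ioi] with t ht ht0
  rw [ht, intervalIntegral.integral_of_le (le_of_lt ht0)]
  congr 2
  refine setIntegral_congr_fun measurableSet_Ioc fun s hs => ?_
  exact Set.indicator_of_mem (Set.Ioc_subset_Ioi_self hs) _

theorem EN_sup {ω : V → ℝ} (v : V → V) {r : ℕ → ℝ} (hr : Monotone r) (hr2 : Tendsto r atTop atTop) :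
    EN ω v = ⨆ n, EN ({ξ : V | ‖ξ‖ < r n}.indicator ω) v := by
  have e : ∀ n, EN ({ξ : V | ‖ξ‖ < r n}.indicator ω) v = ∫⁻ ξ in {ξ : V | ‖ξ‖ < r n}, ENNReal.ofReal (ω ξ) * frSq v ξ := by
    intro n
    rw [← lintegral_indicator (measurableSet_lt measurable_norm measurable_const)]
    refine lintegral_congr fun ξ => ?_
    by_cases h : ξ ∈ {ξ : V | ‖ξ‖ < r n}
    · rw [Set.indicator_of_mem h, Set.indicator_of_mem h]
    · rw [Set.indicator_of_notMem h, Set.indicator_of_notMem h]; simp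
  simp only [e]
  rw [← setLIntegral_iUnion_of_directed]
  · have : (⋃ n, {ξ : V | ‖ξ‖ < r n}) = Set.univ := by
      rw [Set.eq_univ_iff_forall]
      intro ξ
      obtain ⟨n, hn⟩ := (hr2.eventually_gt_atTop ‖ξ‖).exists
      exact Set.mem_iUnion.2 ⟨n, hn⟩
    rw [this, setLIntegral_univ]; rfl
  · exact Monotone.directed_le fun a b hab ξ (hξ : ‖ξ‖ < r a) => lt_of_lt_of_le hξ (hr hab)

theorem EN_tm {ν : ℝ} {u₀ : V → V} {u : ℝ → V → V} (hu : IsLerayHopf ν u₀ u) (hu0 : MemLp u₀ 2 volume) (hd0 : DivFreeF u₀)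
    {ω : V → ℝ} (hm : Measurable ω) (h0 : ∀ ξ, 0 ≤ ω ξ) (he : ∀ ξ, ω (-ξ) = ω ξ) (hb : ∀ R, ∃ C, ∀ ξ : V, ‖ξ‖ < R → ω ξ ≤ C) :
    AEMeasurable (fun s => EN ω (u s)) (volume.restrict (Set.Ioi (0:ℝ))) := by
  have e := fun s => EN_sup (ω := ω) (u s) (r := fun n : ℕ => (n:ℝ)) Nat.mono_cast tendsto_natCast_atTop_atTop
  simp only [e]
  refine AEMeasurable.iSup fun n => ?_
  obtain ⟨C, hC⟩ := hb n
  set ω' := {ξ : V | ‖ξ‖ < (n:ℝ)}.indicator ω with hω'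
  have n0 : ∀ ξ, 0 ≤ ω' ξ := fun ξ => Set.indicator_nonneg (fun ξ _ => h0 ξ) ξ
  have M : Msk ω' n (max C 0) := by
    refine ⟨hm.indicator (measurableSet_lt measurable_norm measurable_const), fun ξ => ?_, fun ξ => ?_, fun ξ h => ?_, Nat.cast_nonneg n⟩
    · rw [abs_of_nonneg (n0 ξ)]
      refine Set.indicator_le' (fun ξ h => (hC ξ h).trans (le_max_left _ _)) (fun ξ _ => le_max_right _ _) ξ
    · by_cases h : ‖ξ‖ < n
      · rw [hω', Set.indicator_of_mem (s := {ξ : V | ‖ξ‖ < (n:ℝ)}) h, Set.indicator_of_mem (s := {ξ : V | ‖ξ‖ < (n:ℝ)}) (by simpa using h), he]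
      · rw [hω', Set.indicator_of_notMem (s := {ξ : V | ‖ξ‖ < (n:ℝ)}) h, Set.indicator_of_notMem (s := {ξ : V | ‖ξ‖ < (n:ℝ)}) (by simpa using h)]
    · exact Set.indicator_of_notMem (s := {ξ : V | ‖ξ‖ < (n:ℝ)}) (by simp; exact h.le) _
  have e2 : ∀ s, EN ω' (u s) = ENNReal.ofReal (W ω' (u s)) := fun s => EN_eq n0 (Ig_bd M.meas M.bd _)
  simp only [e2]
  exact (W_tm hu hu0 hd0 M n0).aemeasurable.ennreal_ofReal

end

section

def Sh (L : ℝ) (p : ℕ) : Set V := {ξ | (p = 0 ∨ L * 2 ^ p / 2 ≤ ‖ξ‖) ∧ ‖ξ‖ < L * 2 ^ p}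
def ind (L : ℝ) (p : ℕ) (ξ : V) : ℝ := if ξ ∈ Sh L p then 1 else 0
def mN (L : ℝ) (N : ℕ) (ξ : V) : ℝ := ∑ r ∈ Finset.range N, ((4:ℝ) ^ N - 4 ^ r) * ind L r ξ
def muN (L : ℝ) (N : ℕ) (ξ : V) : ℝ := 4 ^ N - mN L N ξ

variable {L : ℝ}

theorem Sh_meas (L : ℝ) (p : ℕ) : MeasurableSet (Sh L p) := by
  unfold Sh
  by_cases h : p = 0
  · simp only [h, true_or, true_and]
    exact measurableSet_lt measurable_norm measurable_const
  · simp only [h, false_or]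
    exact (measurableSet_le measurable_const measurable_norm).inter (measurableSet_lt measurable_norm measurable_const)

theorem Sh_ex (hL : 0 < L) (ξ : V) : ∃ p, ξ ∈ Sh L p := by
  have hex : ∃ p : ℕ, ‖ξ‖ < L * 2 ^ p := by
    obtain ⟨p, hp⟩ := pow_unbounded_of_one_lt (‖ξ‖ / L) (one_lt_two (α := ℝ))
    exact ⟨p, by rw [div_lt_iff₀ hL] at hp; linarith⟩
  refine ⟨Nat.find hex, ?_, Nat.find_spec hex⟩
  rcases Nat.eq_zero_or_pos (Nat.find hex) with h | h
  · exact Or.inl h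
  · right
    have := Nat.find_min hex (Nat.sub_lt h one_pos)
    push Not at this
    refine le_trans (le_of_eq ?_) this
    obtain ⟨k, hk⟩ := Nat.exists_eq_succ_of_ne_zero h.ne'
    rw [hk]; simp [pow_succ]; ring

theorem Sh_uniq (hL : 0 < L) {ξ : V} {p r : ℕ} (h : ξ ∈ Sh L p) (h' : ξ ∈ Sh L r) : p = r := by
  have key : ∀ p r : ℕ, ξ ∈ Sh L p → ξ ∈ Sh L r → ¬ p < r := by
    intro p r h h' hpr
    rcases h'.1 with h0 | h0
    · omega
    · obtain ⟨k, rfl⟩ := Nat.exists_eq_add_of_lt hpr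
      have h1 := h.2
      have : L * 2 ^ p ≤ L * 2 ^ (p + k + 1) / 2 := by
        rw [pow_succ, pow_add]
        have : (1:ℝ) ≤ 2 ^ k := one_le_pow₀ (by norm_num)
        have h2 : 0 < L * 2 ^ p := by positivity
        nlinarith
      linarith
  rcases lt_trichotomy p r with h1 | h1 | h1
  · exact absurd h1 (key p r h h')
  · exact h1
  · exact absurd h1 (key r p h' h)

theorem ind_eq (hL : 0 < L) {ξ : V} {p : ℕ} (h : ξ ∈ Sh L p) (r : ℕ) : ind L r ξ = if r = p then 1 else 0 := by
  unfold ind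
  by_cases hr : r = p
  · rw [if_pos hr, if_pos (hr ▸ h)]
  · rw [if_neg hr, if_neg fun h' => hr (Sh_uniq hL h' h)]

theorem ind_sum (hL : 0 < L) {ξ : V} {p : ℕ} (h : ξ ∈ Sh L p) (c : ℕ → ℝ) (P : ℕ) :
    ∑ r ∈ Finset.range P, c r * ind L r ξ = if p < P then c p else 0 := by
  simp [ind_eq hL h]

theorem mN_eq (hL : 0 < L) {ξ : V} {p : ℕ} (h : ξ ∈ Sh L p) (N : ℕ) : mN L N ξ = 4 ^ N - 4 ^ (min p N) := by
  unfold mN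
  rw [ind_sum hL h]
  split_ifs with h1
  · rw [min_eq_left h1.le]
  · rw [min_eq_right (not_lt.1 h1), sub_self]

theorem muN_eq (hL : 0 < L) {ξ : V} {p : ℕ} (h : ξ ∈ Sh L p) (N : ℕ) : muN L N ξ = 4 ^ (min p N) := by
  unfold muN; rw [mN_eq hL h]; ring

theorem ind_msk (hL : 0 < L) (p : ℕ) : Msk (ind L p) (L * 2 ^ p) 1 := by
  refine ⟨?_, fun ξ => ?_, fun ξ => ?_, fun ξ h => ?_, by positivity⟩
  · exact Measurable.ite (Sh_meas L p) measurable_const measurable_const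
  · unfold ind; split_ifs <;> simp
  · unfold ind Sh; simp
  · unfold ind Sh
    rw [if_neg]
    intro h'
    exact absurd h'.2 (by linarith)

theorem mN_nonneg (hL : 0 < L) (N : ℕ) (ξ : V) : 0 ≤ mN L N ξ := by
  obtain ⟨p, hp⟩ := Sh_ex hL ξ
  rw [mN_eq hL hp, sub_nonneg]
  exact pow_le_pow_right₀ (by norm_num) (min_le_right _ _)

theorem muN_one (hL : 0 < L) (N : ℕ) (ξ : V) : 1 ≤ muN L N ξ := by
  obtain ⟨p, hp⟩ := Sh_ex hL ξ
  rw [muN_eq hL hp]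
  exact one_le_pow₀ (by norm_num)

theorem mN_msk (hL : 0 < L) (N : ℕ) : Msk (mN L N) (L * 2 ^ N) (4 ^ N) := by
  refine ⟨?_, fun ξ => ?_, fun ξ => ?_, fun ξ h => ?_, by positivity⟩
  · exact Finset.measurable_sum _ fun r _ => (ind_msk hL r).meas.const_mul _
  · rw [abs_of_nonneg (mN_nonneg hL N ξ)]
    obtain ⟨p, hp⟩ := Sh_ex hL ξ
    rw [mN_eq hL hp]
    have : (0:ℝ) < 4 ^ (min p N) := by positivity
    linarith
  · unfold mN; simp only [(ind_msk hL _).even]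
  · refine Finset.sum_eq_zero fun r hr => ?_
    rw [(ind_msk hL r).supp ξ, mul_zero]
    refine lt_of_le_of_lt ?_ h
    have := Finset.mem_range.1 hr
    gcongr
    norm_num

theorem Sh_sq (hL : 0 < L) {ξ : V} {p : ℕ} (h : ξ ∈ Sh L p) : (L * 2 ^ p) ^ 2 ≤ 4 * ‖ξ‖ ^ 2 + L ^ 2 := by
  rcases h.1 with h0 | h0
  · rw [h0]; simp
  · have : 0 < L * 2 ^ p := by positivity
    have h1 : (L * 2 ^ p) ^ 2 ≤ (2 * ‖ξ‖) ^ 2 := pow_le_pow_left₀ this.le (by linarith) 2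
    nlinarith [sq_nonneg L]

theorem pieces (hL : 0 < L) {v : V → V} (hv : MemLp v 2 volume) (hd : DivFreeF v) :
    Pieces L (fun p => PQ (ind L p) v) (fun p i ξ => (ind L p ξ : ℂ) * FT (comp v i) ξ) := by
  refine ⟨hL, fun p i => PQ_bl (ind_msk hL p) hv i, fun p i ξ hp h => ?_, fun p x => ?_⟩
  · have : ind L p ξ = 0 := by
      unfold ind; rw [if_neg]
      intro h'
      rcases h'.1 with h0 | h0
      · omega
      · linarith
    simp [this]
  · have B := BL.sum (Finset.univ) (fun i _ => (PQ_bl (ind_msk hL p) hv i).pd i)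
    have := BL.ext B (BL.zero 0) (by
      filter_upwards [hd] with ξ hξ
      calc _ = (2 * π * I * ind L p ξ : ℂ) * ∑ i, FT (comp v i) ξ * ((ξ i : ℝ) : ℂ) := by
            rw [Finset.mul_sum]; exact Finset.sum_congr rfl fun i _ => by ring
        _ = 0 := by rw [hξ, mul_zero])
    exact congrFun this x

theorem trunc_lim (hL : 0 < L) {v : V → V} (hv : MemLp v 2 volume) (i : Fin 3) :
    Tendsto (fun P => nrm (fun x => ∑ p ∈ Finset.range P, PQ (ind L p) v i x - v x i)) atTop (nhds 0) := by
  have hb : ∀ P ξ, |∑ p ∈ Finset.range P, ind L p ξ - 1| ≤ 1 := by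
    intro P ξ
    obtain ⟨p, hp⟩ := Sh_ex hL ξ
    have := ind_sum hL hp (fun _ => 1) P
    simp only [one_mul] at this
    rw [this]; split_ifs <;> simp
  have e : ∀ P, nrm (fun x => ∑ p ∈ Finset.range P, PQ (ind L p) v i x - v x i) ^ 2 =
      ∫ ξ, (∑ p ∈ Finset.range P, ind L p ξ - 1) ^ 2 * ‖FT (comp v i) ξ‖ ^ 2 := by
    intro P
    have B := BL.sum (Finset.range P) (fun p hp => (PQ_bl (ind_msk hL p) hv i).mono (R' := L * 2 ^ P)
      (by have := Finset.mem_range.1 hp; gcongr; norm_num))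
    have p1 := B.pair.add ((comp_pair hv i).smul (-1))
    have p2 : IsFourierPair (fun x => ((∑ p ∈ Finset.range P, PQ (ind L p) v i x - v x i : ℝ) : ℂ))
        (fun ξ => ((∑ p ∈ Finset.range P, ind L p ξ - 1 : ℝ) : ℂ) * FT (comp v i) ξ) := by
      refine p1.congr (ae_of_all _ fun x => ?_) (ae_of_all _ fun ξ => ?_)
      · simp; ring
      · simp [Finset.sum_mul, sub_mul]; ring
    have : nrm (fun x => ∑ p ∈ Finset.range P, PQ (ind L p) v i x - v x i) =
        nrm (fun ξ => ((∑ p ∈ Finset.range P, ind L p ξ - 1 : ℝ) : ℂ) * FT (comp v i) ξ) := by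
      unfold nrm; rw [← p2.norm_eq]
      congr 1
      exact eLpNorm_congr_norm_ae (ae_of_all _ fun x => by rw [Complex.norm_real])
    rw [this, nrm_sq p2.2.1]
    refine integral_congr_ae (ae_of_all _ fun ξ => ?_)
    simp only [norm_mul, Complex.norm_real, mul_pow, Real.norm_eq_abs, sq_abs]
  have h2 : Tendsto (fun P => nrm (fun x => ∑ p ∈ Finset.range P, PQ (ind L p) v i x - v x i) ^ 2) atTop (nhds 0) := by
    simp only [e]
    have : (0:ℝ) = ∫ ξ : V, (0:ℝ) := by simp
    rw [this]
    refine tendsto_integral_of_dominated_convergence (fun ξ => ‖FT (comp v i) ξ‖ ^ 2) (fun P => ?_) (int_sq (FT_memLp _))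
      (fun P => ae_of_all _ fun ξ => ?_) (ae_of_all _ fun ξ => ?_)
    · refine AEStronglyMeasurable.mul ?_ (int_sq (FT_memLp _)).1
      have : ∀ p, Measurable (ind L p) := fun p => (ind_msk hL p).meas
      exact (((Finset.measurable_sum _ fun p _ => this p).sub_const 1).pow_const 2).aestronglyMeasurable
    · rw [norm_mul, Real.norm_of_nonneg (sq_nonneg _), Real.norm_of_nonneg (sq_nonneg _)]
      refine mul_le_of_le_one_left (sq_nonneg _) ?_
      rw [← sq_abs]
      exact pow_le_one₀ (abs_nonneg _) (hb P ξ)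
    · obtain ⟨p, hp⟩ := Sh_ex hL ξ
      refine tendsto_const_nhds.congr' ?_
      filter_upwards [eventually_gt_atTop p] with P hP
      have := ind_sum hL hp (fun _ => 1) P
      simp only [one_mul] at this
      rw [this, if_pos hP]; simp
  have h3 := h2.sqrt
  simpa [Real.sqrt_sq (nrm_nonneg _)] using h3

theorem prod_lim {f g : V → ℝ} {fn gn : ℕ → V → ℝ} {k : V → ℝ} (hf : MemLp f 2 volume) (hg : MemLp g 2 volume)
    (hfn : ∀ n, MemLp (fn n) 2 volume) (hgn : ∀ n, MemLp (gn n) 2 volume)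
    (h1 : Tendsto (fun n => nrm (fun x => fn n x - f x)) atTop (nhds 0))
    (h2 : Tendsto (fun n => nrm (fun x => gn n x - g x)) atTop (nhds 0))
    (hk : AEStronglyMeasurable k volume) {b : ℝ} (hb : ∀ x, |k x| ≤ b) :
    Tendsto (fun n => ∫ x, fn n x * gn n x * k x) atTop (nhds (∫ x, f x * g x * k x)) := by
  have I : ∀ {a c : V → ℝ}, MemLp a 2 volume → MemLp c 2 volume → Integrable (fun x => a x * c x * k x) volume :=
    fun ha hc => (int_mul_le ha hc).1.mul_bdd (c := b) hk (ae_of_all _ hb)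
  rw [tendsto_iff_norm_sub_tendsto_zero]
  set A := fun n => nrm (fun x => fn n x - f x)
  set B := fun n => nrm (fun x => gn n x - g x)
  have lim : Tendsto (fun n => b * (A n * B n) + b * (A n * nrm g) + b * (nrm f * B n)) atTop (nhds 0) := by
    have := (((h1.mul h2).const_mul b).add ((h1.mul_const (nrm g)).const_mul b)).add ((h2.const_mul (nrm f)).const_mul b)
    simpa using this
  refine squeeze_zero (fun _ => norm_nonneg _) (fun n => ?_) lim
  have df : MemLp (fun x => fn n x - f x) 2 volume := (hfn n).sub hf
  have dg : MemLp (fun x => gn n x - g x) 2 volume := (hgn n).sub hg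
  have e : (∫ x, fn n x * gn n x * k x) - ∫ x, f x * g x * k x = ((∫ x, (fn n x - f x) * (gn n x - g x) * k x) +
      ∫ x, (fn n x - f x) * g x * k x) + ∫ x, f x * (gn n x - g x) * k x := by
    rw [← integral_sub (I (hfn n) (hgn n)) (I hf hg), ← integral_add (I df dg) (I df hg),
      ← integral_add (f := fun x => (fn n x - f x) * (gn n x - g x) * k x + (fn n x - f x) * g x * k x) ((I df dg).add (I df hg)) (I hf dg)]
    exact integral_congr_ae (ae_of_all _ fun x => by ring)
  rw [e]
  have e1 := int3_le df dg hk hb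
  have e2 := int3_le df hg hk hb
  have e3 := int3_le hf dg hk hb
  refine (norm_add_le _ _).trans (add_le_add ((norm_add_le _ _).trans (add_le_add ?_ ?_)) ?_)
  · exact e1
  · exact e2
  · exact e3

end

section

def K0 (L ν M' : ℝ) : ℝ := π ^ 2 * ν * L ^ 2 / 2 + (72 * (18 * π) * M') ^ 2 / (π ^ 2 * ν)

theorem shell_bd {L ν c M' : ℝ} (hL : 0 < L) (hν : 0 < ν) (hc : 2 * c * (72 * (18 * π)) ≤ π ^ 2 / 4) (N : ℕ) {ξ : V} {p : ℕ} (h : ξ ∈ Sh L p)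
    {b : ℝ} (hb : b ≤ M' + 2 * c * ν * (L * 2 ^ p)) :
    72 * (18 * π) * (4 ^ (min p N) * (L * 2 ^ p) * b) ≤
      2 * π ^ 2 * ν * (muN L N ξ * ‖ξ‖ ^ 2) + K0 L ν M' * (4 / L ^ 2 * ‖ξ‖ ^ 2 + 1) := by
  rw [muN_eq hL h]
  have hs := Sh_sq hL h
  have hl : 0 < L * 2 ^ p := by positivity
  have hpi := Real.pi_pos
  have hmu : (4:ℝ) ^ (min p N) ≤ 4 / L ^ 2 * ‖ξ‖ ^ 2 + 1 := by
    have h1 : (4:ℝ) ^ (min p N) ≤ 4 ^ p := pow_le_pow_right₀ (by norm_num) (min_le_left _ _)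
    have h2 : (4:ℝ) ^ p = (L * 2 ^ p) ^ 2 / L ^ 2 := by
      rw [mul_pow, ← pow_mul, mul_comm p 2, pow_mul]; norm_num; field_simp
    have h3 : 4 / L ^ 2 * ‖ξ‖ ^ 2 + 1 = (4 * ‖ξ‖ ^ 2 + L ^ 2) / L ^ 2 := by field_simp
    rw [h3]
    refine h1.trans (h2.le.trans ?_)
    gcongr
  set mu := (4:ℝ) ^ (min p N)
  have hm0 : 0 < mu := by positivity
  set l := L * 2 ^ p
  set K := 72 * (18 * π) with hK
  have hK0 : 0 < K := by positivity
  have a1 : K * M' * l ≤ π ^ 2 * ν / 4 * l ^ 2 + (K * M') ^ 2 / (π ^ 2 * ν) := by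
    have e : π ^ 2 * ν / 4 * l ^ 2 + (K * M') ^ 2 / (π ^ 2 * ν) - K * M' * l = (π ^ 2 * ν * l / 2 - K * M') ^ 2 / (π ^ 2 * ν) := by
      field_simp; ring
    have : 0 ≤ (π ^ 2 * ν * l / 2 - K * M') ^ 2 / (π ^ 2 * ν) := by positivity
    linarith
  have a2 : K * (l * b) ≤ 2 * π ^ 2 * ν * ‖ξ‖ ^ 2 + K0 L ν M' := by
    have b1 : K * (l * b) ≤ K * (l * (M' + 2 * c * ν * l)) := by gcongr
    have b2 : 2 * c * K * (ν * l ^ 2) ≤ π ^ 2 / 4 * (ν * l ^ 2) := by gcongr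
    have b3 : π ^ 2 * ν / 2 * l ^ 2 ≤ π ^ 2 * ν / 2 * (4 * ‖ξ‖ ^ 2 + L ^ 2) := by gcongr
    unfold K0
    rw [← hK]
    nlinarith
  have hk0 : 0 ≤ K0 L ν M' := by unfold K0; positivity
  calc K * (mu * l * b) = mu * (K * (l * b)) := by ring
    _ ≤ mu * (2 * π ^ 2 * ν * ‖ξ‖ ^ 2 + K0 L ν M') := by gcongr
    _ = 2 * π ^ 2 * ν * (mu * ‖ξ‖ ^ 2) + K0 L ν M' * mu := by ring
    _ ≤ _ := by gcongr

theorem bsum {M' a : ℝ} (P : ℕ) (ha : 0 ≤ a) :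
    ∑ m ∈ Finset.range (P + 1), (if m = 0 then M' else a * 2 ^ m) ≤ M' + 2 * (a * 2 ^ P) := by
  have : ∑ m ∈ Finset.range (P + 1), (if m = 0 then M' else a * 2 ^ m) = M' + 2 * (a * 2 ^ P) - 2 * a := by
    induction P with
    | zero => simp
    | succ n ih => rw [Finset.sum_range_succ, ih, if_neg (by omega), pow_succ]; ring
  linarith

theorem muN_meas {L : ℝ} (hL : 0 < L) (N : ℕ) : Measurable (muN L N) := (mN_msk hL N).meas.const_sub _

theorem muN_le {L : ℝ} (hL : 0 < L) (N : ℕ) (ξ : V) : muN L N ξ ≤ 4 ^ N := by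
  have := mN_nonneg hL N ξ; unfold muN; linarith

theorem Ig_mu {L : ℝ} (hL : 0 < L) (N : ℕ) {v : V → V} (hg : Ig (fun ξ => ‖ξ‖ ^ 2) v) : Ig (fun ξ => muN L N ξ * ‖ξ‖ ^ 2) v := by
  have := hg.lin hg (4 ^ N) 0
  refine Ig_mono ((muN_meas hL N).mul (by fun_prop)) (fun ξ => ?_) this
  have h1 := muN_one hL N ξ
  have h2 : 0 ≤ muN L N ξ := by linarith
  show |muN L N ξ * ‖ξ‖ ^ 2| ≤ _
  rw [abs_of_nonneg (mul_nonneg h2 (sq_nonneg _)), zero_mul, add_zero]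
  exact mul_le_mul_of_nonneg_right (muN_le hL N ξ) (sq_nonneg _)

theorem W_fin {n : ℕ} {v : V → V} (c : ℕ → ℝ) {ω : ℕ → V → ℝ} (h : ∀ p, Ig (ω p) v) :
    Ig (fun ξ => ∑ p ∈ Finset.range n, c p * ω p ξ) v ∧
    W (fun ξ => ∑ p ∈ Finset.range n, c p * ω p ξ) v = ∑ p ∈ Finset.range n, c p * W (ω p) v := by
  induction n with
  | zero => simp [Ig, W]
  | succ n ih =>
    have h1 := ih.1.lin (h n) 1 (c n)
    have h2 := W_lin ih.1 (h n) 1 (c n)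
    simp only [one_mul] at h1 h2
    simp only [Finset.sum_range_succ]
    exact ⟨h1, by rw [h2, ih.2]⟩

theorem slice {L ν c M' : ℝ} (hL : 0 < L) (hν : 0 < ν) (hc0 : 0 ≤ c) (hc : 2 * c * (72 * (18 * π)) ≤ π ^ 2 / 4)
    {v : V → V} (hv : MemLp v 2 volume) (hd : DivFreeF v) (hg : Ig (fun ξ => ‖ξ‖ ^ 2) v)
    (hb0 : ∀ i x, |PQ (ind L 0) v i x| ≤ M') (hb : ∀ p, 1 ≤ p → ∀ i x, |PQ (ind L p) v i x| ≤ c * ν * (L * 2 ^ p)) (N : ℕ) :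
    |tri (fun i x => v x i) (fun i x => v x i) (PQ (mN L N) v)| ≤
      2 * π ^ 2 * ν * W (fun ξ => muN L N ξ * ‖ξ‖ ^ 2) v + K0 L ν M' * W (fun ξ => 4 / L ^ 2 * ‖ξ‖ ^ 2 + 1) v := by
  have hM : 0 ≤ M' := (abs_nonneg _).trans (hb0 0 0)
  have hk0 : 0 ≤ K0 L ν M' := by unfold K0; positivity
  have I1 := Ig_bd (v := v) (ω := fun _ => 1) measurable_const (C := 1) (by simp)
  have I2 : Ig (fun ξ => 4 / L ^ 2 * ‖ξ‖ ^ 2 + 1) v := by simpa using hg.lin I1 (4 / L ^ 2) 1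
  have I3 := Ig_mu hL N hg
  have I4 := I3.lin I2 (2 * π ^ 2 * ν) (K0 L ν M')
  have hi : ∀ p, Ig (ind L p) v := fun p => Ig_bd (ind_msk hL p).meas (ind_msk hL p).bd v
  set b : ℕ → ℝ := fun m => if m = 0 then M' else c * ν * L * 2 ^ m with hbdef
  have X := pieces hL hv hd
  have main : ∀ P, N ≤ P → |tri (fun i x => ∑ p ∈ Finset.range P, PQ (ind L p) v i x) (fun i x => ∑ p ∈ Finset.range P, PQ (ind L p) v i x)
      (PQ (mN L N) v)| ≤ 2 * π ^ 2 * ν * W (fun ξ => muN L N ξ * ‖ξ‖ ^ 2) v + K0 L ν M' * W (fun ξ => 4 / L ^ 2 * ‖ξ‖ ^ 2 + 1) v := by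
    intro P hP
    have e := X.est2 (b := b) (n := fun p => nrm (PV (ind L p) v)) (mu := fun p => 4 ^ (min p N))
      (fun p i x => by
        simp only [hbdef]
        split_ifs with h
        · rw [h]; exact hb0 i x
        · have := hb p (by omega) i x; linarith)
      (fun p i => nrm_co (PV_memLp (ind_msk hL p) hv) i) (fun p => by positivity)
      (fun e a hea => by
        have : min e N ≤ min a N + 1 := by omega
        calc (4:ℝ) ^ (min e N) ≤ 4 ^ (min a N + 1) := pow_le_pow_right₀ (by norm_num) this
          _ = _ := by rw [pow_succ]; ring)
      N P (4 ^ N) (fun r hr => by rw [min_eq_right hr]) hP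
    have eq : (fun i x => ∑ r ∈ Finset.range N, ((4:ℝ) ^ N - 4 ^ (min r N)) * PQ (ind L r) v i x) = PQ (mN L N) v := by
      funext i
      have B := BL.sum (Finset.range N) (fun r hr => ((PQ_bl (ind_msk hL r) hv i).cmul (4 ^ N - 4 ^ (min r N))).mono (R' := L * 2 ^ N)
        (by have := Finset.mem_range.1 hr; gcongr; norm_num))
      refine BL.ext B (PQ_bl (mN_msk hL N) hv i) (ae_of_all _ fun ξ => ?_)
      simp only [mN]
      push_cast
      rw [Finset.sum_mul]
      refine Finset.sum_congr rfl fun r hr => ?_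
      rw [min_eq_left (Finset.mem_range.1 hr).le]; push_cast; ring
    rw [eq] at e
    refine e.trans ?_
    have nW : ∀ p, nrm (PV (ind L p) v) ^ 2 = W (ind L p) v := by
      intro p
      have hsq : (fun ξ => ind L p ξ ^ 2) = ind L p := by funext ξ; unfold ind; split_ifs <;> simp
      rw [PV_nrm (ind_msk hL p) hv, hsq, En_eq_W (ind_msk hL p).meas (ind_msk hL p).bd]
    simp only [nW]
    have F := W_fin (n := P) (v := v) (fun a => 72 * (18 * π) * (4 ^ (min a N) * (L * 2 ^ a) * ∑ m ∈ Finset.range (a+1), b m)) hi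
    have : 72 * (18 * π) * ∑ a ∈ Finset.range P, (4:ℝ) ^ (min a N) * (L * 2 ^ a) * (∑ m ∈ Finset.range (a+1), b m) * W (ind L a) v =
        W (fun ξ => ∑ a ∈ Finset.range P, 72 * (18 * π) * (4 ^ (min a N) * (L * 2 ^ a) * ∑ m ∈ Finset.range (a+1), b m) * ind L a ξ) v := by
      rw [F.2, Finset.mul_sum]
      exact Finset.sum_congr rfl fun a _ => by ring
    rw [this, ← W_lin I3 I2]
    refine W_mono F.1 I4 fun ξ => ?_
    obtain ⟨p, hp⟩ := Sh_ex hL ξ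
    rw [ind_sum hL hp]
    have hbs : ∑ m ∈ Finset.range (p+1), b m ≤ M' + 2 * c * ν * (L * 2 ^ p) :=
      (bsum p (by positivity : 0 ≤ c * ν * L)).trans (by linarith)
    have := shell_bd hL hν hc N hp hbs
    split_ifs
    · exact this
    · have := muN_one hL N ξ
      positivity
  have lim : Tendsto (fun P => |tri (fun i x => ∑ p ∈ Finset.range P, PQ (ind L p) v i x) (fun i x => ∑ p ∈ Finset.range P, PQ (ind L p) v i x)
      (PQ (mN L N) v)|) atTop (nhds |tri (fun i x => v x i) (fun i x => v x i) (PQ (mN L N) v)|) := by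
    refine Tendsto.abs (tendsto_finsetSum _ fun i _ => tendsto_finsetSum _ fun j _ => ?_)
    have Bm := (PQ_bl (mN_msk hL N) hv j).pd i
    have sm : ∀ k P, MemLp (fun x => ∑ p ∈ Finset.range P, PQ (ind L p) v k x) 2 volume := fun k P =>
      memLp_finsetSum _ fun p _ => (PQ_bl (ind_msk hL p) hv k).memLp
    exact prod_lim (memLp_co hv i) (memLp_co hv j) (sm i) (sm j) (trunc_lim hL hv i) (trunc_lim hL hv j) Bm.cont.aestronglyMeasurable Bm.bound
  exact le_of_tendsto lim (eventually_atTop.2 ⟨N, main⟩)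

end

section

theorem bd_of_ae {f : V → ℝ} (hf : Continuous f) {A : ℝ} (h : ∀ᵐ x : V, |f x| ≤ A) (x : V) : |f x| ≤ A := by
  have e : (fun x => max |f x| A) =ᵐ[volume] fun _ => A := by
    filter_upwards [h] with x hx
    exact max_eq_right hx
  have := (Continuous.ae_eq_iff_eq volume (hf.abs.max continuous_const) continuous_const).1 e
  have h2 := congrFun this x
  exact max_eq_right_iff.1 h2

theorem piece_bd {k a : ℝ} (ha : 0 ≤ a) (J : ℕ) (hk : k ≤ 2 ^ J) {v : V → V} (hv : MemLp v 2 volume) (i : Fin 3)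
    (hB : besov (-1) (hi k (comp v i)) ≤ ENNReal.ofReal a) (p : ℕ) (hp : 1 ≤ p) (x : V) :
    |PQ (ind (2 ^ J) p) v i x| ≤ a * (2 ^ J * 2 ^ p) := by
  have hL : (0:ℝ) < 2 ^ J := by positivity
  have B := PQ_bl (ind_msk hL p) hv i
  set w := hi k (comp v i)
  have hle : ENNReal.ofReal ((2:ℝ) ^ ((-1:ℝ) * ((J + p : ℕ) : ℝ))) * nInf (Δd ((J + p : ℕ) : ℤ) w) ≤ ENNReal.ofReal a :=
    ((le_iSup (fun j : {j : ℕ // 1 ≤ j} => ENNReal.ofReal ((2:ℝ) ^ ((-1:ℝ) * (j : ℕ))) * nInf (Δd ((j : ℕ) : ℤ) w))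
      ⟨J + p, by omega⟩).trans (le_max_right _ _)).trans hB
  have hmk : MeasurableSet {ξ : V | k ≤ ‖ξ‖} := measurableSet_le measurable_const measurable_norm
  have hw : FT w =ᵐ[volume] _ := FT_of_pair (cut_pair _ hmk (comp v i))
  set j : ℤ := ((J + p : ℕ) : ℤ)
  have ej : (2:ℝ) ^ j = 2 ^ J * 2 ^ p := by
    simp only [j]; rw [zpow_natCast, pow_add]
  have ej1 : (2:ℝ) ^ (j - 1) = 2 ^ J * 2 ^ p / 2 := by
    rw [zpow_sub_one₀ (by norm_num), ej]; rfl
  have hmj : MeasurableSet {ξ : V | (2:ℝ) ^ (j - 1) ≤ ‖ξ‖ ∧ ‖ξ‖ < (2:ℝ) ^ j} :=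
    (measurableSet_le measurable_const measurable_norm).inter (measurableSet_lt measurable_norm measurable_const)
  have p1 : IsFourierPair (Δd j w) (fun ξ => (ind (2 ^ J) p ξ : ℂ) * FT (comp v i) ξ) := by
    refine (cut_pair _ hmj w).congr (ae_eq_refl _) ?_
    filter_upwards [hw] with ξ hξ
    unfold ind
    by_cases h : ξ ∈ Sh (2 ^ J) p
    · have h1 : (2:ℝ) ^ J * 2 ^ p / 2 ≤ ‖ξ‖ := h.1.resolve_left (by omega)
      have hk2 : k ≤ ‖ξ‖ := by
        have : (2:ℝ) ^ 1 ≤ 2 ^ p := pow_le_pow_right₀ (by norm_num) hp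
        nlinarith
      rw [Set.indicator_of_mem (show ξ ∈ {ξ : V | (2:ℝ) ^ (j - 1) ≤ ‖ξ‖ ∧ ‖ξ‖ < (2:ℝ) ^ j} from ⟨by rw [ej1]; exact h1, by rw [ej]; exact h.2⟩), hξ,
        Set.indicator_of_mem (show ξ ∈ {ξ : V | k ≤ ‖ξ‖} from hk2), if_pos h]
      simp
    · rw [Set.indicator_of_notMem (s := {ξ : V | (2:ℝ) ^ (j - 1) ≤ ‖ξ‖ ∧ ‖ξ‖ < (2:ℝ) ^ j}), if_neg h]
      · simp
      · intro h'
        rw [Set.mem_ofPred_eq, ej, ej1] at h'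
        exact h ⟨Or.inr h'.1, h'.2⟩
  have p2 := B.pair.unique_left p1
  have hn : nInf (Δd j w) ≤ ENNReal.ofReal (a * (2 ^ J * 2 ^ p)) := by
    have e2 : (2:ℝ) ^ ((-1:ℝ) * ((J + p : ℕ) : ℝ)) = (2 ^ J * 2 ^ p)⁻¹ := by
      rw [neg_one_mul, Real.rpow_neg (by norm_num), Real.rpow_natCast, pow_add]
    rw [e2] at hle
    have h0 : (0:ℝ) < 2 ^ J * 2 ^ p := by positivity
    rw [ENNReal.ofReal_inv_of_pos h0, mul_comm, ← div_eq_mul_inv,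
      ENNReal.div_le_iff (by simp) ENNReal.ofReal_ne_top, ← ENNReal.ofReal_mul ha] at hle
    exact hle
  refine bd_of_ae B.cont ?_ x
  have h1 : ∀ᵐ y, ‖Δd j w y‖ₑ ≤ nInf (Δd j w) := by
    unfold nInf; rw [eLpNorm_exponent_top]; exact ae_le_eLpNormEssSup
  filter_upwards [h1, p2] with y hy hy2
  have := hy.trans hn
  rw [← hy2, ← ofReal_norm, ENNReal.ofReal_le_ofReal_iff (by positivity), Complex.norm_real] at this
  exact this

theorem gradSq_eq (w : V → V) : gradSq w = EN (fun ξ => ‖ξ‖ ^ 2) w := by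
  unfold gradSq EN
  refine lintegral_congr fun ξ => ?_
  rw [ENNReal.ofReal_pow (norm_nonneg _), ofReal_norm]; rfl

theorem h1Sq_eq (w : V → V) : h1Sq w = EN (fun ξ => 1 + ‖ξ‖ ^ 2) w := by
  unfold h1Sq EN
  refine lintegral_congr fun ξ => ?_
  rw [ENNReal.ofReal_add zero_le_one (sq_nonneg _), ENNReal.ofReal_pow (norm_nonneg _), ofReal_norm, ENNReal.ofReal_one]; rfl

theorem h2Sq_eq (w : V → V) : h2Sq w = EN (fun ξ => (1 + ‖ξ‖ ^ 2) ^ 2) w := by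
  unfold h2Sq EN
  refine lintegral_congr fun ξ => ?_
  rw [ENNReal.ofReal_pow (by positivity), ENNReal.ofReal_add zero_le_one (sq_nonneg _), ENNReal.ofReal_pow (norm_nonneg _), ofReal_norm, ENNReal.ofReal_one]; rfl

theorem grad4_eq (w : V → V) : gradSq4π w = ENNReal.ofReal (4 * π ^ 2) * gradSq w := by
  unfold gradSq4π gradSq
  rw [← lintegral_const_mul' _ _ ENNReal.ofReal_ne_top]
  exact lintegral_congr fun ξ => by rw [mul_assoc]

def gW (u : ℝ → V → V) (s : ℝ) : ℝ := W (fun ξ => ‖ξ‖ ^ 2) (u s)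

theorem gW_nonneg (u : ℝ → V → V) (s : ℝ) : 0 ≤ gW u s := W_nonneg (fun _ => sq_nonneg _) _

theorem grad_ae {ν : ℝ} {u₀ : V → V} {u : ℝ → V → V} (hu : IsLerayHopf ν u₀ u) (hu0 : MemLp u₀ 2 volume) (hd0 : DivFreeF u₀) :
    (∀ᵐ s ∂(volume.restrict (Set.Ioi (0:ℝ))), Ig (fun ξ => ‖ξ‖ ^ 2) (u s) ∧ gradSq (u s) = ENNReal.ofReal (gW u s)) ∧
    IntegrableOn (gW u) (Set.Ioi 0) := by
  have hm : AEMeasurable (fun s => gradSq (u s)) (volume.restrict (Set.Ioi (0:ℝ))) := by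
    simp only [gradSq_eq]
    refine EN_tm hu hu0 hd0 (by fun_prop) (fun _ => sq_nonneg _) (fun ξ => by simp) (fun R => ⟨R ^ 2, fun ξ h => ?_⟩)
    exact pow_le_pow_left₀ (norm_nonneg _) h.le 2
  have A : ∀ᵐ s ∂(volume.restrict (Set.Ioi (0:ℝ))), Ig (fun ξ => ‖ξ‖ ^ 2) (u s) ∧ gradSq (u s) = ENNReal.ofReal (gW u s) := by
    filter_upwards [ae_lt_top' hm hu.gradL2.ne] with s hs
    rw [gradSq_eq] at hs ⊢
    have := Ig_of_EN (by fun_prop) (fun _ => sq_nonneg _) hs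
    exact ⟨this, EN_eq (fun _ => sq_nonneg _) this⟩
  refine ⟨A, ?_⟩
  have e : gW u =ᵐ[volume.restrict (Set.Ioi (0:ℝ))] fun s => (gradSq (u s)).toReal := by
    filter_upwards [A] with s hs
    rw [hs.2, ENNReal.toReal_ofReal (gW_nonneg u s)]
  exact (integrable_toReal_of_lintegral_ne_top hm hu.gradL2.ne).congr e.symm

theorem energy_real {ν : ℝ} (hν : 0 < ν) {u₀ : V → V} {u : ℝ → V → V} (hu : IsLerayHopf ν u₀ u) (hu0 : MemLp u₀ 2 volume) (hd0 : DivFreeF u₀) :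
    ∀ᵐ t ∂(volume.restrict (Set.Ioi (0:ℝ))), nrm (u t) ^ 2 + 8 * π ^ 2 * ν * (∫ s in Set.Ioc 0 t, gW u s) ≤ nrm u₀ ^ 2 := by
  obtain ⟨A, hi⟩ := grad_ae hu hu0 hd0
  filter_upwards [hu.energy, ae_restrict_mem measurableSet_Ioi] with t ht ht0
  have hi' : IntegrableOn (gW u) (Set.Ioc 0 t) := hi.mono_set Set.Ioc_subset_Ioi_self
  have e1 : ∫⁻ τ in Set.Ioc (0:ℝ) t, gradSq4π (u τ) = ENNReal.ofReal (4 * π ^ 2 * ∫ s in Set.Ioc 0 t, gW u s) := by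
    simp only [grad4_eq]
    rw [lintegral_const_mul' _ _ ENNReal.ofReal_ne_top, ENNReal.ofReal_mul (p := 4 * π ^ 2) (by positivity),
      ofReal_integral_eq_lintegral_ofReal hi' (ae_of_all _ (gW_nonneg u))]
    congr 1
    refine lintegral_congr_ae ?_
    filter_upwards [ae_restrict_of_ae_restrict_of_subset Set.Ioc_subset_Ioi_self A] with s hs
    exact hs.2
  have g0 : 0 ≤ ∫ s in Set.Ioc 0 t, gW u s := integral_nonneg (gW_nonneg u)
  have n1 : eLpNorm (u t) 2 volume = ENNReal.ofReal (nrm (u t)) := (ENNReal.ofReal_toReal (hu.memL2 t ht0).eLpNorm_ne_top).symm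
  have n2 : eLpNorm u₀ 2 volume = ENNReal.ofReal (nrm u₀) := (ENNReal.ofReal_toReal hu0.eLpNorm_ne_top).symm
  have n3 : (1/2 : ℝ≥0∞) = ENNReal.ofReal (1/2) := by
    rw [ENNReal.ofReal_div_of_pos (by norm_num)]; simp
  rw [e1, n1, n2, n3, ← ENNReal.ofReal_pow (nrm_nonneg _), ← ENNReal.ofReal_pow (nrm_nonneg _), ← ENNReal.ofReal_mul (p := 1/2) (by norm_num),
    ← ENNReal.ofReal_mul (p := 1/2) (by norm_num), ← ENNReal.ofReal_mul hν.le, ← ENNReal.ofReal_add (by positivity) (by positivity),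
    ENNReal.ofReal_le_ofReal_iff (by positivity)] at ht
  linarith

end

section

def DW (L : ℝ) (N : ℕ) (u : ℝ → V → V) (s : ℝ) : ℝ := W (fun ξ => muN L N ξ * ‖ξ‖ ^ 2) (u s)

theorem DW_nonneg {L : ℝ} (hL : 0 < L) (N : ℕ) (u : ℝ → V → V) (s : ℝ) : 0 ≤ DW L N u s :=
  W_nonneg (fun ξ => mul_nonneg (zero_le_one.trans (muN_one hL N ξ)) (sq_nonneg _)) _

theorem DW_eq {L : ℝ} (hL : 0 < L) (N : ℕ) {u : ℝ → V → V} {s : ℝ} (hg : Ig (fun ξ => ‖ξ‖ ^ 2) (u s)) :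
    DW L N u s = 4 ^ N * gW u s - W (fun ξ => mN L N ξ * ‖ξ‖ ^ 2) (u s) := by
  have hm := (mN_msk hL N).mul_sq
  have := W_lin hg (Ig_bd hm.meas hm.bd (u s)) (4 ^ N) (-1)
  unfold DW gW
  rw [sub_eq_add_neg, ← neg_one_mul, ← this]
  congr 1; funext ξ; unfold muN; ring

theorem WmuN_eq {L : ℝ} (hL : 0 < L) (N : ℕ) {v : V → V} (hv : MemLp v 2 volume) :
    W (muN L N) v = 4 ^ N * nrm v ^ 2 - W (mN L N) v := by
  have hm := mN_msk hL N
  have := W_lin (Ig_bd (v := v) (ω := fun _ => 1) measurable_const (C := 1) (by simp)) (Ig_bd hm.meas hm.bd v) (4 ^ N) (-1)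
  rw [sub_eq_add_neg, ← neg_one_mul, ← W_one hv, ← this]
  congr 1; funext ξ; unfold muN; ring

theorem Ig_muN {L : ℝ} (hL : 0 < L) (N : ℕ) (v : V → V) : Ig (muN L N) v :=
  Ig_bd (muN_meas hL N) (C := 4 ^ N) (fun ξ => by
    rw [abs_of_nonneg (zero_le_one.trans (muN_one hL N ξ))]; exact muN_le hL N ξ) v

theorem muN_h1 {L : ℝ} (hL : 1 ≤ L) (N : ℕ) (ξ : V) : muN L N ξ ≤ 4 * (1 + ‖ξ‖ ^ 2) := by
  have hL0 : 0 < L := by linarith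
  obtain ⟨p, hp⟩ := Sh_ex hL0 ξ
  rw [muN_eq hL0 hp]
  have h1 : (4:ℝ) ^ (min p N) ≤ 4 ^ p := pow_le_pow_right₀ (by norm_num) (min_le_left _ _)
  have h2 : (4:ℝ) ^ p * L ^ 2 = (L * 2 ^ p) ^ 2 := by
    rw [mul_pow, ← pow_mul, mul_comm p 2, pow_mul]; norm_num; ring
  have hs := Sh_sq hL0 hp
  have h3 : (4:ℝ) ^ p ≤ 4 * (1 + ‖ξ‖ ^ 2) := by
    have hL2 : 1 ≤ L ^ 2 := one_le_pow₀ hL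
    by_contra h
    push Not at h
    have : 4 * (1 + ‖ξ‖ ^ 2) * L ^ 2 < 4 ^ p * L ^ 2 := by gcongr
    nlinarith [sq_nonneg ‖ξ‖]
  exact h1.trans h3

theorem muN_low {L : ℝ} (hL : 0 < L) (N : ℕ) {ξ : V} (h : ‖ξ‖ < L * 2 ^ N) : 1 + ‖ξ‖ ^ 2 ≤ (1 + L ^ 2) * muN L N ξ := by
  obtain ⟨p, hp⟩ := Sh_ex hL ξ
  have hpN : p ≤ N := by
    rcases hp.1 with h0 | h0
    · omega
    · by_contra hc
      push Not at hc
      have : (2:ℝ) ^ (N + 1) ≤ 2 ^ p := pow_le_pow_right₀ (by norm_num) hc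
      rw [pow_succ] at this
      nlinarith
  rw [muN_eq hL hp, min_eq_left hpN]
  have h1 : ‖ξ‖ ^ 2 ≤ (L * 2 ^ p) ^ 2 := pow_le_pow_left₀ (norm_nonneg _) hp.2.le 2
  have h2 : (L * 2 ^ p) ^ 2 = L ^ 2 * 4 ^ p := by
    rw [mul_pow, ← pow_mul, mul_comm p 2, pow_mul]; norm_num
  have h3 : (1:ℝ) ≤ 4 ^ p := one_le_pow₀ (by norm_num)
  nlinarith

theorem DW_int {ν : ℝ} {u₀ : V → V} {u : ℝ → V → V} (hu : IsLerayHopf ν u₀ u) (hu0 : MemLp u₀ 2 volume) (hd0 : DivFreeF u₀)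
    {L : ℝ} (hL : 0 < L) (N : ℕ) : IntegrableOn (DW L N u) (Set.Ioi 0) := by
  obtain ⟨A, hi⟩ := grad_ae hu hu0 hd0
  have hm := (mN_msk hL N).mul_sq
  have h0 : ∀ ξ, 0 ≤ mN L N ξ * ‖ξ‖ ^ 2 := fun ξ => mul_nonneg (mN_nonneg hL N ξ) (sq_nonneg _)
  have hW := W_tm hu hu0 hd0 hm h0
  have e : DW L N u =ᵐ[volume.restrict (Set.Ioi (0:ℝ))] fun s => 4 ^ N * gW u s - W (fun ξ => mN L N ξ * ‖ξ‖ ^ 2) (u s) := by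
    filter_upwards [A] with s hs
    exact DW_eq hL N hs.1
  refine Integrable.mono' (hi.const_mul (4 ^ N)) (((hi.1.const_mul (4 ^ N)).sub hW).congr e.symm) ?_
  filter_upwards [e] with s hs
  rw [Real.norm_of_nonneg (DW_nonneg hL N u s), hs]
  linarith [W_nonneg h0 (u s)]

theorem main_bd {ν : ℝ} (hν : 0 < ν) {u₀ : V → V} {u : ℝ → V → V} (hu : IsLerayHopf ν u₀ u) (hu0 : MemLp u₀ 2 volume) (hd0 : DivFreeF u₀)
    {L c M M' T : ℝ} (hL : 0 < L) (hc0 : 0 ≤ c) (hc : 2 * c * (72 * (18 * π)) ≤ π ^ 2 / 4)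
    (hM : ∀ᵐ t ∂(volume.restrict (Set.Ioi (0:ℝ))), nrm (u t) ≤ M)
    (hb : ∀ᵐ s ∂(volume.restrict (Set.Ioo (0:ℝ) T)), (∀ i x, |PQ (ind L 0) (u s) i x| ≤ M') ∧
      ∀ p, 1 ≤ p → ∀ i x, |PQ (ind L p) (u s) i x| ≤ c * ν * (L * 2 ^ p)) (N : ℕ) :
    ∀ᵐ t ∂(volume.restrict (Set.Ioo (0:ℝ) T)), W (muN L N) (u t) + 4 * π ^ 2 * ν * (∫ s in Set.Ioc 0 t, DW L N u s) ≤
      W (muN L N) u₀ + 2 * K0 L ν M' * (4 / L ^ 2 * (∫ s in Set.Ioi 0, gW u s) + M ^ 2 * T) := by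
  obtain ⟨A, hi⟩ := grad_ae hu hu0 hd0
  have hD := DW_int hu hu0 hd0 hL N
  have hmk := mN_msk hL N
  obtain ⟨F1, ⟨K, F2⟩, F3⟩ := W_ident hu hu0 hd0 hmk (mN_nonneg hL N)
  have hE := energy_real hν hu hu0 hd0
  have hk0 : 0 ≤ K0 L ν M' := by unfold K0; positivity
  have sub : Set.Ioo 0 T ⊆ Set.Ioi (0:ℝ) := Set.Ioo_subset_Ioi_self
  have rs : ∀ {P : ℝ → Prop}, (∀ᵐ t ∂(volume.restrict (Set.Ioi (0:ℝ))), P t) → ∀ᵐ t ∂(volume.restrict (Set.Ioo (0:ℝ) T)), P t :=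
    fun h => ae_restrict_of_ae_restrict_of_subset sub h
  set g := gW u
  set F := fun s => Fop ν (u s) (PQ (mN L N) (u s))
  have pt : ∀ᵐ s ∂(volume.restrict (Set.Ioo (0:ℝ) T)), 4 * π ^ 2 * ν * DW L N u s - 2 * K0 L ν M' * (4 / L ^ 2 * g s + M ^ 2) ≤
      4 ^ N * (8 * π ^ 2 * ν) * g s + 2 * F s := by
    filter_upwards [rs A, hb, rs hu.divFree, rs hM, ae_restrict_mem measurableSet_Ioo] with s h1 h2 h3 h4 h5
    have hv := hu.memL2 s h5.1
    have S := slice hL hν hc0 hc hv h3 h1.1 h2.1 h2.2 N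
    have e1 : F s = _ := Fop_eq hmk ν hv
    have e2 := DW_eq hL N h1.1
    have e3 : W (fun ξ => 4 / L ^ 2 * ‖ξ‖ ^ 2 + 1) (u s) = 4 / L ^ 2 * g s + nrm (u s) ^ 2 := by
      have := W_lin h1.1 (Ig_bd (v := u s) (ω := fun _ => 1) measurable_const (C := 1) (by simp)) (4 / L ^ 2) 1
      rw [W_one hv] at this
      simp only [mul_one, one_mul] at this
      exact this
    have e4 : nrm (u s) ^ 2 ≤ M ^ 2 := pow_le_pow_left₀ (nrm_nonneg _) h4 2
    rw [e3] at S
    change _ ≤ 2 * π ^ 2 * ν * DW L N u s + _ at S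
    have S2 := (abs_le.1 S).1
    have e5 : K0 L ν M' * (4 / L ^ 2 * g s + nrm (u s) ^ 2) ≤ K0 L ν M' * (4 / L ^ 2 * g s + M ^ 2) := by gcongr
    have e6 : W (fun ξ => mN L N ξ * ‖ξ‖ ^ 2) (u s) = 4 ^ N * g s - DW L N u s := by rw [e2]; ring
    rw [e1, e6]
    linarith
  filter_upwards [rs F3, rs hE, ae_restrict_mem measurableSet_Ioo] with t h1 h2 h3
  have sub1 : Set.Ioc 0 t ⊆ Set.Ioo 0 T := fun s hs => ⟨hs.1, hs.2.trans_lt h3.2⟩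
  have sub2 : Set.Ioc 0 t ⊆ Set.Ioi 0 := Set.Ioc_subset_Ioi_self
  have ig : IntegrableOn g (Set.Ioc 0 t) := hi.mono_set sub2
  have iD : IntegrableOn (DW L N u) (Set.Ioc 0 t) := hD.mono_set sub2
  have iF : IntegrableOn F (Set.Ioc 0 t) :=
    Integrable.mono' (integrable_const K) (F1.mono_measure (Measure.restrict_mono sub2 le_rfl))
      (ae_restrict_of_ae_restrict_of_subset sub2 F2)
  have ic : IntegrableOn (fun _ : ℝ => M ^ 2) (Set.Ioc 0 t) := integrable_const _
  have i1 : IntegrableOn (fun s => 4 / L ^ 2 * g s + M ^ 2) (Set.Ioc 0 t) := (ig.const_mul _).add ic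
  have mono : ∫ s in Set.Ioc 0 t, (4 * π ^ 2 * ν * DW L N u s - 2 * K0 L ν M' * (4 / L ^ 2 * g s + M ^ 2)) ≤
      ∫ s in Set.Ioc 0 t, (4 ^ N * (8 * π ^ 2 * ν) * g s + 2 * F s) := integral_mono_ae (μ := volume.restrict (Set.Ioc 0 t)) ((iD.const_mul (4 * π ^ 2 * ν)).sub (i1.const_mul (2 * K0 L ν M')))
    ((ig.const_mul (4 ^ N * (8 * π ^ 2 * ν))).add (iF.const_mul 2)) (ae_restrict_of_ae_restrict_of_subset sub1 pt)
  have l1 : ∫ s in Set.Ioc 0 t, (4 * π ^ 2 * ν * DW L N u s - 2 * K0 L ν M' * (4 / L ^ 2 * g s + M ^ 2)) =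
      4 * π ^ 2 * ν * (∫ s in Set.Ioc 0 t, DW L N u s) - 2 * K0 L ν M' * (4 / L ^ 2 * (∫ s in Set.Ioc 0 t, g s) + M ^ 2 * t) := by
    rw [integral_sub (iD.const_mul _) (i1.const_mul _), integral_const_mul, integral_const_mul,
      integral_add (ig.const_mul _) ic, integral_const_mul]
    simp [h3.1.le, mul_comm]
  have l2 : ∫ s in Set.Ioc 0 t, (4 ^ N * (8 * π ^ 2 * ν) * g s + 2 * F s) =
      4 ^ N * (8 * π ^ 2 * ν) * (∫ s in Set.Ioc 0 t, g s) + 2 * ∫ s in Set.Ioc 0 t, F s := by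
    rw [integral_add (ig.const_mul _) (iF.const_mul _), integral_const_mul, integral_const_mul]
  rw [l1, l2] at mono
  have m1 : ∫ s in Set.Ioc 0 t, g s ≤ ∫ s in Set.Ioi 0, g s := setIntegral_mono_set hi (ae_of_all _ (gW_nonneg u)) sub2.eventuallyLE
  have m2 : 2 * K0 L ν M' * (4 / L ^ 2 * (∫ s in Set.Ioc 0 t, g s) + M ^ 2 * t) ≤
      2 * K0 L ν M' * (4 / L ^ 2 * (∫ s in Set.Ioi 0, g s) + M ^ 2 * T) := by
    have := h3.2.le
    gcongr
  have m3 : (4:ℝ) ^ N * (nrm (u t) ^ 2 + 8 * π ^ 2 * ν * ∫ s in Set.Ioc 0 t, g s) ≤ 4 ^ N * nrm u₀ ^ 2 := by gcongr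
  rw [WmuN_eq hL N (hu.memL2 t h3.1), WmuN_eq hL N hu0]
  linarith

end

section

theorem EN_mono {ω ω' : V → ℝ} (h : ∀ ξ, ω ξ ≤ ω' ξ) (v : V → V) : EN ω v ≤ EN ω' v :=
  lintegral_mono fun ξ => mul_le_mul_left (ENNReal.ofReal_le_ofReal (h ξ)) _

theorem Ioo_lim {f : ℝ → ℝ≥0∞} {T : ℝ} (hT : 0 < T) {B : ℝ≥0∞} (h : ∀ t, 0 < t → t < T → ∫⁻ s in Set.Ioc 0 t, f s ≤ B) :
    ∫⁻ s in Set.Ioo 0 T, f s ≤ B := by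
  have mono : Monotone fun n : ℕ => Set.Ioc (0:ℝ) (T - T / (n + 2)) := by
    intro a b hab
    refine Set.Ioc_subset_Ioc_right ?_
    have : (a:ℝ) ≤ b := by exact_mod_cast hab
    have : T / ((b:ℝ) + 2) ≤ T / (a + 2) := by gcongr
    linarith
  have e : Set.Ioo 0 T = ⋃ n : ℕ, Set.Ioc (0:ℝ) (T - T / (n + 2)) := by
    ext x
    simp only [Set.mem_Ioo, Set.mem_iUnion, Set.mem_Ioc]
    constructor
    · rintro ⟨h1, h2⟩
      obtain ⟨n, hn⟩ := exists_nat_gt (T / (T - x))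
      refine ⟨n, h1, ?_⟩
      have h3 : 0 < T - x := by linarith
      rw [div_lt_iff₀ h3] at hn
      have : T / ((n:ℝ) + 2) ≤ T - x := by
        rw [div_le_iff₀ (by positivity)]; nlinarith
      linarith
    · rintro ⟨n, h1, h2⟩
      have : 0 < T / ((n:ℝ) + 2) := by positivity
      exact ⟨h1, by linarith⟩
  rw [e, setLIntegral_iUnion_of_directed _ mono.directed_le]
  refine iSup_le fun n => h _ ?_ ?_
  · have : T / ((n:ℝ) + 2) < T := by
      rw [div_lt_iff₀ (by positivity)]
      have : (0:ℝ) ≤ n := by positivity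
      nlinarith
    linarith
  · have : 0 < T / ((n:ℝ) + 2) := by positivity
    linarith

theorem regular_aux {ν : ℝ} (hν : 0 < ν) {u₀ : V → V} {u : ℝ → V → V} (hu : IsLerayHopf ν u₀ u) (hu0 : MemLp u₀ 2 volume) (hd0 : DivFreeF u₀)
    {L T B : ℝ} (hL : 0 < L) (hT : 0 < T)
    (h : ∀ N, ∀ᵐ t ∂(volume.restrict (Set.Ioo (0:ℝ) T)), W (muN L N) (u t) + 4 * π ^ 2 * ν * (∫ s in Set.Ioc 0 t, DW L N u s) ≤ B) :
    RegularOn u T := by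
  have rs : ∀ {P : ℝ → Prop}, (∀ᵐ t ∂(volume.restrict (Set.Ioi (0:ℝ))), P t) → ∀ᵐ t ∂(volume.restrict (Set.Ioo (0:ℝ) T)), P t :=
    fun h => ae_restrict_of_ae_restrict_of_subset Set.Ioo_subset_Ioi_self h
  have D0 : ∀ N t, 0 ≤ ∫ s in Set.Ioc 0 t, DW L N u s := fun N t => integral_nonneg (DW_nonneg hL N u)
  have mu0 : ∀ N ξ, 0 ≤ muN L N ξ := fun N ξ => zero_le_one.trans (muN_one hL N ξ)
  have hW : ∀ N, ∀ᵐ t ∂(volume.restrict (Set.Ioo (0:ℝ) T)), W (muN L N) (u t) ≤ B := by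
    intro N
    filter_upwards [h N] with t ht
    have : 0 ≤ 4 * π ^ 2 * ν * (∫ s in Set.Ioc 0 t, DW L N u s) := mul_nonneg (by positivity) (D0 N t)
    linarith
  have hr : Monotone fun n : ℕ => L * 2 ^ n := fun a b hab => by
    have : (2:ℝ) ^ a ≤ 2 ^ b := pow_le_pow_right₀ (by norm_num) hab
    exact mul_le_mul_of_nonneg_left this hL.le
  have hr2 : Tendsto (fun n : ℕ => L * 2 ^ n) atTop atTop :=
    (tendsto_pow_atTop_atTop_of_one_lt (by norm_num : (1:ℝ) < 2)).const_mul_atTop hL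
  have B0 : ∀ N, ∀ t, 0 < t → t < T → ∫ s in Set.Ioc 0 t, DW L N u s ≤ B / (4 * π ^ 2 * ν) := by
    intro N t ht0 htT
    have h1 : ∀ᵐ t' ∂(volume.restrict (Set.Ioo t T)), W (muN L N) (u t') + 4 * π ^ 2 * ν * (∫ s in Set.Ioc 0 t', DW L N u s) ≤ B :=
      ae_restrict_of_ae_restrict_of_subset (Set.Ioo_subset_Ioo_left ht0.le) (h N)
    have hne : (ae (volume.restrict (Set.Ioo t T))).NeBot := by
      rw [ae_neBot, Ne, Measure.restrict_eq_zero, Real.volume_Ioo]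
      simpa using htT
    obtain ⟨t', h2, h3⟩ := (h1.and (ae_restrict_mem measurableSet_Ioo)).exists
    have hi := (DW_int hu hu0 hd0 hL N).mono_set (show Set.Ioc 0 t' ⊆ Set.Ioi (0:ℝ) from fun s hs => hs.1)
    have m1 : ∫ s in Set.Ioc 0 t, DW L N u s ≤ ∫ s in Set.Ioc 0 t', DW L N u s :=
      setIntegral_mono_set hi (ae_of_all _ (DW_nonneg hL N u)) (Set.Ioc_subset_Ioc_right h3.1.le).eventuallyLE
    have m2 := W_nonneg (mu0 N) (u t')
    rw [le_div_iff₀ (by positivity)]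
    have : 0 < 4 * π ^ 2 * ν := by positivity
    nlinarith
  constructor
  · refine lt_of_le_of_lt (essSup_le_of_ae_le (ENNReal.ofReal ((1 + L ^ 2) * B)) ?_) ENNReal.ofReal_lt_top
    filter_upwards [ae_all_iff.2 hW] with t ht
    rw [h1Sq_eq, EN_sup (u t) hr hr2]
    refine iSup_le fun N => ?_
    have i1 := (Ig_muN hL N (u t)).lin (Ig_muN hL N (u t)) (1 + L ^ 2) 0
    have w1 := W_lin (Ig_muN hL N (u t)) (Ig_muN hL N (u t)) (1 + L ^ 2) 0
    simp only [zero_mul, add_zero] at i1 w1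
    refine (EN_mono (ω' := fun ξ => (1 + L ^ 2) * muN L N ξ) (fun ξ => ?_) _).trans ?_
    · refine Set.indicator_le' (s := {ξ : V | ‖ξ‖ < L * 2 ^ N}) (fun x hx => muN_low hL N hx) (fun x _ => ?_) ξ
      exact mul_nonneg (by positivity) (mu0 N x)
    · rw [EN_eq (fun ξ => mul_nonneg (by positivity) (mu0 N ξ)) i1, w1]
      have := ht N
      gcongr
  · obtain ⟨A, -⟩ := grad_ae hu hu0 hd0
    have e : ∀ t, h2Sq (u t) = ⨆ N : ℕ, EN ({ξ : V | ‖ξ‖ < L * 2 ^ N}.indicator fun ξ => (1 + ‖ξ‖ ^ 2) ^ 2) (u t) := fun t => by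
      rw [h2Sq_eq, EN_sup (u t) hr hr2]
    simp only [e]
    have q0 : ∀ ξ : V, 0 ≤ (1 + ‖ξ‖ ^ 2) ^ 2 := fun ξ => sq_nonneg _
    rw [lintegral_iSup']
    · refine lt_of_le_of_lt (iSup_le (a := ENNReal.ofReal (1 + L ^ 2) * (ENNReal.ofReal B * ENNReal.ofReal T + ENNReal.ofReal (B / (4 * π ^ 2 * ν)))) fun N => ?_) ?_
      · have step : ∀ᵐ t ∂(volume.restrict (Set.Ioo (0:ℝ) T)), EN ({ξ : V | ‖ξ‖ < L * 2 ^ N}.indicator fun ξ => (1 + ‖ξ‖ ^ 2) ^ 2) (u t) ≤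
            ENNReal.ofReal (1 + L ^ 2) * (ENNReal.ofReal B + ENNReal.ofReal (DW L N u t)) := by
          filter_upwards [hW N, rs A] with t h1 h2
          have i1 := (Ig_muN hL N (u t)).lin (Ig_mu hL N h2.1) (1 + L ^ 2) (1 + L ^ 2)
          have w1 := W_lin (Ig_muN hL N (u t)) (Ig_mu hL N h2.1) (1 + L ^ 2) (1 + L ^ 2)
          have p0 : ∀ ξ : V, 0 ≤ (1 + L ^ 2) * muN L N ξ + (1 + L ^ 2) * (muN L N ξ * ‖ξ‖ ^ 2) := fun ξ => by
            have := mu0 N ξ; positivity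
          refine (EN_mono (fun ξ => ?_) _).trans ((EN_eq p0 i1).trans_le ?_)
          · refine Set.indicator_le' (s := {ξ : V | ‖ξ‖ < L * 2 ^ N}) (fun x hx => ?_) (fun x _ => p0 x) ξ
            have := muN_low hL N hx
            have h3 : 0 ≤ ‖x‖ ^ 2 := sq_nonneg _
            nlinarith
          · rw [w1, ← ENNReal.ofReal_add ((W_nonneg (mu0 N) (u t)).trans h1) (DW_nonneg hL N u t), ← ENNReal.ofReal_mul (by positivity)]
            refine ENNReal.ofReal_le_ofReal ?_
            rw [← mul_add]
            have : W (muN L N) (u t) + W (fun ξ => muN L N ξ * ‖ξ‖ ^ 2) (u t) ≤ B + DW L N u t := by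
              unfold DW; linarith
            gcongr
        refine (lintegral_mono_ae step).trans ?_
        rw [lintegral_const_mul' _ _ ENNReal.ofReal_ne_top, lintegral_add_left measurable_const]
        refine mul_le_mul_right (add_le_add ?_ ?_) _
        · rw [lintegral_const, Measure.restrict_apply_univ, Real.volume_Ioo, sub_zero]
        · refine Ioo_lim hT fun t h1 h2 => ?_
          have hi := (DW_int hu hu0 hd0 hL N).mono_set (show Set.Ioc 0 t ⊆ Set.Ioi (0:ℝ) from fun s hs => hs.1)
          rw [← ofReal_integral_eq_lintegral_ofReal hi (ae_of_all _ (DW_nonneg hL N u))]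
          exact ENNReal.ofReal_le_ofReal (B0 N t h1 h2)
      · exact ENNReal.mul_lt_top ENNReal.ofReal_lt_top (ENNReal.add_lt_top.2 ⟨ENNReal.mul_lt_top ENNReal.ofReal_lt_top ENNReal.ofReal_lt_top, ENNReal.ofReal_lt_top⟩)
    · intro N
      refine AEMeasurable.mono_measure (EN_tm hu hu0 hd0 ?_ ?_ ?_ ?_) (Measure.restrict_mono Set.Ioo_subset_Ioi_self le_rfl)
      · exact Measurable.indicator (by fun_prop) (measurableSet_lt measurable_norm measurable_const)
      · exact fun ξ => Set.indicator_nonneg (fun x _ => q0 x) ξ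
      · intro ξ; unfold Set.indicator; simp
      · refine fun R => ⟨(1 + R ^ 2) ^ 2, fun ξ hξ => ?_⟩
        refine (Set.indicator_le_self' (s := {ξ : V | ‖ξ‖ < L * 2 ^ N}) (fun x _ => q0 x) ξ).trans ?_
        gcongr
    · refine ae_of_all _ fun t a b hab => EN_mono (fun ξ => ?_) _
      exact Set.indicator_le_indicator_of_subset (fun x hx => lt_of_lt_of_le (show ‖x‖ < L * 2 ^ a from hx) (hr hab)) q0 ξ

end

/-- There is an absolute constant `c > 0` such that smallness
`‖(u(t))^k‖_{B^{-1}_{∞,∞}} ≤ cν` for a.e. `t ∈ (0,T)`, for some `k > 0`, implies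
regularity in `(0,T]`. -/
theorem regular_of_small_highFrequency_Besov :
    ∃ c : ℝ, 0 < c ∧
      ∀ (ν : ℝ), 0 < ν → ∀ u₀ : V → V,
        MemLp u₀ 2 volume → DivFreeF u₀ → h1Sq u₀ < ⊤ →
        ∀ u : ℝ → V → V, IsLerayHopf ν u₀ u → ∀ T : ℝ, 0 < T →
        (∃ k : ℝ, 0 < k ∧ ∀ᵐ t ∂(volume.restrict (Set.Ioo (0:ℝ) T)),
            (⨆ i : Fin 3, besov (-1) (hi k (comp (u t) i))) ≤ ENNReal.ofReal (c * ν)) →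
        RegularOn u T := by
  refine ⟨1 / 10368, by norm_num, ?_⟩
  intro ν hν u₀ hu0 hd0 hh u hu T hT ⟨k, hk, hB⟩
  obtain ⟨J, hJ⟩ := pow_unbounded_of_one_lt k (one_lt_two (α := ℝ))
  obtain ⟨M, hM0, hM⟩ := LH_bound hu
  have hL1 : (1:ℝ) ≤ 2 ^ J := one_le_pow₀ (by norm_num)
  have hL : (0:ℝ) < 2 ^ J := by positivity
  have hc : 2 * (1 / 10368) * (72 * (18 * π)) ≤ π ^ 2 / 4 := by nlinarith [Real.pi_gt_three]
  have hb : ∀ᵐ s ∂(volume.restrict (Set.Ioo (0:ℝ) T)), (∀ i x, |PQ (ind (2 ^ J) 0) (u s) i x| ≤ CR (2 ^ J * 2 ^ 0) * (1 * M)) ∧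
      ∀ p, 1 ≤ p → ∀ i x, |PQ (ind (2 ^ J) p) (u s) i x| ≤ 1 / 10368 * ν * (2 ^ J * 2 ^ p) := by
    filter_upwards [hB, ae_restrict_of_ae_restrict_of_subset Set.Ioo_subset_Ioi_self hM, ae_restrict_mem measurableSet_Ioo] with s h1 h2 h3
    have hv := hu.memL2 s h3.1
    refine ⟨fun i x => ?_, fun p hp i x => ?_⟩
    · have Bq := PQ_bl (ind_msk hL 0) hv i
      refine (Bq.bound x).trans (mul_le_mul_of_nonneg_left ((PQ_nrm (ind_msk hL 0) hv i).trans (by gcongr)) ?_)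
      unfold CR; positivity
    · exact piece_bd (by positivity) J hJ.le hv i ((le_iSup (fun i => besov (-1) (hi k (comp (u s) i))) i).trans h1) p hp x
  have i0 : Ig (fun ξ => 1 + ‖ξ‖ ^ 2) u₀ := Ig_of_EN (by fun_prop) (fun ξ => by positivity) (by rw [← h1Sq_eq]; exact hh)
  have w0 : ∀ N, W (muN (2 ^ J) N) u₀ ≤ 4 * W (fun ξ => 1 + ‖ξ‖ ^ 2) u₀ := by
    intro N
    have i1 := i0.lin i0 4 0
    have w1 := W_lin i0 i0 4 0
    simp only [zero_mul, add_zero] at i1 w1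
    rw [← w1]
    exact W_mono (Ig_muN hL N u₀) i1 (muN_h1 hL1 N)
  refine regular_aux hν hu hu0 hd0 hL hT (B := 4 * W (fun ξ => 1 + ‖ξ‖ ^ 2) u₀ + 2 * K0 (2 ^ J) ν (CR (2 ^ J * 2 ^ 0) * (1 * M)) *
    (4 / (2 ^ J) ^ 2 * (∫ s in Set.Ioi 0, gW u s) + M ^ 2 * T)) fun N => ?_
  filter_upwards [main_bd hν hu hu0 hd0 hL (by norm_num) hc hM hb N] with t ht
  exact ht.trans (add_le_add_left (w0 N) _)

end NSE
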